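/- arXiv:2312.16334 — 7 statements merged into one kernel-verified Lean document; each statement's English description precedes it below -/
import Mathlib

section
/- For every integer d ≥ 1 there exists a natural number n = n(d) with the following property: every compact connected topological d-manifold M without boundary can be written as a union M = U_1 ∪ … ∪ U_n of n open sets such that every connected component of every U_i is an open collared ball, i.e., for each component C of U_i there is an open embedding e : ℝ^d → M with C = e(B), where B is the open unit ball of ℝ^d. -/
open Topology

open Metric in
theorem sep_family {M : Type} [MetricSpace M] [CompactSpace M] {κ : Type} [Finite κ]
    (F : κ → Set (Set M)) (hfin : ∀ i, (F i).Finite) (hcl : ∀ i, ∀ A ∈ F i, IsClosed A)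
    (hdisj : ∀ i, ∀ A ∈ F i, ∀ B ∈ F i, A ≠ B → Disjoint A B) :
    ∃ δ > 0, ∀ i, ∀ A ∈ F i, ∀ B ∈ F i, A ≠ B →
      Disjoint (thickening δ A) (thickening δ B) := by
  have h : ∀ᶠ δ : ℝ in 𝓝[>] 0, ∀ i, ∀ A ∈ F i, ∀ B ∈ F i, A ≠ B →
      Disjoint (thickening δ A) (thickening δ B) := by
    rw [Filter.eventually_all]
    intro i
    rw [Filter.eventually_all_finite (hfin i)]
    intro A hA
    rw [Filter.eventually_all_finite (hfin i)]
    intro B hB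
    by_cases hAB : A = B
    · simp [hAB]
    obtain ⟨δ, hδ, hd⟩ := (hdisj i A hA B hB hAB).exists_thickenings
      (hcl i A hA).isCompact (hcl i B hB)
    filter_upwards [Ioo_mem_nhdsGT hδ] with r hr _
    exact hd.mono (thickening_mono hr.2.le _) (thickening_mono hr.2.le _)
  obtain ⟨δ, h1, h2⟩ := (h.and self_mem_nhdsWithin).exists
  exact ⟨δ, h2, h1⟩

/-- `K` can be covered by `κ`-many finite disjoint families of small closed sets. -/
def SmallDim (κ : Type) {M : Type} [MetricSpace M] (K : Set M) : Prop :=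
  ∀ ε > 0, ∃ F : κ → Set (Set M), (∀ i, (F i).Finite) ∧ (∀ i, ∀ A ∈ F i, IsClosed A) ∧
    (∀ i, ∀ A ∈ F i, ∀ x ∈ A, ∀ y ∈ A, dist x y ≤ ε) ∧
    (∀ i, ∀ A ∈ F i, ∀ B ∈ F i, A ≠ B → Disjoint A B) ∧
    (∀ x ∈ K, ∃ i, ∃ A ∈ F i, x ∈ A)

open Metric in
theorem SmallDim.union {κ : Type} [Finite κ] {M : Type} [MetricSpace M] [CompactSpace M]
    {K L : Set M} (hK : SmallDim κ K) (hL : SmallDim κ L) : SmallDim κ (K ∪ L) := by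
  intro ε hε
  obtain ⟨F, Ffin, Fcl, Fdiam, Fdisj, Fcov⟩ := hL (ε / 3) (by positivity)
  obtain ⟨δ, hδ, hsep⟩ := sep_family F Ffin Fcl Fdisj
  obtain ⟨G, Gfin, Gcl, Gdiam, Gdisj, Gcov⟩ := hK (min (ε / 3) (δ / 2)) (by positivity)
  have key : ∀ i, ∀ A ∈ F i, ∀ B ∈ F i, ∀ U ∈ G i, (U ∩ A).Nonempty → (U ∩ B).Nonempty →
      A = B := by
    rintro i A hA B hB U hU ⟨a, haU, ha⟩ ⟨b, hbU, hb⟩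
    by_contra hne
    have h1 := (Gdiam i U hU b hbU a haU).trans (min_le_right _ _)
    refine (Set.disjoint_left.1 (hsep i A hA B hB hne) : ∀ ⦃a⦄, _) (?_ : b ∈ _) ?_
    · exact mem_thickening_iff.2 ⟨a, ha, by linarith⟩
    · exact self_subset_thickening hδ _ hb
  let m : κ → Set M → Set M := fun i A => A ∪ ⋃₀ {U ∈ G i | (U ∩ A).Nonempty}
  have hm : ∀ i A x, x ∈ m i A ↔ x ∈ A ∨ ∃ U ∈ G i, (U ∩ A).Nonempty ∧ x ∈ U := by
    intro i A x
    simp [m, and_assoc]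
  have near : ∀ i, ∀ A ∈ F i, ∀ x ∈ m i A, ∃ a ∈ A, dist x a ≤ ε / 3 := by
    intro i A hA x hx
    rcases (hm _ _ _).1 hx with hx | ⟨U, hU, ⟨a, haU, haA⟩, hxU⟩
    · exact ⟨x, hx, by simp; positivity⟩
    · exact ⟨a, haA, (Gdiam i U hU x hxU a haU).trans (min_le_left _ _)⟩
  have dmm : ∀ i, ∀ A ∈ F i, ∀ B ∈ F i, A ≠ B → Disjoint (m i A) (m i B) := by
    intro i A hA B hB hne
    rw [Set.disjoint_left]
    intro x hxA hxB
    rcases (hm _ _ _).1 hxA with hx | ⟨U, hU, hUA, hxU⟩ <;>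
      rcases (hm _ _ _).1 hxB with hx' | ⟨V, hV, hVB, hxV⟩
    · exact Set.disjoint_left.1 (Fdisj i A hA B hB hne) hx hx'
    · exact hne (key i A hA B hB V hV ⟨x, hxV, hx⟩ hVB)
    · exact hne (key i A hA B hB U hU hUA ⟨x, hxU, hx'⟩)
    · have : U = V := by
        by_contra h
        exact Set.disjoint_left.1 (Gdisj i U hU V hV h) hxU hxV
      subst this
      exact hne (key i A hA B hB U hU hUA hVB)
  have dmu : ∀ i, ∀ A ∈ F i, ∀ U ∈ G i, (∀ A ∈ F i, ¬ (U ∩ A).Nonempty) →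
      Disjoint (m i A) U := by
    intro i A hA U hU hn
    rw [Set.disjoint_left]
    intro x hxA hxU
    rcases (hm _ _ _).1 hxA with hx | ⟨V, hV, hVA, hxV⟩
    · exact hn A hA ⟨x, hxU, hx⟩
    · have : U = V := by
        by_contra h
        exact Set.disjoint_left.1 (Gdisj i U hU V hV h) hxU hxV
      subst this
      exact hn A hA hVA
  refine ⟨fun i => (m i '' F i) ∪ {U ∈ G i | ∀ A ∈ F i, ¬ (U ∩ A).Nonempty}, ?_, ?_, ?_, ?_, ?_⟩
  · intro i
    exact ((Ffin i).image _).union ((Gfin i).subset (Set.sep_subset _ _))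
  · rintro i _ (⟨A, hA, rfl⟩ | ⟨hU, -⟩)
    · refine (Fcl i A hA).union ?_
      rw [Set.sUnion_eq_biUnion]
      refine ((Gfin i).subset (Set.sep_subset _ _)).isClosed_biUnion ?_
      intro U hU
      exact Gcl i U hU.1
    · exact Gcl i _ hU
  · rintro i _ (⟨A, hA, rfl⟩ | ⟨hU, -⟩) x hx y hy
    · obtain ⟨a, ha, hxa⟩ := near i A hA x hx
      obtain ⟨b, hb, hyb⟩ := near i A hA y hy
      have h1 := Fdiam i A hA a ha b hb
      have h2 := dist_triangle4 x a b y
      rw [dist_comm b y] at h2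
      linarith
    · have := (Gdiam i _ hU x hx y hy).trans (min_le_left _ _)
      linarith
  · rintro i _ (⟨A, hA, rfl⟩ | ⟨hU, hU'⟩) _ (⟨B, hB, rfl⟩ | ⟨hV, hV'⟩) hne
    · exact dmm i A hA B hB (fun h => hne (by rw [h]))
    · exact dmu i A hA _ hV hV'
    · exact (dmu i B hB _ hU hU').symm
    · exact Gdisj i _ hU _ hV hne
  · rintro x (hx | hx)
    · obtain ⟨i, U, hU, hxU⟩ := Gcov x hx
      by_cases h : ∃ A ∈ F i, (U ∩ A).Nonempty
      · obtain ⟨A, hA, hUA⟩ := h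
        exact ⟨i, m i A, Or.inl ⟨A, hA, rfl⟩, (hm _ _ _).2 (Or.inr ⟨U, hU, hUA, hxU⟩)⟩
      · push Not at h
        exact ⟨i, U, Or.inr ⟨hU, fun A hA => by simp [h A hA]⟩, hxU⟩
    · obtain ⟨i, A, hA, hxA⟩ := Fcov x hx
      exact ⟨i, m i A, Or.inl ⟨A, hA, rfl⟩, (hm _ _ _).2 (Or.inl hxA)⟩

/-- The set of colours. -/
abbrev Col (d : ℕ) : Type := Fin d → ZMod (2 * d + 1)

open Metric in
theorem lattice_cover (d : ℕ) (hd : 1 ≤ d) (Q : Set (EuclideanSpace ℝ (Fin d)))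
    (hQ : IsCompact Q) (η : ℝ) (hη : 0 < η) :
    ∃ r > 0, r ≤ η ∧ ∃ C : Col d → Set (EuclideanSpace ℝ (Fin d)),
      (∀ i, (C i).Finite) ∧ (∀ i, ∀ x ∈ C i, ∀ y ∈ C i, x ≠ y → 2 * r < dist x y) ∧
      (∀ x ∈ Q, ∃ i, ∃ c ∈ C i, x ∈ ball c r) := by
  have hd' : (1 : ℝ) ≤ d := by exact_mod_cast hd
  set s : ℝ := η / d with hs
  have hs0 : 0 < s := by positivity
  have hsd : d * s = η := by rw [hs]; field_simp
  let p : (Fin d → ℤ) → EuclideanSpace ℝ (Fin d) := fun z => WithLp.toLp 2 (fun j => s * z j)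
  have hp : ∀ z j, p z j = s * z j := fun z j => rfl
  have coord : ∀ (v : EuclideanSpace ℝ (Fin d)) j, |v j| ≤ ‖v‖ := fun v j =>
    by simpa using PiLp.norm_apply_le v j
  have cov : ∀ x : EuclideanSpace ℝ (Fin d), ∃ z, x ∈ ball (p z) η := by
    intro x
    refine ⟨fun j => round (x j / s), ?_⟩
    rw [mem_ball, dist_eq_norm]
    have h1 : ∀ j, |(x - p fun j => round (x j / s)) j| ≤ s / 2 := by
      intro j
      have h2 := abs_sub_round (x j / s)
      have h3 : (x - p fun j => round (x j / s)) j = s * (x j / s - round (x j / s)) := by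
        rw [PiLp.sub_apply, hp]; field_simp
      rw [h3, abs_mul, abs_of_pos hs0]
      nlinarith
    have h4 : ‖x - p fun j => round (x j / s)‖ ≤ d * (s / 2) := by
      rw [EuclideanSpace.norm_eq]
      apply Real.sqrt_le_iff.2
      refine ⟨by positivity, ?_⟩
      calc ∑ j, ‖(x - p fun j => round (x j / s)) j‖ ^ 2 ≤ ∑ j : Fin d, (s / 2) ^ 2 := by
            apply Finset.sum_le_sum
            intro j _
            rw [Real.norm_eq_abs]
            exact pow_le_pow_left₀ (abs_nonneg _) (h1 j) 2
        _ = d * (s / 2) ^ 2 := by simp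
        _ ≤ (d * (s / 2)) ^ 2 := by
            rw [mul_pow]
            have : (d : ℝ) ≤ d ^ 2 := by nlinarith
            gcongr
    linarith [mul_div_assoc (d : ℝ) s 2]
  obtain ⟨t, ht⟩ := hQ.elim_finite_subcover (fun z => ball (p z) η) (fun z => isOpen_ball)
    (fun x _ => Set.mem_iUnion.2 (cov x))
  refine ⟨η, hη, le_rfl, fun i => p '' {z | z ∈ t ∧ (fun j => (z j : ZMod (2 * d + 1))) = i},
    ?_, ?_, ?_⟩
  · intro i
    exact (t.finite_toSet.subset (fun z hz => hz.1)).image _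
  · rintro i _ ⟨z, ⟨-, hz⟩, rfl⟩ _ ⟨w, ⟨-, hw⟩, rfl⟩ hne
    have : ∃ j, z j ≠ w j := by
      by_contra h
      push Not at h
      exact hne (by rw [funext h])
    obtain ⟨j, hj⟩ := this
    have h1 : ((z j : ℤ) : ZMod (2 * d + 1)) = w j := congrFun (hz.trans hw.symm) j
    rw [ZMod.intCast_eq_intCast_iff_dvd_sub] at h1
    have h2 : ((2 * d + 1 : ℕ) : ℤ) ≤ |w j - z j| :=
      Int.le_of_dvd (abs_pos.2 (sub_ne_zero.2 hj.symm)) ((dvd_abs _ _).2 h1)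
    have h3 : (2 * d + 1 : ℝ) ≤ |(w j : ℝ) - z j| := by exact_mod_cast h2
    have h4 := coord (p w - p z) j
    rw [PiLp.sub_apply, hp, hp, ← mul_sub, abs_mul, abs_of_pos hs0] at h4
    rw [dist_comm, dist_eq_norm]
    nlinarith
  · intro x hx
    obtain ⟨z, hz, hxz⟩ := Set.mem_iUnion₂.1 (ht hx)
    exact ⟨_, p z, ⟨z, ⟨hz, rfl⟩, rfl⟩, hxz⟩

open Metric in
theorem smallDim_chart {d : ℕ} (hd : 1 ≤ d) {M : Type} [MetricSpace M]
    (φ : EuclideanSpace ℝ (Fin d) → M) (hφ : IsOpenEmbedding φ)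
    (Q : Set (EuclideanSpace ℝ (Fin d))) (hQ : IsCompact Q) : SmallDim (Col d) (φ '' Q) := by
  intro ε hε
  have huc := hQ.uniformContinuousOn_of_continuous hφ.continuous.continuousOn
  obtain ⟨η, hη, huc⟩ := Metric.uniformContinuousOn_iff_le.1 huc ε hε
  obtain ⟨r, hr, hrη, C, Cfin, Csep, Ccov⟩ := lattice_cover d hd Q hQ (η / 2) (by positivity)
  refine ⟨fun i => (fun c => φ '' (closedBall c r ∩ Q)) '' C i, ?_, ?_, ?_, ?_, ?_⟩
  · exact fun i => (Cfin i).image _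
  · rintro i _ ⟨c, hc, rfl⟩
    exact ((hQ.inter_left isClosed_closedBall).image hφ.continuous).isClosed
  · rintro i _ ⟨c, hc, rfl⟩ _ ⟨x, ⟨hx, hxQ⟩, rfl⟩ _ ⟨y, ⟨hy, hyQ⟩, rfl⟩
    apply huc x hxQ y hyQ
    rw [mem_closedBall] at hx hy
    linarith [dist_triangle_right x y c]
  · rintro i _ ⟨c, hc, rfl⟩ _ ⟨c', hc', rfl⟩ hne
    have hcc : c ≠ c' := fun h => hne (by rw [h])
    have := Csep i c hc c' hc' hcc
    apply Set.disjoint_image_of_injective hφ.injective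
    exact (closedBall_disjoint_closedBall (by linarith)).mono
      Set.inter_subset_left Set.inter_subset_left
  · rintro _ ⟨x, hx, rfl⟩
    obtain ⟨i, c, hc, hxc⟩ := Ccov x hx
    exact ⟨i, _, ⟨c, hc, rfl⟩, x, ⟨ball_subset_closedBall hxc, hx⟩, rfl⟩

theorem component_of_disjoint {M : Type} [TopologicalSpace M] (𝒱 : Set (Set M))
    (ho : ∀ V ∈ 𝒱, IsOpen V) (hc : ∀ V ∈ 𝒱, IsPreconnected V)
    (hd : ∀ V ∈ 𝒱, ∀ W ∈ 𝒱, V ≠ W → Disjoint V W) (V : Set M) (hV : V ∈ 𝒱) (x : M) (hx : x ∈ V) :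
    connectedComponentIn (⋃₀ 𝒱) x = V := by
  apply Set.Subset.antisymm
  · have hsub : connectedComponentIn (⋃₀ 𝒱) x ⊆ V ∪ ⋃₀ (𝒱 \ {V}) := by
      refine (connectedComponentIn_subset _ _).trans ?_
      rintro y ⟨W, hW, hy⟩
      by_cases h : W = V
      · exact Or.inl (h ▸ hy)
      · exact Or.inr ⟨W, ⟨hW, h⟩, hy⟩
    refine isPreconnected_connectedComponentIn.subset_left_of_subset_union (ho V hV)
      (isOpen_sUnion fun W hW => ho W hW.1) ?_ hsub
      ⟨x, mem_connectedComponentIn ⟨V, hV, hx⟩, hx⟩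
    rw [Set.disjoint_sUnion_right]
    rintro W ⟨hW, hne⟩
    exact hd V hV W hW (fun h => hne h.symm)
  · exact (hc V hV).subset_connectedComponentIn hx (Set.subset_sUnion_of_mem hV)

open Metric Pointwise in
theorem ball_embedding {d : ℕ} {M : Type} [TopologicalSpace M]
    (φ : EuclideanSpace ℝ (Fin d) → M) (hφ : IsOpenEmbedding φ)
    (c : EuclideanSpace ℝ (Fin d)) (r : ℝ) (hr : 0 < r) :
    ∃ e : EuclideanSpace ℝ (Fin d) → M, IsOpenEmbedding e ∧
      φ '' ball c r = e '' ball (0 : EuclideanSpace ℝ (Fin d)) 1 := by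
  let h : EuclideanSpace ℝ (Fin d) ≃ₜ EuclideanSpace ℝ (Fin d) :=
    (Homeomorph.smulOfNeZero r hr.ne').trans (Homeomorph.addLeft c)
  refine ⟨φ ∘ h, hφ.comp h.isOpenEmbedding, ?_⟩
  rw [Set.image_comp]
  congr 1
  have : (h : EuclideanSpace ℝ (Fin d) → _) = (fun x => c +ᵥ x) ∘ (fun x => r • x) := rfl
  rw [this, Set.image_comp, Set.image_smul, smul_unitBall_of_pos hr, Set.image_vadd]
  simp

open Metric in
theorem main_aux {d : ℕ} (hd : 1 ≤ d) {M : Type} [MetricSpace M] [CompactSpace M]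
    (hM : ∀ x : M, ∃ φ : EuclideanSpace ℝ (Fin d) → M, IsOpenEmbedding φ ∧ x ∈ Set.range φ) :
    ∃ U : Col d × Col d → Set M, (∀ i, IsOpen (U i)) ∧ (⋃ i, U i) = Set.univ ∧
      (∀ i, ∀ x ∈ U i, ∃ e : EuclideanSpace ℝ (Fin d) → M, IsOpenEmbedding e ∧
        connectedComponentIn (U i) x = e '' ball (0 : EuclideanSpace ℝ (Fin d)) 1) := by
  choose φ hφ hxφ using hM
  choose o ho using hxφ
  have hdim : SmallDim (Col d) (Set.univ : Set M) := by
    refine isCompact_univ.induction_on (p := SmallDim (Col d)) ?_ ?_ ?_ ?_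
    · intro ε hε
      exact ⟨fun _ => ∅, by simp, by simp, by simp, by simp, by simp⟩
    · intro s t hst ht ε hε
      obtain ⟨F, h1, h2, h3, h4, h5⟩ := ht ε hε
      exact ⟨F, h1, h2, h3, h4, fun x hx => h5 x (hst hx)⟩
    · intro s t hs ht
      exact hs.union ht
    · intro x _
      refine ⟨φ x '' closedBall (o x) 1, ?_, smallDim_chart hd _ (hφ x) _ (isCompact_closedBall _ _)⟩
      rw [nhdsWithin_univ]
      have := (hφ x).isOpenMap.image_mem_nhds (closedBall_mem_nhds (o x) one_pos)
      rwa [ho] at this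
  obtain ⟨ε, hε, hleb⟩ := lebesgue_number_lemma_of_metric (isCompact_univ (X := M))
    (c := fun x => Set.range (φ x)) (fun x => (hφ x).isOpen_range)
    (fun x _ => Set.mem_iUnion.2 ⟨x, o x, ho x⟩)
  obtain ⟨F, Ffin, Fcl, Fdiam, Fdisj, Fcov⟩ := hdim (ε / 2) (by positivity)
  obtain ⟨δ, hδ, hsep⟩ := sep_family F Ffin Fcl Fdisj
  -- local data
  have local_data : ∀ i, ∀ A ∈ F i, ∃ 𝒱 : Col d → Set (Set M),
      (∀ k, ∀ V ∈ 𝒱 k, IsOpen V ∧ IsPreconnected V ∧ V ⊆ thickening δ A ∧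
        ∃ e : EuclideanSpace ℝ (Fin d) → M, IsOpenEmbedding e ∧
          V = e '' ball (0 : EuclideanSpace ℝ (Fin d)) 1) ∧
      (∀ k, ∀ V ∈ 𝒱 k, ∀ W ∈ 𝒱 k, V ≠ W → Disjoint V W) ∧
      (∀ x ∈ A, ∃ k, ∃ V ∈ 𝒱 k, x ∈ V) := by
    intro i A hA
    rcases A.eq_empty_or_nonempty with rfl | ⟨a, ha⟩
    · exact ⟨fun _ => ∅, by simp, by simp, by simp⟩
    obtain ⟨y, hy⟩ := hleb a (Set.mem_univ a)
    have hAy : A ⊆ Set.range (φ y) := fun x hx => hy (by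
      rw [mem_ball]
      linarith [Fdiam i A hA x hx a ha])
    set Q := φ y ⁻¹' A with hQdef
    have hQ : IsCompact Q :=
      (hφ y).isInducing.isCompact_preimage' (Fcl i A hA).isCompact hAy
    have hOo : IsOpen (φ y ⁻¹' thickening δ A) := isOpen_thickening.preimage (hφ y).continuous
    obtain ⟨η, hη, hηsub⟩ := hQ.exists_thickening_subset_open hOo
      (Set.preimage_mono (self_subset_thickening hδ A))
    obtain ⟨r, hr, hrη, C, Cfin, Csep, Ccov⟩ := lattice_cover d hd Q hQ (η / 2) (by positivity)
    refine ⟨fun k => (fun c => φ y '' ball c r) '' {c ∈ C k | (ball c r ∩ Q).Nonempty}, ?_, ?_, ?_⟩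
    · rintro k _ ⟨c, ⟨hc, q, hqc, hqQ⟩, rfl⟩
      refine ⟨(hφ y).isOpenMap _ isOpen_ball,
        ((convex_ball c r).isPreconnected).image _ (hφ y).continuous.continuousOn, ?_,
        ball_embedding _ (hφ y) c r hr⟩
      rintro _ ⟨x, hx, rfl⟩
      apply hηsub
      rw [mem_ball] at hx hqc
      exact mem_thickening_iff.2 ⟨q, hqQ, by linarith [dist_triangle_right x q c]⟩
    · rintro k _ ⟨c, ⟨hc, -⟩, rfl⟩ _ ⟨c', ⟨hc', -⟩, rfl⟩ hne
      have hcc : c ≠ c' := fun h => hne (by rw [h])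
      have := Csep k c hc c' hc' hcc
      exact Set.disjoint_image_of_injective (hφ y).injective
        (ball_disjoint_ball (by linarith))
    · intro x hx
      obtain ⟨x', rfl⟩ := hAy hx
      obtain ⟨k, c, hc, hxc⟩ := Ccov x' hx
      exact ⟨k, _, ⟨c, ⟨hc, x', hxc, hx⟩, rfl⟩, x', hxc, rfl⟩
  choose! 𝒱 h1 h2 h3 using local_data
  let 𝒲 : Col d × Col d → Set (Set M) := fun p => {V | ∃ A ∈ F p.1, V ∈ 𝒱 p.1 A p.2}
  have hcomp : ∀ p, ∀ V ∈ 𝒲 p, ∀ x ∈ V, connectedComponentIn (⋃₀ 𝒲 p) x = V := by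
    intro p V hV x hx
    refine component_of_disjoint (𝒲 p) ?_ ?_ ?_ V hV x hx
    · rintro V ⟨A, hA, hV⟩
      exact (h1 _ A hA _ V hV).1
    · rintro V ⟨A, hA, hV⟩
      exact (h1 _ A hA _ V hV).2.1
    · rintro V ⟨A, hA, hV⟩ W ⟨B, hB, hW⟩ hne
      by_cases hAB : A = B
      · subst hAB
        exact h2 _ A hA _ V hV W hW hne
      · exact (hsep _ A hA B hB hAB).mono (h1 _ A hA _ V hV).2.2.1 (h1 _ B hB _ W hW).2.2.1
  refine ⟨fun p => ⋃₀ 𝒲 p, ?_, ?_, ?_⟩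
  · intro p
    apply isOpen_sUnion
    rintro V ⟨A, hA, hV⟩
    exact (h1 _ A hA _ V hV).1
  · rw [Set.eq_univ_iff_forall]
    intro x
    obtain ⟨i, A, hA, hx⟩ := Fcov x (Set.mem_univ x)
    obtain ⟨k, V, hV, hxV⟩ := h3 i A hA x hx
    exact Set.mem_iUnion.2 ⟨(i, k), V, ⟨A, hA, hV⟩, hxV⟩
  · rintro p x ⟨V, hV, hx⟩
    rw [hcomp p V hV x hx]
    obtain ⟨A, hA, hV⟩ := hV
    exact (h1 _ A hA _ V hV).2.2.2

/-- For every integer `d ≥ 1` there exists `n = n(d)` such that every compact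
connected topological `d`-manifold without boundary can be covered by `n` open sets, each of
whose connected components is an open collared ball `e(B)` for some open embedding
`e : ℝ^d → M`. -/
theorem stmt_0 :
    ∀ d : ℕ, 1 ≤ d → ∃ n : ℕ,
      ∀ (M : Type) [TopologicalSpace M] [CompactSpace M] [ConnectedSpace M] [T2Space M]
        [SecondCountableTopology M] [Nonempty M],
        (∀ x : M, ∃ U : Set M, IsOpen U ∧ x ∈ U ∧
          Nonempty (U ≃ₜ EuclideanSpace ℝ (Fin d))) →
        ∃ U : Fin n → Set M,
          (∀ i, IsOpen (U i)) ∧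
          (⋃ i, U i) = Set.univ ∧
          (∀ i, ∀ x ∈ U i, ∃ e : EuclideanSpace ℝ (Fin d) → M,
            IsOpenEmbedding e ∧
            connectedComponentIn (U i) x = e '' Metric.ball (0 : EuclideanSpace ℝ (Fin d)) 1) := by
  intro d hd
  obtain ⟨n, ⟨g⟩⟩ := Finite.exists_equiv_fin (Col d × Col d)
  refine ⟨n, ?_⟩
  intro M _ _ _ _ _ _ hM
  letI : MetricSpace M := TopologicalSpace.metrizableSpaceMetric M
  obtain ⟨U, h1, h2, h3⟩ := main_aux hd (M := M) (by
    intro x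
    obtain ⟨U, hU, hx, ⟨h⟩⟩ := hM x
    refine ⟨Subtype.val ∘ h.symm, hU.isOpenEmbedding_subtypeVal.comp h.symm.isOpenEmbedding,
      h ⟨x, hx⟩, by simp⟩)
  refine ⟨fun i => U (g.symm i), fun i => h1 _, ?_, fun i => h3 _⟩
  rw [← h2]
  exact g.symm.surjective.iUnion_comp U
end

section
/- For every integer d ≥ 1 there exists a natural number n = n(d) with the following property: every compact connected topological d-manifold M without boundary is the union of n open subsets, each of which equals e(B) for some open embedding e : ℝ^d → M, where B is the open unit ball of ℝ^d. -/
open Topology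

namespace BallCover

set_option linter.unusedSectionVars false

open Set Metric Filter

/-! ### Homeomorphisms supported in a chart ball -/

section ext

variable {E M : Type*} [NormedAddCommGroup E] [NormedSpace ℝ E] [ProperSpace E]
  [TopologicalSpace M] [CompactSpace M] [T2Space M]

lemma exists_ext {g : E → M} (hg : IsOpenEmbedding g) {f : E → E} (hf : Continuous f)
    (hb : Function.Bijective f) (hid : ∀ x, 1 ≤ ‖x‖ → f x = x) :
    ∃ h : M ≃ₜ M, (∀ x, h (g x) = g (f x)) ∧ ∀ y, y ∉ g '' ball 0 1 → h y = y := by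
  classical
  set h : M → M := Function.extend g (g ∘ f) id with hh
  have h1 : ∀ x, h (g x) = g (f x) := fun x => hg.injective.extend_apply _ _ x
  have h2 : ∀ y, y ∉ range g → h y = y := fun y hy => by
    rw [hh, Function.extend_apply']
    · rfl
    · exact hy
  have h3 : ∀ y, y ∉ g '' ball 0 1 → h y = y := by
    intro y hy
    by_cases hr : y ∈ range g
    · obtain ⟨x, rfl⟩ := hr
      rw [h1, hid]
      by_contra hx
      exact hy ⟨x, by simpa using hx, rfl⟩
    · exact h2 y hr
  have hc : Continuous h := by
    rw [continuous_iff_continuousAt]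
    intro y
    by_cases hr : y ∈ range g
    · obtain ⟨x, rfl⟩ := hr
      rw [← hg.continuousAt_iff]
      have : h ∘ g = g ∘ f := funext h1
      rw [this]
      exact (hg.continuous.comp hf).continuousAt
    · have hcl : IsClosed (g '' closedBall 0 1) :=
        ((isCompact_closedBall 0 1).image hg.continuous).isClosed
      have hy : y ∈ (g '' closedBall 0 1)ᶜ := by
        rintro ⟨x, -, rfl⟩
        exact hr ⟨x, rfl⟩
      have : h =ᶠ[𝓝 y] id := by
        filter_upwards [hcl.isOpen_compl.mem_nhds hy] with z hz
        exact h3 z (fun hz' => hz (image_mono ball_subset_closedBall hz'))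
      exact continuousAt_id.congr this.symm
  have hbij : Function.Bijective h := by
    constructor
    · intro a b hab
      by_cases ha : a ∈ range g <;> by_cases hb' : b ∈ range g
      · obtain ⟨x, rfl⟩ := ha
        obtain ⟨y, rfl⟩ := hb'
        rw [h1, h1] at hab
        rw [hb.1 (hg.injective hab)]
      · obtain ⟨x, rfl⟩ := ha
        rw [h1, h2 b hb'] at hab
        exact absurd ⟨_, hab⟩ hb'
      · obtain ⟨y, rfl⟩ := hb'
        rw [h1, h2 a ha] at hab
        exact absurd ⟨_, hab.symm⟩ ha
      · rwa [h2 a ha, h2 b hb'] at hab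
    · intro b
      by_cases hb' : b ∈ range g
      · obtain ⟨y, rfl⟩ := hb'
        obtain ⟨x, rfl⟩ := hb.2 y
        exact ⟨g x, h1 x⟩
      · exact ⟨b, h2 b hb'⟩
  refine ⟨Continuous.homeoOfEquivCompactToT2 (f := Equiv.ofBijective h hbij) hc, h1, h3⟩

/-- The radial squaring map. -/
noncomputable def sq (x : E) : E := min 1 ‖x‖ • x

lemma sq_continuous : Continuous (sq : E → E) := by
  unfold sq; fun_prop

lemma sq_norm (x : E) : ‖sq x‖ = min 1 ‖x‖ * ‖x‖ := by
  rw [sq, norm_smul, Real.norm_of_nonneg (by positivity)]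

lemma sq_id (x : E) (hx : 1 ≤ ‖x‖) : sq x = x := by
  simp [sq, hx]

lemma sq_bij : Function.Bijective (sq : E → E) := by
  constructor
  · intro x y hxy
    have hn : ‖x‖ = ‖y‖ := by
      have h := congrArg norm hxy
      rw [sq_norm, sq_norm] at h
      have hx := norm_nonneg x
      have hy := norm_nonneg y
      rcases le_total 1 ‖x‖ with h1 | h1 <;> rcases le_total 1 ‖y‖ with h2 | h2 <;>
        simp only [h1, h2, min_eq_left, min_eq_right] at h <;> nlinarith
    by_cases h0 : ‖y‖ = 0
    · rw [norm_eq_zero.1 h0, norm_eq_zero.1 (hn.trans h0)]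
    · have h0' : 0 < ‖y‖ := lt_of_le_of_ne (norm_nonneg _) (Ne.symm h0)
      simp only [sq, hn] at hxy
      exact smul_right_injective E (lt_min one_pos h0').ne' hxy
  · intro y
    rcases le_total 1 ‖y‖ with h1 | h1
    · exact ⟨y, sq_id y h1⟩
    by_cases h0 : ‖y‖ = 0
    · exact ⟨y, by simp [sq, norm_eq_zero.1 h0]⟩
    have h0' : 0 < ‖y‖ := lt_of_le_of_ne (norm_nonneg _) (Ne.symm h0)
    have hs : 0 < √‖y‖ := Real.sqrt_pos.2 h0'
    have hss : √‖y‖ * √‖y‖ = ‖y‖ := Real.mul_self_sqrt h0'.le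
    have hn : ‖(√‖y‖)⁻¹ • y‖ = √‖y‖ := by
      rw [norm_smul, Real.norm_of_nonneg (by positivity)]
      field_simp
      nlinarith
    refine ⟨(√‖y‖)⁻¹ • y, ?_⟩
    have h1' : √‖y‖ ≤ 1 := by
      rw [Real.sqrt_le_left zero_le_one]
      simpa using h1
    rw [sq, hn, min_eq_right h1', smul_smul, mul_inv_cancel₀ hs.ne', one_smul]

lemma exists_shrink {g : E → M} (hg : IsOpenEmbedding g) {W : Set M} (hW : IsOpen W)
    (h0 : g 0 ∈ W) :
    ∃ h : M ≃ₜ M, h (g 0) = g 0 ∧ (∀ y ∈ g '' closedBall 0 (3/4), h y ∈ W) ∧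
      ∀ y, y ∉ g '' ball 0 1 → h y = y := by
  have hn : g ⁻¹' W ∈ 𝓝 (0 : E) := (hW.preimage hg.continuous).mem_nhds h0
  obtain ⟨ε, hε, hsub⟩ := Metric.mem_nhds_iff.1 hn
  obtain ⟨k, hk⟩ := exists_pow_lt_of_lt_one hε (show (3/4 : ℝ) < 1 by norm_num)
  have hid : ∀ n x, 1 ≤ ‖x‖ → (sq : E → E)^[n] x = x := by
    intro n x hx
    exact Function.iterate_fixed (sq_id x hx) n
  obtain ⟨h, h1, h2⟩ := exists_ext hg (sq_continuous.iterate k) (sq_bij.iterate k) (hid k)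
  have hb : ∀ (n : ℕ) (x : E), ‖x‖ ≤ 3/4 → ‖(sq : E → E)^[n] x‖ ≤ (3/4) ^ (n+1) := by
    intro n x hx
    induction n with
    | zero => simpa using hx
    | succ n ih =>
      rw [Function.iterate_succ_apply', sq_norm]
      set r := ‖(sq : E → E)^[n] x‖
      have hr0 : 0 ≤ r := norm_nonneg _
      have hp : ((3/4 : ℝ)) ^ (n+1) ≤ 3/4 := by
        rw [pow_succ]
        have : (3/4 : ℝ)^n ≤ 1 := pow_le_one₀ (by norm_num) (by norm_num)
        nlinarith
      calc min 1 r * r ≤ r * r := by gcongr; exact min_le_right _ _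
        _ ≤ (3/4)^(n+1) * (3/4) := by gcongr; exact ih.trans hp
        _ = _ := by rw [pow_succ _ (n+1)]
  refine ⟨h, ?_, ?_, h2⟩
  · rw [h1, Function.iterate_fixed]
    simp [sq]
  · rintro _ ⟨x, hx, rfl⟩
    rw [h1]
    apply hsub
    rw [mem_ball_zero_iff]
    refine (hb k x (by simpa using hx)).trans_lt (lt_of_le_of_lt ?_ hk)
    exact pow_le_pow_of_le_one (by norm_num) (by norm_num) (Nat.le_succ k)

lemma exists_push {g : E → M} (hg : IsOpenEmbedding g) {v : E} (hv : ‖v‖ < 1) :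
    ∃ h : M ≃ₜ M, h (g 0) = g v ∧ ∀ y, y ∉ g '' ball 0 1 → h y = y := by
  have hl : ∀ x y : E, |max 0 (1 - ‖x‖) - max 0 (1 - ‖y‖)| ≤ ‖x - y‖ := by
    intro x y
    have h1 : |max (1 - ‖x‖) 0 - max (1 - ‖y‖) 0| ≤ |(1 - ‖x‖) - (1 - ‖y‖)| :=
      abs_max_sub_max_le_abs _ _ _
    rw [max_comm 0, max_comm 0]
    refine h1.trans ?_
    have h2 := abs_norm_sub_norm_le y x
    rw [norm_sub_rev x y]
    have h3 : (1 - ‖x‖) - (1 - ‖y‖) = ‖y‖ - ‖x‖ := by ring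
    rw [h3]
    exact h2
  have hfc : Continuous (fun x : E => x + max 0 (1 - ‖x‖) • v) := by fun_prop
  suffices hbij : Function.Bijective (fun x : E => x + max 0 (1 - ‖x‖) • v) by
    obtain ⟨h, h1, h2⟩ := exists_ext hg hfc hbij (fun x hx => by simp [hx])
    exact ⟨h, by simp [h1], h2⟩
  · constructor
    · intro x y hxy
      simp only at hxy
      have h3 : x - y = (max 0 (1 - ‖y‖) - max 0 (1 - ‖x‖)) • v := by
        rw [sub_smul, sub_eq_sub_iff_add_eq_add, hxy, add_comm]
      have h4 := congrArg norm h3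
      rw [norm_smul, Real.norm_eq_abs] at h4
      have h5 := hl y x
      rw [norm_sub_rev] at h5
      have h6 := norm_nonneg (x - y)
      have h7 : ‖x - y‖ ≤ ‖x - y‖ * ‖v‖ := by
        calc _ = _ := h4
          _ ≤ _ := by gcongr
      have h8 : ‖x - y‖ = 0 := by nlinarith
      exact sub_eq_zero.1 (norm_eq_zero.1 h8)
    · intro y
      have hcon : ContractingWith ⟨‖v‖, norm_nonneg v⟩
          (fun x : E => y - max 0 (1 - ‖x‖) • v) := by
        refine ⟨by exact_mod_cast hv, LipschitzWith.of_dist_le_mul ?_⟩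
        intro a b
        rw [dist_eq_norm, dist_eq_norm, sub_sub_sub_cancel_left, ← sub_smul, norm_smul,
          Real.norm_eq_abs, mul_comm]
        have := hl b a
        rw [norm_sub_rev] at this
        exact mul_le_mul_of_nonneg_left this (norm_nonneg v)
      have := hcon.fixedPoint_isFixedPt
      refine ⟨ContractingWith.fixedPoint _ hcon, ?_⟩
      rw [Function.IsFixedPt] at this
      simp only at this ⊢
      nth_rewrite 1 [← this]
      abel

end ext

/-! ### Good sets and engulfing -/

/-- Sets of the form `e(B)`. -/
def Good (d : ℕ) {M : Type*} [TopologicalSpace M] (W : Set M) : Prop :=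
  ∃ e : EuclideanSpace ℝ (Fin d) → M, IsOpenEmbedding e ∧ W = e '' ball 0 1

section engulf

variable {d : ℕ} {M : Type*} [TopologicalSpace M]

lemma Good.isOpen {W : Set M} (h : Good d W) : IsOpen W := by
  obtain ⟨e, he, rfl⟩ := h
  exact he.isOpenMap _ isOpen_ball

lemma Good.nonempty {W : Set M} (h : Good d W) : W.Nonempty := by
  obtain ⟨e, he, rfl⟩ := h
  exact ⟨e 0, 0, by simp, rfl⟩

lemma Good.preimage {W : Set M} (h : Good d W) (f : M ≃ₜ M) : Good d (f ⁻¹' W) := by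
  obtain ⟨e, he, rfl⟩ := h
  refine ⟨f.symm ∘ e, f.symm.isOpenEmbedding.comp he, ?_⟩
  rw [image_comp, ← f.image_symm]

/-- Every point is the center of a chart. -/
def Locally (d : ℕ) (M : Type*) [TopologicalSpace M] : Prop :=
  ∀ x : M, ∃ e : (Fin d → ℝ) → M, IsOpenEmbedding e ∧ e 0 = x

/-- Affine reparametrization of a chart. -/
lemma reparam {e : (Fin d → ℝ) → M} (he : IsOpenEmbedding e) (c : Fin d → ℝ) {δ : ℝ}
    (hδ : 0 < δ) : IsOpenEmbedding (fun x => e (c + δ • x)) := by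
  have h1 : IsOpenEmbedding (fun x : Fin d → ℝ => c + δ • x) :=
    (Homeomorph.addLeft c).isOpenEmbedding.comp (Homeomorph.smulOfNeZero δ hδ.ne').isOpenEmbedding
  exact he.comp h1

variable [CompactSpace M] [T2Space M] [ConnectedSpace M]

lemma exists_good (hM : Locally d M) : ∃ W : Set M, Good d W := by
  obtain ⟨x⟩ := (inferInstance : Nonempty M)
  obtain ⟨e, he, -⟩ := hM x
  exact ⟨_, e ∘ (EuclideanSpace.equiv (Fin d) ℝ),
    he.comp (EuclideanSpace.equiv (Fin d) ℝ).toHomeomorph.isOpenEmbedding, rfl⟩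

lemma exists_good_finset (hM : Locally d M) (F : Set M) (hF : F.Finite) :
    ∃ W : Set M, Good d W ∧ F ⊆ W := by
  induction F, hF using Set.Finite.induction_on with
  | empty =>
    obtain ⟨W, hW⟩ := exists_good (d := d) hM
    exact ⟨W, hW, empty_subset _⟩
  | @insert a F ha hF ih =>
    obtain ⟨W₀, hW₀, hFW₀⟩ := ih
    let A : Set M := {x | ∃ W : Set M, Good d W ∧ F ⊆ W ∧ x ∈ W}
    have hAo : IsOpen A := by
      rw [isOpen_iff_mem_nhds]
      rintro x ⟨W, hW, hFW, hx⟩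
      filter_upwards [hW.isOpen.mem_nhds hx] with y hy
      exact ⟨W, hW, hFW, hy⟩
    have hAc : IsClosed A := by
      rw [← closure_subset_iff_isClosed]
      intro x hx
      by_cases hxF : x ∈ F
      · exact ⟨W₀, hW₀, hFW₀, hFW₀ hxF⟩
      obtain ⟨e, he, rfl⟩ := hM x
      have hn : e ⁻¹' Fᶜ ∈ 𝓝 (0 : Fin d → ℝ) :=
        (hF.isClosed.isOpen_compl.preimage he.continuous).mem_nhds hxF
      obtain ⟨ε, hε, hsub⟩ := Metric.mem_nhds_iff.1 hn
      have hg := reparam he 0 hε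
      set g : (Fin d → ℝ) → M := fun x => e (0 + ε • x) with hgdef
      have hg0 : g 0 = e 0 := by simp [hgdef]
      have hgF : ∀ y ∈ F, y ∉ g '' ball 0 1 := by
        rintro _ hy ⟨v, hv, rfl⟩
        refine hsub ?_ hy
        rw [mem_ball_zero_iff] at hv ⊢
        rw [zero_add, norm_smul, Real.norm_of_nonneg hε.le]
        nlinarith
      have hmem : g '' ball 0 1 ∈ 𝓝 (e 0) :=
        (hg.isOpenMap _ isOpen_ball).mem_nhds ⟨0, by simp, hg0⟩
      obtain ⟨_, ⟨v, hv, rfl⟩, W, hW, hFW, hvW⟩ := mem_closure_iff_nhds.1 hx _ hmem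
      obtain ⟨h, h1, h2⟩ := exists_push hg (v := v) (by simpa using hv)
      refine ⟨h ⁻¹' W, hW.preimage h, fun y hy => ?_, ?_⟩
      · rw [mem_preimage, h2 y (hgF y hy)]
        exact hFW hy
      · rw [mem_preimage, ← hg0, h1]
        exact hvW
    have hne : A.Nonempty := by
      obtain ⟨x, hx⟩ := hW₀.nonempty
      exact ⟨x, W₀, hW₀, hFW₀, hx⟩
    have hA : A = univ := IsClopen.eq_univ ⟨hAc, hAo⟩ hne
    obtain ⟨W, hW, hFW, haW⟩ : a ∈ A := hA ▸ mem_univ a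
    exact ⟨W, hW, insert_subset haW hFW⟩

lemma engulf (hM : Locally d M) {σ : Type*} [Finite σ] (g : σ → (Fin d → ℝ) → M)
    (hg : ∀ s, IsOpenEmbedding (g s))
    (hdis : ∀ s t, s ≠ t → Disjoint (g s '' ball 0 1) (g t '' ball 0 1)) :
    ∃ W : Set M, Good d W ∧ ∀ s, g s '' closedBall 0 (3/4) ⊆ W := by
  classical
  haveI := Fintype.ofFinite σ
  have key : ∀ S : Finset σ, ∃ W : Set M, Good d W ∧ (∀ s, g s 0 ∈ W) ∧
      ∀ s ∈ S, g s '' closedBall 0 (3/4) ⊆ W := by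
    intro S
    induction S using Finset.induction_on with
    | empty =>
      obtain ⟨W, hW, h⟩ := exists_good_finset hM (range fun s => g s 0) (finite_range _)
      exact ⟨W, hW, fun s => h ⟨s, rfl⟩, by simp⟩
    | @insert a S ha ih =>
      obtain ⟨W, hW, h0, hS⟩ := ih
      obtain ⟨h, h1, h2, h3⟩ := exists_shrink (hg a) hW.isOpen (h0 a)
      have hout : ∀ s, s ≠ a → ∀ x ∈ ball (0 : Fin d → ℝ) 1, h (g s x) = g s x := by
        intro s hs x hx
        exact h3 _ (disjoint_left.1 (hdis s a hs) ⟨x, hx, rfl⟩)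
      refine ⟨h ⁻¹' W, hW.preimage h, fun s => ?_, fun s hs => ?_⟩
      · by_cases hsa : s = a
        · subst hsa
          rw [mem_preimage, h1]
          exact h0 s
        · rw [mem_preimage, hout s hsa 0 (by simp)]
          exact h0 s
      · by_cases hsa : s = a
        · subst hsa
          exact h2
        · rintro _ ⟨x, hx, rfl⟩
          rw [mem_preimage, hout s hsa x (closedBall_subset_ball (by norm_num) hx)]
          exact hS s ((Finset.mem_insert.1 hs).resolve_left hsa) ⟨x, hx, rfl⟩
  obtain ⟨W, hW, -, h⟩ := key Finset.univ
  exact ⟨W, hW, fun s => h s (Finset.mem_univ s)⟩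

end engulf

/-! ### Cubes -/

/-- The set of colours. -/
abbrev Col (d : ℕ) := Fin d → ZMod 2

/-- The colour of a lattice point. -/
def col {d : ℕ} (z : Fin d → ℤ) : Col d := fun i => (z i : ZMod 2)

section cubes

variable {d : ℕ} {M : Type*} [TopologicalSpace M]

lemma lattice_sep {z z' : Fin d → ℤ} (hc : col z = col z') (hne : z ≠ z') :
    ∃ i, (2 : ℝ) ≤ |(z i : ℝ) - z' i| := by
  obtain ⟨i, hi⟩ := Function.ne_iff.1 hne
  refine ⟨i, ?_⟩
  have h1 : ((z i : ℤ) : ZMod 2) = (z' i : ℤ) := congrFun hc i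
  rw [ZMod.intCast_eq_intCast_iff_dvd_sub] at h1
  have h2 : (2 : ℤ) ≤ |z i - z' i| := by
    have h3 : ((2 : ℕ) : ℤ) ∣ |z i - z' i| := by
      rw [dvd_abs, ← neg_sub, dvd_neg]
      exact h1
    refine Int.le_of_dvd (abs_pos.2 (sub_ne_zero.2 hi)) (by exact_mod_cast h3)
  exact_mod_cast h2

lemma cubes {e : (Fin d → ℝ) → M} (he : IsOpenEmbedding e) {K : Set M} (hK : IsCompact K)
    (hKe : K ⊆ range e) (P : Set M → Prop) (hP : ∀ x ∈ K, ∀ᶠ s in (𝓝 x).smallSets, P s) :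
    ∃ (T : Finset (Fin d → ℤ)) (g : (Fin d → ℤ) → (Fin d → ℝ) → M),
      (∀ z, IsOpenEmbedding (g z)) ∧ (∀ z, range (g z) ⊆ range e) ∧
      (∀ z ∈ T, P (g z '' ball 0 1)) ∧
      (∀ z z', col z = col z' → z ≠ z' → Disjoint (g z '' ball 0 1) (g z' '' ball 0 1)) ∧
      K ⊆ ⋃ z ∈ T, g z '' closedBall 0 (3/4) := by
  classical
  have hK' : IsCompact (e ⁻¹' K) := he.isInducing.isCompact_preimage' hK hKe
  have hU : ∀ x : Fin d → ℝ, ∃ U ∈ 𝓝 x, x ∈ e ⁻¹' K → ∀ s ⊆ U, P (e '' s) := by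
    intro x
    by_cases hx : x ∈ e ⁻¹' K
    · obtain ⟨U, hU, hUP⟩ := eventually_smallSets.1 (hP _ hx)
      exact ⟨e ⁻¹' U, he.continuous.continuousAt hU,
        fun _ s hs => hUP _ (image_subset_iff.2 hs)⟩
    · exact ⟨univ, univ_mem, fun h => absurd h hx⟩
  choose U hUn hUP using hU
  obtain ⟨ε, hε, hleb⟩ : ∃ ε > 0, ∀ x ∈ e ⁻¹' K, ∃ y ∈ e ⁻¹' K, ball x ε ⊆ U y := by
    obtain ⟨ε, hε, h⟩ := lebesgue_number_lemma_of_metric (ι := e ⁻¹' K)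
      (c := fun y => interior (U y)) hK' (fun _ => isOpen_interior)
      (fun x hx => mem_iUnion.2 ⟨⟨x, hx⟩, mem_interior_iff_mem_nhds.2 (hUn x)⟩)
    refine ⟨ε, hε, fun x hx => ?_⟩
    obtain ⟨y, hy⟩ := h x hx
    exact ⟨y, y.2, hy.trans interior_subset⟩
  set δ := ε / 2 with hδdef
  have hδ : 0 < δ := by positivity
  set p : (Fin d → ℤ) → Fin d → ℝ := fun z i => δ * z i with hp
  have hcov : e ⁻¹' K ⊆ ⋃ z, ball (p z) (3/4 * δ) := by
    intro x _
    refine mem_iUnion.2 ⟨fun i => round (x i / δ), ?_⟩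
    rw [mem_ball, dist_pi_lt_iff (by positivity)]
    intro i
    have h1 := abs_sub_round (x i / δ)
    have h2 : x i - δ * round (x i / δ) = δ * (x i / δ - round (x i / δ)) := by
      field_simp
    rw [Real.dist_eq, hp]
    simp only
    rw [h2, abs_mul, abs_of_pos hδ]
    nlinarith
  obtain ⟨T₀, hT₀⟩ := hK'.elim_finite_subcover _ (fun z => isOpen_ball) hcov
  let T := T₀.filter fun z => (e ⁻¹' K ∩ ball (p z) (3/4 * δ)).Nonempty
  have himg : ∀ z, (fun x => e (p z + δ • x)) '' ball 0 1 ⊆ e '' ball (p z) δ := by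
    rintro z _ ⟨x, hx, rfl⟩
    refine ⟨_, ?_, rfl⟩
    rw [mem_ball_zero_iff] at hx
    rw [mem_ball_iff_norm, add_sub_cancel_left, norm_smul, Real.norm_of_nonneg hδ.le]
    nlinarith
  refine ⟨T, fun z x => e (p z + δ • x), fun z => reparam he (p z) hδ, ?_, ?_, ?_, ?_⟩
  · rintro z _ ⟨x, rfl⟩
    exact ⟨_, rfl⟩
  · intro z hz
    obtain ⟨-, x, hxK, hx⟩ := Finset.mem_filter.1 hz
    obtain ⟨y, hyK, hy⟩ := hleb x hxK
    have : (fun x => e (p z + δ • x)) '' ball 0 1 =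
        e '' ((fun x => p z + δ • x) '' ball 0 1) := by
      rw [image_image]
    rw [this]
    refine hUP y hyK _ (Subset.trans ?_ hy)
    rintro _ ⟨w, hw, rfl⟩
    rw [mem_ball_zero_iff] at hw
    rw [mem_ball] at hx ⊢
    have h1 : dist (p z + δ • w) (p z) < δ := by
      rw [dist_eq_norm, add_sub_cancel_left, norm_smul, Real.norm_of_nonneg hδ.le]
      nlinarith
    have h2 := dist_triangle_right (p z + δ • w) x (p z)
    linarith
  · intro z z' hc hne
    refine Disjoint.mono (himg z) (himg z') ?_
    rw [disjoint_image_iff he.injective]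
    apply ball_disjoint_ball
    obtain ⟨i, hi⟩ := lattice_sep hc hne
    refine le_trans ?_ (dist_le_pi_dist (p z) (p z') i)
    rw [Real.dist_eq, hp]
    simp only
    rw [← mul_sub, abs_mul, abs_of_pos hδ]
    nlinarith
  · intro y hy
    obtain ⟨x, rfl⟩ := hKe hy
    obtain ⟨z, hz, hx⟩ := mem_iUnion₂.1 (hT₀ hy)
    refine mem_iUnion₂.2 ⟨z, Finset.mem_filter.2 ⟨hz, x, hy, hx⟩, δ⁻¹ • (x - p z), ?_, ?_⟩
    · rw [mem_ball_iff_norm] at hx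
      rw [mem_closedBall_zero_iff, norm_smul, Real.norm_of_nonneg (by positivity),
        inv_mul_le_iff₀ hδ]
      linarith
    · simp only
      rw [smul_smul, mul_inv_cancel₀ hδ.ne', one_smul, add_sub_cancel]

end cubes

/-! ### Monochromatic sets -/

/-- Being contained in a chart. -/
def InChart (d : ℕ) {M : Type*} [TopologicalSpace M] (N : Set M) : Prop :=
  ∃ e : (Fin d → ℝ) → M, IsOpenEmbedding e ∧ N ⊆ range e

/-- Sets covered by a finite family of closed sets with pairwise disjoint open neighborhoods
contained in charts. -/
def Mono (d : ℕ) {M : Type} [TopologicalSpace M] (S : Set M) : Prop :=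
  ∃ (ι : Type) (_ : Finite ι) (K N : ι → Set M), (∀ i, IsClosed (K i)) ∧ (∀ i, IsOpen (N i)) ∧
    (∀ i, K i ⊆ N i) ∧ (∀ i j, i ≠ j → Disjoint (N i) (N j)) ∧ (∀ i, InChart d (N i)) ∧
    S ⊆ ⋃ i, K i

section mono

variable {d : ℕ} {M : Type} [TopologicalSpace M] [CompactSpace M] [T2Space M]

lemma mono_empty : Mono d (∅ : Set M) :=
  ⟨Empty, inferInstance, fun _ => ∅, fun _ => ∅, nofun, nofun, nofun, nofun, nofun,
    empty_subset _⟩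

lemma mono_step {S : Set M} (hS : Mono d S) :
    ∃ P : Set M → Prop, (∀ x, ∀ᶠ s in (𝓝 x).smallSets, P s) ∧
      ∀ (τ : Type) (_ : Finite τ) (Q Q' : τ → Set M), (∀ z, IsClosed (Q z)) →
        (∀ z, IsOpen (Q' z)) → (∀ z, Q z ⊆ Q' z) → (∀ z z', z ≠ z' → Disjoint (Q' z) (Q' z')) →
        (∀ z, InChart d (Q' z)) → (∀ z, P (Q' z)) → Mono d (S ∪ ⋃ z, Q z) := by
  classical
  obtain ⟨ι, hι, K, N, hK, hN, hKN, hdis, hch, hSK⟩ := hS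
  have hN1 : ∀ i, ∃ V, IsOpen V ∧ K i ⊆ V ∧ closure V ⊆ N i := fun i =>
    normal_exists_closure_subset (hK i) (hN i) (hKN i)
  choose V hVo hKV hVN using hN1
  refine ⟨fun s => (∃ i, s ⊆ N i) ∨ s ⊆ (⋃ i, closure (V i))ᶜ, fun x => ?_, ?_⟩
  · by_cases hx : x ∈ ⋃ i, closure (V i)
    · obtain ⟨i, hi⟩ := mem_iUnion.1 hx
      exact eventually_smallSets.2 ⟨N i, (hN i).mem_nhds (hVN i hi), fun t ht => Or.inl ⟨i, ht⟩⟩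
    · have hcl : IsClosed (⋃ i, closure (V i)) := isClosed_iUnion_of_finite fun i => isClosed_closure
      exact eventually_smallSets.2 ⟨_, hcl.isOpen_compl.mem_nhds hx, fun t ht => Or.inr ht⟩
  · intro τ hτ Q Q' hQ hQ' hQQ hQdis hQch hQP
    let G : ι → τ → Prop := fun i z => Q' z ⊆ N i
    let Bad : τ → Prop := fun z => ∀ i, ¬ Q' z ⊆ N i
    have hNew : ∀ i, V i ∪ ⋃ z, ⋃ (_ : G i z), Q' z ⊆ N i := by
      intro i
      refine union_subset (subset_closure.trans (hVN i)) (iUnion₂_subset fun z hz => hz)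
    have hcross : ∀ i z, Disjoint (V i ∪ ⋃ z, ⋃ (_ : G i z), Q' z) (if Bad z then Q' z else ∅) := by
      intro i z
      split_ifs with hb
      · rw [disjoint_union_left]
        constructor
        · rcases hQP z with ⟨j, hj⟩ | hz
          · exact absurd hj (hb j)
          · rw [disjoint_left]
            intro x hx hxz
            exact hz hxz (mem_iUnion.2 ⟨i, subset_closure hx⟩)
        · rw [disjoint_iUnion₂_left]
          intro z' hz'
          apply hQdis
          rintro rfl
          exact hb i hz'
      · exact disjoint_empty _
    refine ⟨ι ⊕ τ, inferInstance,
      Sum.elim (fun i => K i ∪ ⋃ z, ⋃ (_ : G i z), Q z) (fun z => if Bad z then Q z else ∅),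
      Sum.elim (fun i => V i ∪ ⋃ z, ⋃ (_ : G i z), Q' z) (fun z => if Bad z then Q' z else ∅),
      ?_, ?_, ?_, ?_, ?_, ?_⟩
    · rintro (i | z)
      · refine (hK i).union (isClosed_iUnion_of_finite fun z => isClosed_iUnion_of_finite fun _ => hQ z)
      · simp only [Sum.elim_inr]
        split_ifs
        · exact hQ z
        · exact isClosed_empty
    · rintro (i | z)
      · exact (hVo i).union (isOpen_iUnion fun z => isOpen_iUnion fun _ => hQ' z)
      · simp only [Sum.elim_inr]
        split_ifs
        · exact hQ' z
        · exact isOpen_empty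
    · rintro (i | z)
      · exact union_subset_union (hKV i) (iUnion₂_mono fun z _ => hQQ z)
      · simp only [Sum.elim_inr]
        split_ifs
        · exact hQQ z
        · exact Subset.rfl
    · rintro (i | z) (j | z') hne
      · exact (hdis i j (fun h => hne (h ▸ rfl))).mono (hNew i) (hNew j)
      · exact hcross i z'
      · exact (hcross j z).symm
      · have hzz : z ≠ z' := fun h => hne (h ▸ rfl)
        simp only [Sum.elim_inr]
        split_ifs <;> simp [hQdis z z' hzz]
    · rintro (i | z)
      · obtain ⟨e, he, hsub⟩ := hch i
        exact ⟨e, he, (hNew i).trans hsub⟩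
      · obtain ⟨e, he, hsub⟩ := hQch z
        refine ⟨e, he, ?_⟩
        simp only [Sum.elim_inr]
        split_ifs
        · exact hsub
        · exact empty_subset _
    · rintro x (hx | hx)
      · obtain ⟨i, hi⟩ := mem_iUnion.1 (hSK hx)
        exact mem_iUnion.2 ⟨Sum.inl i, Or.inl hi⟩
      · obtain ⟨z, hz⟩ := mem_iUnion.1 hx
        by_cases hb : Bad z
        · refine mem_iUnion.2 ⟨Sum.inr z, ?_⟩
          simp only [Sum.elim_inr, if_pos hb]
          exact hz
        · obtain ⟨i, hi⟩ := not_forall_not.1 hb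
          exact mem_iUnion.2 ⟨Sum.inl i, Or.inr (mem_iUnion₂.2 ⟨z, hi, hz⟩)⟩

lemma color_step {S : Col d → Set M} (hS : ∀ c, Mono d (S c)) {e : (Fin d → ℝ) → M}
    (he : IsOpenEmbedding e) {K : Set M} (hK : IsCompact K) (hKe : K ⊆ range e) :
    ∃ S' : Col d → Set M, (∀ c, Mono d (S' c)) ∧ (⋃ c, S c) ∪ K ⊆ ⋃ c, S' c := by
  choose P hP hstep using fun c => mono_step (hS c)
  obtain ⟨T, g, hg, hge, hgP, hgd, hKT⟩ := cubes he hK hKe (fun s => ∀ c, P c s)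
    (fun x _ => eventually_all.2 fun c => hP c x)
  refine ⟨fun c => S c ∪ ⋃ z : {z : T // col z.1 = c}, g z.1 '' closedBall 0 (3/4), ?_, ?_⟩
  · intro c
    refine hstep c {z : T // col z.1 = c} inferInstance _ (fun z => g z.1 '' ball 0 1)
      ?_ ?_ ?_ ?_ ?_ ?_
    · intro z
      exact ((isCompact_closedBall _ _).image (hg _).continuous).isClosed
    · intro z
      exact (hg _).isOpenMap _ isOpen_ball
    · intro z
      exact image_mono (closedBall_subset_ball (by norm_num))
    · intro z z' hne
      refine hgd _ _ (z.2.trans z'.2.symm) (fun h => hne ?_)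
      exact Subtype.ext (Subtype.ext h)
    · intro z
      exact ⟨e, he, (image_subset_range _ _).trans (hge _)⟩
    · intro z
      exact hgP _ z.1.2 c
  · rintro x (hx | hx)
    · obtain ⟨c, hc⟩ := mem_iUnion.1 hx
      exact mem_iUnion.2 ⟨c, Or.inl hc⟩
    · obtain ⟨z, hz, hxz⟩ := mem_iUnion₂.1 (hKT hx)
      exact mem_iUnion.2 ⟨col z, Or.inr (mem_iUnion.2 ⟨⟨⟨z, hz⟩, rfl⟩, hxz⟩)⟩

lemma exists_coloring (hM : Locally d M) :
    ∃ S : Col d → Set M, (∀ c, Mono d (S c)) ∧ (⋃ c, S c) = univ := by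
  classical
  choose e he he0 using hM
  have hn : ∀ x : M, e x '' closedBall 0 1 ∈ 𝓝 x := by
    intro x
    refine mem_of_superset (((he x).isOpenMap _ isOpen_ball).mem_nhds ⟨0, ?_, he0 x⟩)
      (image_mono ball_subset_closedBall)
    simp
  obtain ⟨t, ht⟩ := CompactSpace.elim_nhds_subcover _ hn
  have key : ∀ t : Finset M, ∃ S : Col d → Set M, (∀ c, Mono d (S c)) ∧
      (⋃ x ∈ t, e x '' closedBall 0 1) ⊆ ⋃ c, S c := by
    intro t
    induction t using Finset.induction_on with
    | empty => exact ⟨fun _ => ∅, fun _ => mono_empty, by simp⟩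
    | @insert a t ha ih =>
      obtain ⟨S, hS, hsub⟩ := ih
      obtain ⟨S', hS', hsub'⟩ := color_step hS (he a)
        ((isCompact_closedBall 0 1).image (he a).continuous) (image_subset_range _ _)
      refine ⟨S', hS', ?_⟩
      rw [Finset.set_biUnion_insert]
      refine Subset.trans (union_subset ?_ ?_) hsub'
      · exact subset_union_right
      · exact hsub.trans subset_union_left
  obtain ⟨S, hS, hsub⟩ := key t
  refine ⟨S, hS, ?_⟩
  rw [ht] at hsub
  exact univ_subset_iff.1 hsub

lemma mono_good [ConnectedSpace M] (hM : Locally d M) {S : Set M} (hS : Mono d S) :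
    ∃ W : Col d → Set M, (∀ c, Good d (W c)) ∧ S ⊆ ⋃ c, W c := by
  obtain ⟨ι, hι, K, N, hK, hN, hKN, hdis, hch, hSK⟩ := hS
  choose e he hNe using hch
  choose T g hg hge hgP hgd hKT using fun i => cubes (he i) (hK i).isCompact
    ((hKN i).trans (hNe i)) (fun s => s ⊆ N i)
    (fun x hx => eventually_smallSets.2 ⟨N i, (hN i).mem_nhds (hKN i hx), fun t ht => ht⟩)
  have key : ∀ c : Col d, ∃ W : Set M, Good d W ∧
      ∀ s : {p : Σ i, T i // col p.2.1 = c}, g s.1.1 s.1.2.1 '' closedBall 0 (3/4) ⊆ W := by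
    intro c
    refine engulf hM (fun s : {p : Σ i, T i // col p.2.1 = c} => g s.1.1 s.1.2.1)
      (fun s => hg _ _) ?_
    rintro ⟨⟨i, z, hz⟩, hzc⟩ ⟨⟨j, w, hw⟩, hwc⟩ hne
    simp only at hzc hwc ⊢
    by_cases hij : i = j
    · subst hij
      refine hgd i z w (hzc.trans hwc.symm) ?_
      rintro rfl
      exact hne rfl
    · exact (hdis i j hij).mono (hgP i z hz) (hgP j w hw)
  choose W hW hsub using key
  refine ⟨W, hW, fun x hx => ?_⟩
  obtain ⟨i, hi⟩ := mem_iUnion.1 (hSK hx)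
  obtain ⟨z, hz, hxz⟩ := mem_iUnion₂.1 (hKT i hi)
  exact mem_iUnion.2 ⟨col z, hsub (col z) ⟨⟨i, z, hz⟩, rfl⟩ hxz⟩

end mono

lemma locally_of_charts {d : ℕ} {M : Type} [TopologicalSpace M]
    (h : ∀ x : M, ∃ U : Set M, IsOpen U ∧ x ∈ U ∧ Nonempty (U ≃ₜ EuclideanSpace ℝ (Fin d))) :
    Locally d M := by
  intro x
  obtain ⟨U, hU, hx, ⟨φ⟩⟩ := h x
  let L := (EuclideanSpace.equiv (Fin d) ℝ).toHomeomorph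
  let c : Fin d → ℝ := L (φ ⟨x, hx⟩)
  have h1 : IsOpenEmbedding (fun y : Fin d → ℝ => ((φ.symm (L.symm y) : U) : M)) :=
    hU.isOpenEmbedding_subtypeVal.comp (φ.symm.isOpenEmbedding.comp L.symm.isOpenEmbedding)
  refine ⟨_, reparam h1 c one_pos, ?_⟩
  simp [c]

end BallCover

/-- For every integer `d ≥ 1` there exists `n = n(d)` such that every compact
connected topological `d`-manifold without boundary is the union of `n` open subsets, each of
which is `e(B)` for some open embedding `e : ℝ^d → M`, where `B` is the open unit ball. -/
theorem stmt_1 :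
    ∀ d : ℕ, 1 ≤ d → ∃ n : ℕ,
      ∀ (M : Type) [TopologicalSpace M] [CompactSpace M] [ConnectedSpace M] [T2Space M]
        [SecondCountableTopology M] [Nonempty M],
        (∀ x : M, ∃ U : Set M, IsOpen U ∧ x ∈ U ∧
          Nonempty (U ≃ₜ EuclideanSpace ℝ (Fin d))) →
        ∃ e : Fin n → (EuclideanSpace ℝ (Fin d) → M),
          (∀ i, IsOpenEmbedding (e i)) ∧
          (⋃ i, e i '' Metric.ball (0 : EuclideanSpace ℝ (Fin d)) 1) = Set.univ := by
  intro d _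
  refine ⟨Fintype.card (BallCover.Col d × BallCover.Col d), ?_⟩
  intro M _ _ _ _ _ _ hM
  have hL := BallCover.locally_of_charts hM
  obtain ⟨S, hS, hcov⟩ := BallCover.exists_coloring hL
  choose W hW hSW using fun c => BallCover.mono_good hL (hS c)
  choose e he heW using hW
  let φ := (Fintype.equivFin (BallCover.Col d × BallCover.Col d)).symm
  refine ⟨fun i => e (φ i).1 (φ i).2, fun i => he _ _, ?_⟩
  refine Set.eq_univ_of_forall fun x => ?_
  obtain ⟨c, hc⟩ := Set.mem_iUnion.1 (hcov ▸ Set.mem_univ x)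
  obtain ⟨c', hc'⟩ := Set.mem_iUnion.1 (hSW c hc)
  refine Set.mem_iUnion.2 ⟨φ.symm (c, c'), ?_⟩
  simp only [φ.apply_symm_apply]
  rw [heW c c'] at hc'
  exact hc'
end

section
/- Let M be a compact connected topological d-manifold without boundary. A homeomorphism g of M is isotopic to the identity if and only if g can be written as a composition g = g_1 ∘ ⋯ ∘ g_k of finitely many homeomorphisms of M, where each g_j is supported in e_j(B) for some open embedding e_j : ℝ^d → M, with B the open unit ball of ℝ^d. -/
open Topology

/-- A self-homeomorphism `g` of `M` is isotopic to the identity if there is a continuous map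
`H : [0,1] × M → M` with `H(0,·) = id`, `H(1,·) = g`, and `H(t,·)` a homeomorphism for all `t`. -/
def IsotopicToId {M : Type*} [TopologicalSpace M] (g : M ≃ₜ M) : Prop :=
  ∃ H : unitInterval × M → M, Continuous H ∧
    (∀ x, H (0, x) = x) ∧ (∀ x, H (1, x) = g x) ∧
    ∀ t : unitInterval, ∃ h : M ≃ₜ M, ∀ x, H (t, x) = h x

namespace Frag

variable {n : ℕ}

/-- Points whose coordinates in `J` are bounded by `a`. -/
def Dom (J : Finset (Fin n)) (a : ℝ) : Set (Fin n → ℝ) := {x | ∀ i ∈ J, |x i| ≤ a}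

/-- `h` and `g` are continuous, `ε`-close to the identity and mutually inverse on `D`. -/
structure NearOn (D : Set (Fin n → ℝ)) (ε : ℝ) (h g : (Fin n → ℝ) → (Fin n → ℝ)) : Prop where
  ch : ContinuousOn h D
  cg : ContinuousOn g D
  dh : ∀ x ∈ D, ∀ i, |h x i - x i| ≤ ε
  dg : ∀ x ∈ D, ∀ i, |g x i - x i| ≤ ε
  gh : ∀ x ∈ D, h x ∈ D → g (h x) = x
  hg : ∀ x ∈ D, g x ∈ D → h (g x) = x

lemma NearOn.symm {D : Set (Fin n → ℝ)} {ε : ℝ} {h g : (Fin n → ℝ) → (Fin n → ℝ)}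
    (N : NearOn D ε h g) : NearOn D ε g h :=
  ⟨N.cg, N.ch, N.dg, N.dh, N.hg, N.gh⟩

lemma NearOn.mono {D D' : Set (Fin n → ℝ)} {ε : ℝ} {h g : (Fin n → ℝ) → (Fin n → ℝ)}
    (N : NearOn D ε h g) (hD : D' ⊆ D) : NearOn D' ε h g :=
  ⟨N.ch.mono hD, N.cg.mono hD, fun x hx => N.dh x (hD hx), fun x hx => N.dg x (hD hx),
    fun x hx hy => N.gh x (hD hx) (hD hy), fun x hx hy => N.hg x (hD hx) (hD hy)⟩

lemma NearOn.conj {D D' : Set (Fin n → ℝ)} {ε : ℝ} {h g : (Fin n → ℝ) → (Fin n → ℝ)}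
    (N : NearOn D ε h g) (q q' : (Fin n → ℝ) → (Fin n → ℝ)) (cq : Continuous q)
    (cq' : Continuous q') (qq' : ∀ x, q (q' x) = x) (q'q : ∀ x, q' (q x) = x)
    (lq : ∀ x y, (∀ i, |x i - y i| ≤ ε) → ∀ i, |q x i - q y i| ≤ ε)
    (hD : ∀ x ∈ D', q' x ∈ D) :
    NearOn D' ε (fun x => q (h (q' x))) (fun x => q (g (q' x))) where
  ch := cq.comp_continuousOn (N.ch.comp cq'.continuousOn hD)
  cg := cq.comp_continuousOn (N.cg.comp cq'.continuousOn hD)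
  dh x hx i := by
    have := lq _ _ (N.dh _ (hD x hx)) i
    rwa [qq'] at this
  dg x hx i := by
    have := lq _ _ (N.dg _ (hD x hx)) i
    rwa [qq'] at this
  gh x hx hy := by
    have h1 := hD _ hy
    simp only [q'q] at h1 ⊢
    rw [N.gh _ (hD x hx) h1, qq']
  hg x hx hy := by
    have h1 := hD _ hy
    simp only [q'q] at h1 ⊢
    rw [N.hg _ (hD x hx) h1, qq']

lemma NearOn.comp {D D' : Set (Fin n → ℝ)} {ε₁ ε₂ : ℝ} {h₁ g₁ h₂ g₂ : (Fin n → ℝ) → (Fin n → ℝ)}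
    (N₁ : NearOn D ε₁ h₁ g₁) (N₂ : NearOn D ε₂ h₂ g₂) (e₁ : 0 ≤ ε₁) (e₂ : 0 ≤ ε₂)
    (hD : ∀ x ∈ D', ∀ y, (∀ i, |y i - x i| ≤ ε₁ + ε₂) → y ∈ D) :
    NearOn D' (ε₁ + ε₂) (fun x => h₁ (h₂ x)) (fun x => g₂ (g₁ x)) := by
  have k0 : ∀ x ∈ D', x ∈ D := fun x hx => hD x hx x (fun i => by simp; positivity)
  have k2 : ∀ x ∈ D', h₂ x ∈ D := fun x hx => hD x hx _ (fun i => by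
    linarith [N₂.dh x (k0 x hx) i])
  have k1 : ∀ x ∈ D', g₁ x ∈ D := fun x hx => hD x hx _ (fun i => by
    linarith [N₁.dg x (k0 x hx) i])
  have d12 : ∀ x ∈ D', ∀ i, |h₁ (h₂ x) i - x i| ≤ ε₁ + ε₂ := fun x hx i => by
    have a1 := N₂.dh x (k0 x hx) i
    have a2 := N₁.dh _ (k2 x hx) i
    rw [abs_le] at *
    constructor <;> linarith
  have d21 : ∀ x ∈ D', ∀ i, |g₂ (g₁ x) i - x i| ≤ ε₁ + ε₂ := fun x hx i => by
    have a1 := N₁.dg x (k0 x hx) i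
    have a2 := N₂.dg _ (k1 x hx) i
    rw [abs_le] at *
    constructor <;> linarith
  refine ⟨N₁.ch.comp (N₂.ch.mono k0) k2, N₂.cg.comp (N₁.cg.mono k0) k1, d12, d21, ?_, ?_⟩
  · intro x hx _
    rw [N₁.gh _ (k2 x hx) (hD x hx _ (d12 x hx)), N₂.gh _ (k0 x hx) (k2 x hx)]
  · intro x hx _
    rw [N₂.hg _ (k1 x hx) (hD x hx _ (d21 x hx)), N₁.hg _ (k0 x hx) (k1 x hx)]

/-- Apply a real function to the coordinate `i`. -/
def cm (i : Fin n) (φ : ℝ → ℝ) (x : Fin n → ℝ) : Fin n → ℝ := Function.update x i (φ (x i))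

@[simp] lemma cm_same (i : Fin n) (φ : ℝ → ℝ) (x : Fin n → ℝ) : cm i φ x i = φ (x i) := by
  simp [cm]

lemma cm_ne {i l : Fin n} (h : l ≠ i) (φ : ℝ → ℝ) (x : Fin n → ℝ) : cm i φ x l = x l := by
  simp [cm, h]

lemma cm_eq_self {i : Fin n} {φ : ℝ → ℝ} {x : Fin n → ℝ} (h : φ (x i) = x i) : cm i φ x = x := by
  simp [cm, h]

lemma cm_congr {i : Fin n} {φ ψ : ℝ → ℝ} {x : Fin n → ℝ} (h : φ (x i) = ψ (x i)) :
    cm i φ x = cm i ψ x := by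
  simp [cm, h]

lemma cm_cm {i : Fin n} {φ ψ : ℝ → ℝ} {x : Fin n → ℝ} :
    cm i φ (cm i ψ x) = cm i (fun t => φ (ψ t)) x := by
  simp [cm]

lemma cm_cont {i : Fin n} {φ : ℝ → ℝ} (h : Continuous φ) : Continuous (cm i φ) := by
  unfold cm
  exact continuous_id.update i (h.comp (continuous_apply i))

lemma cm_lip {i : Fin n} {φ : ℝ → ℝ} (h : ∀ s t, |φ s - φ t| ≤ |s - t|) {ε : ℝ}
    (x y : Fin n → ℝ) (hxy : ∀ i, |x i - y i| ≤ ε) (l : Fin n) :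
    |cm i φ x l - cm i φ y l| ≤ ε := by
  by_cases hl : l = i
  · subst hl
    simpa using (h _ _).trans (hxy l)
  · simpa [cm_ne hl] using hxy l

/-- Shift of the coordinate `i` by `4 k`. -/
def sh (i : Fin n) (k : ℤ) : (Fin n → ℝ) → (Fin n → ℝ) := cm i (fun t => t + 4 * k)

lemma sh_sh (i : Fin n) (k l : ℤ) (x : Fin n → ℝ) : sh i k (sh i l x) = sh i (k + l) x := by
  unfold sh
  rw [cm_cm]
  apply cm_congr
  push_cast
  ring

lemma sh_zero (i : Fin n) (x : Fin n → ℝ) : sh i 0 x = x := by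
  unfold sh
  apply cm_eq_self
  simp

@[simp] lemma sh_same (i : Fin n) (k : ℤ) (x : Fin n → ℝ) : sh i k x i = x i + 4 * k := by
  simp [sh]

lemma sh_ne {i l : Fin n} (h : l ≠ i) (k : ℤ) (x : Fin n → ℝ) : sh i k x l = x l := by
  simp [sh, cm_ne h]

lemma sh_cont (i : Fin n) (k : ℤ) : Continuous (sh i k) := by
  unfold sh
  exact cm_cont (by fun_prop)

/-- slab around `[-1,3]` in direction `i`. -/
def Slab (i : Fin n) (J : Finset (Fin n)) (b a : ℝ) : Set (Fin n → ℝ) :=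
  {x | -1 - b ≤ x i ∧ x i ≤ 3 + b ∧ ∀ l ∈ J, |x l| ≤ a}

/-- periodic extension. -/
noncomputable def per (i : Fin n) (ψ : (Fin n → ℝ) → (Fin n → ℝ)) (x : Fin n → ℝ) : Fin n → ℝ :=
  sh i ⌊(x i + 1) / 4⌋ (ψ (sh i (-⌊(x i + 1) / 4⌋) x))

lemma sh_mem_dom {i : Fin n} {J : Finset (Fin n)} (hi : i ∉ J) {c : ℝ} {x : Fin n → ℝ}
    (hx : x ∈ Dom J c) (k : ℤ) : sh i k x ∈ Dom J c := by
  intro l hl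
  have : l ≠ i := fun h => hi (h ▸ hl)
  rw [sh_ne this]
  exact hx l hl

lemma per_eq {i : Fin n} {J : Finset (Fin n)} (hi : i ∉ J) {c : ℝ}
    {ψ : (Fin n → ℝ) → (Fin n → ℝ)}
    (hψ : ∀ x ∈ Dom J c, -5/4 ≤ x i → x i ≤ -3/4 → ψ (sh i 1 x) = sh i 1 (ψ x))
    {x : Fin n → ℝ} (hx : x ∈ Dom J c) (k : ℤ) (h1 : -5/4 ≤ x i - 4 * k)
    (h2 : x i - 4 * k ≤ 13/4) : per i ψ x = sh i k (ψ (sh i (-k) x)) := by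
  have hf := Int.floor_le ((x i + 1) / 4)
  have hf' := Int.lt_floor_add_one ((x i + 1) / 4)
  unfold per
  set m := ⌊(x i + 1) / 4⌋ with hm
  have hc : m = k ∨ m = k + 1 ∨ m = k - 1 := by
    have a1 : (m : ℝ) < k + 2 := by linarith
    have a2 : (k : ℝ) < m + 2 := by linarith
    have a1' : m < k + 2 := by exact_mod_cast a1
    have a2' : k < m + 2 := by exact_mod_cast a2
    omega
  rcases hc with h | h | h
  · rw [h]
  · have hm' : (m : ℝ) = k + 1 := by rw [h]; push_cast; ring
    have := hψ (sh i (-m) x) (sh_mem_dom hi hx _) (by simp [hm']; linarith)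
      (by simp [hm']; linarith)
    rw [sh_sh, show (1 : ℤ) + -m = -k by omega] at this
    rw [this, sh_sh, h]
  · have hm' : (m : ℝ) = k - 1 := by rw [h]; push_cast; ring
    have := hψ (sh i (-k) x) (sh_mem_dom hi hx _) (by simp; linarith)
      (by simp; linarith)
    rw [sh_sh, show (1 : ℤ) + -k = -m by omega] at this
    rw [this, sh_sh, show m + 1 = k by omega]

lemma per_floor (i : Fin n) (x : Fin n → ℝ) :
    -1 ≤ x i - 4 * ⌊(x i + 1) / 4⌋ ∧ x i - 4 * ⌊(x i + 1) / 4⌋ ≤ 3 := by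
  have hf := Int.floor_le ((x i + 1) / 4)
  have hf' := Int.lt_floor_add_one ((x i + 1) / 4)
  constructor <;> linarith

lemma per_cont {i : Fin n} {J : Finset (Fin n)} (hi : i ∉ J) {c : ℝ}
    {ψ : (Fin n → ℝ) → (Fin n → ℝ)}
    (hψ : ∀ x ∈ Dom J c, -5/4 ≤ x i → x i ≤ -3/4 → ψ (sh i 1 x) = sh i 1 (ψ x))
    (hc : ContinuousOn ψ (Slab i J (1/4) c)) : ContinuousOn (per i ψ) (Dom J c) := by
  intro x hx
  set k := ⌊(x i + 1) / 4⌋ with hk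
  have hk2 := per_floor i x
  rw [← hk] at hk2
  set U : Set (Fin n → ℝ) := {y | -5/4 < y i - 4 * k ∧ y i - 4 * k < 13/4} with hU
  have hUo : IsOpen U := by
    apply IsOpen.inter
    · exact isOpen_lt continuous_const
        (by fun_prop : Continuous fun y : Fin n → ℝ => y i - 4 * (k : ℝ))
    · exact isOpen_lt
        (by fun_prop : Continuous fun y : Fin n → ℝ => y i - 4 * (k : ℝ)) continuous_const
  have hxU : x ∈ U := ⟨by linarith, by linarith⟩
  have key : ContinuousOn (fun y => sh i k (ψ (sh i (-k) y))) (Dom J c ∩ U) := by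
    apply (sh_cont i k).comp_continuousOn
    apply hc.comp (sh_cont i (-k)).continuousOn
    intro y hy
    refine ⟨?_, ?_, sh_mem_dom hi hy.1 _⟩
    · simp; linarith [hy.2.1]
    · simp; linarith [hy.2.2]
  have key2 : ContinuousOn (per i ψ) (Dom J c ∩ U) :=
    key.congr fun y hy => per_eq hi hψ hy.1 k hy.2.1.le hy.2.2.le
  exact (continuousWithinAt_inter (hUo.mem_nhds hxU)).1 (key2 x ⟨hx, hxU⟩)

lemma per_near {i : Fin n} {J : Finset (Fin n)} (hi : i ∉ J) {c ε : ℝ} (hε : ε ≤ 1/4)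
    {ψ ψ' : (Fin n → ℝ) → (Fin n → ℝ)}
    (hψ : ∀ x ∈ Dom J c, -5/4 ≤ x i → x i ≤ -3/4 → ψ (sh i 1 x) = sh i 1 (ψ x))
    (hψ' : ∀ x ∈ Dom J c, -5/4 ≤ x i → x i ≤ -3/4 → ψ' (sh i 1 x) = sh i 1 (ψ' x))
    (N : NearOn (Slab i J (1/4) c) ε ψ ψ') : NearOn (Dom J c) ε (per i ψ) (per i ψ') := by
  have aux : ∀ {ψ ψ' : (Fin n → ℝ) → (Fin n → ℝ)},
      (∀ x ∈ Dom J c, -5/4 ≤ x i → x i ≤ -3/4 → ψ (sh i 1 x) = sh i 1 (ψ x)) →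
      (∀ x ∈ Dom J c, -5/4 ≤ x i → x i ≤ -3/4 → ψ' (sh i 1 x) = sh i 1 (ψ' x)) →
      NearOn (Slab i J (1/4) c) ε ψ ψ' →
      (∀ x ∈ Dom J c, ∀ l, |per i ψ x l - x l| ≤ ε) ∧
      (∀ x ∈ Dom J c, per i ψ x ∈ Dom J c → per i ψ' (per i ψ x) = x) := by
    intro ψ ψ' hψ hψ' N
    have d : ∀ x ∈ Dom J c, ∀ l, |per i ψ x l - x l| ≤ ε := by
      intro x hx l
      have hk2 := per_floor i x
      unfold per
      set k := ⌊(x i + 1) / 4⌋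
      have hm : sh i (-k) x ∈ Slab i J (1/4) c :=
        ⟨by simp; linarith, by simp; linarith, sh_mem_dom hi hx _⟩
      have := N.dh _ hm l
      by_cases hl : l = i
      · subst hl
        simp at this ⊢
        convert this using 2
        ring
      · rwa [sh_ne hl] at this ⊢
    refine ⟨d, fun x hx hy => ?_⟩
    have hk2 := per_floor i x
    have hd := d x hx i
    set k := ⌊(x i + 1) / 4⌋ with hk
    have e : per i ψ x = sh i k (ψ (sh i (-k) x)) := rfl
    rw [abs_le] at hd
    have hm : sh i (-k) x ∈ Slab i J (1/4) c :=
      ⟨by simp; linarith, by simp; linarith, sh_mem_dom hi hx _⟩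
    have hm2 : sh i (-k) (per i ψ x) ∈ Slab i J (1/4) c :=
      ⟨by simp; linarith, by simp; linarith, sh_mem_dom hi hy _⟩
    rw [per_eq hi hψ' hy k (by linarith) (by linarith)]
    have e2 : sh i (-k) (per i ψ x) = ψ (sh i (-k) x) := by
      rw [e, sh_sh]; simp [sh_zero]
    rw [e2] at hm2 ⊢
    rw [N.gh _ hm hm2, sh_sh]
    simp [sh_zero]
  have a1 := aux hψ hψ' N
  have a2 := aux hψ' hψ N.symm
  exact ⟨per_cont hi hψ N.ch, per_cont hi hψ' N.cg, a1.1, a2.1, a1.2, a2.2⟩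

end Frag

namespace Frag

variable {n : ℕ}

/-- compression: shift by `4` on the left, identity on the right. -/
noncomputable def qf (t : ℝ) : ℝ := min (t + 4) (max t (t / 5 + 2))
/-- inverse of `qf`. -/
noncomputable def qi (s : ℝ) : ℝ := max (s - 4) (min s (5 * s - 10))

lemma qf_cont : Continuous qf := by unfold qf; fun_prop
lemma qi_cont : Continuous qi := by unfold qi; fun_prop

lemma qf_left {t : ℝ} (h : t ≤ -5/2) : qf t = t + 4 := by
  unfold qf
  rw [max_eq_right (by linarith), min_eq_left (by linarith)]
lemma qf_right {t : ℝ} (h : 5/2 ≤ t) : qf t = t := by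
  unfold qf
  rw [max_eq_left (by linarith), min_eq_right (by linarith)]
lemma qf_mid {t : ℝ} (h : -5/2 ≤ t) (h' : t ≤ 5/2) : qf t = t / 5 + 2 := by
  unfold qf
  rw [max_eq_right (by linarith), min_eq_right (by linarith)]
lemma qi_left {t : ℝ} (h : t ≤ 3/2) : qi t = t - 4 := by
  unfold qi
  rw [min_eq_right (by linarith), max_eq_left (by linarith)]
lemma qi_right {t : ℝ} (h : 5/2 ≤ t) : qi t = t := by
  unfold qi
  rw [min_eq_left (by linarith), max_eq_right (by linarith)]
lemma qi_mid {t : ℝ} (h : 3/2 ≤ t) (h' : t ≤ 5/2) : qi t = 5 * t - 10 := by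
  unfold qi
  rw [min_eq_right (by linarith), max_eq_right (by linarith)]

lemma qf_qi (t : ℝ) : qf (qi t) = t := by
  rcases le_total t (3/2) with h | h
  · rw [qi_left h, qf_left (by linarith)]; ring
  rcases le_total t (5/2) with h' | h'
  · rw [qi_mid h h', qf_mid (by linarith) (by linarith)]; ring
  · rw [qi_right h', qf_right h']

lemma qi_qf (t : ℝ) : qi (qf t) = t := by
  rcases le_total t (-5/2) with h | h
  · rw [qf_left h, qi_left (by linarith)]; ring
  rcases le_total t (5/2) with h' | h'
  · rw [qf_mid h h', qi_mid (by linarith) (by linarith)]; ring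
  · rw [qf_right h', qi_right h']

lemma qf_lip (s t : ℝ) : |qf s - qf t| ≤ |s - t| := by
  have key : ∀ s t : ℝ, s ≤ t → qf s ≤ qf t ∧ qf t - qf s ≤ t - s := by
    intro s t h
    rcases le_total s (-5/2) with h1 | h1 <;> rcases le_total t (-5/2) with h2 | h2 <;>
    rcases le_total s (5/2) with h3 | h3 <;> rcases le_total t (5/2) with h4 | h4 <;>
    first
    | (exfalso; linarith)
    | (first | rw [qf_left h1] | rw [qf_right h3] | rw [qf_mid h1 h3]
       first | rw [qf_left h2] | rw [qf_right h4] | rw [qf_mid h2 h4]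
       constructor <;> linarith)
  rcases le_total s t with h | h
  · have := key s t h
    rw [abs_sub_comm, abs_sub_comm s, abs_of_nonneg (by linarith), abs_of_nonneg (by linarith)]
    exact this.2
  · have := key t s h
    rw [abs_of_nonneg (by linarith), abs_of_nonneg (by linarith)]
    exact this.2

lemma mem_dom_insert {i : Fin n} {J : Finset (Fin n)} {a : ℝ} {x : Fin n → ℝ}
    (h : |x i| ≤ a) (h' : ∀ l ∈ J, |x l| ≤ a) : x ∈ Dom (insert i J) a := by
  intro l hl
  rcases Finset.mem_insert.1 hl with rfl | hl
  · exact h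
  · exact h' l hl

lemma near_abs {a b c ε : ℝ} (h : |a - b| ≤ ε) (h' : |b| ≤ c) : |a| ≤ c + ε := by
  rw [abs_le] at *; constructor <;> linarith

/-- half of the computation of the interpolation near its left and right ends, used for both
the map and its inverse. -/
lemma interp_aux {i : Fin n} {J : Finset (Fin n)} (hi : i ∉ J) {a ε : ℝ} (ha : 6 ≤ a)
    (hε0 : 0 ≤ ε) (hε : ε ≤ 1/24) {h g : (Fin n → ℝ) → (Fin n → ℝ)}
    (N : NearOn (Dom (insert i J) a) ε h g) :
    (∀ x, (∀ l ∈ J, |x l| ≤ a - 1/8) → -11/8 ≤ x i → x i ≤ 11/8 →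
      sh i 1 (g (sh i (-1) (cm i qf (h (cm i qi x))))) = x ∧
      cm i qf (g (cm i qi (sh i 1 (h (sh i (-1) x))))) = x) ∧
    (∀ x, (∀ l ∈ J, |x l| ≤ a - 1/8) → 21/8 ≤ x i → x i ≤ 27/8 →
      cm i qf (h (cm i qi x)) = h x ) := by
  constructor
  · intro x hJ h1 h2
    have e1 : cm i qi x = sh i (-1) x := cm_congr (by simp; rw [qi_left (by linarith)]; ring)
    have m1 : sh i (-1) x ∈ Dom (insert i J) a := by
      apply mem_dom_insert
      · simp; rw [abs_le]; constructor <;> linarith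
      · intro l hl
        have : l ≠ i := fun h => hi (h ▸ hl)
        rw [sh_ne this]; linarith [hJ l hl]
    have d := N.dh _ m1
    have m2 : h (sh i (-1) x) ∈ Dom (insert i J) a := by
      apply mem_dom_insert
      · have := d i
        simp at this
        rw [abs_le] at *; constructor <;> linarith
      · intro l hl
        have hli : l ≠ i := fun h => hi (h ▸ hl)
        have := near_abs (c := a - 1/8) (d l) (by rw [sh_ne hli]; exact hJ l hl)
        linarith
    have di := d i
    simp at di
    rw [abs_le] at di
    have e2 : cm i qf (h (sh i (-1) x)) = sh i 1 (h (sh i (-1) x)) :=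
      cm_congr (by rw [qf_left (by linarith)]; simp)
    have e3 : cm i qi (sh i 1 (h (sh i (-1) x))) = h (sh i (-1) x) := by
      rw [← e2, cm_cm]; exact cm_eq_self (qi_qf _)
    constructor
    · rw [e1, e2, sh_sh]
      simp only [neg_add_cancel, sh_zero]
      rw [N.gh _ m1 m2, sh_sh]; simp [sh_zero]
    · rw [e3, N.gh _ m1 m2, ← e1, cm_cm]; exact cm_eq_self (qf_qi _)
  · intro x hJ h1 h2
    have e1 : cm i qi x = x := cm_eq_self (qi_right (by linarith))
    have m1 : x ∈ Dom (insert i J) a := by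
      apply mem_dom_insert
      · rw [abs_le]; constructor <;> linarith
      · intro l hl; linarith [hJ l hl]
    have di := N.dh _ m1 i
    rw [abs_le] at di
    rw [e1]
    exact cm_eq_self (qf_right (by linarith))

lemma wrap {i : Fin n} {J : Finset (Fin n)} (hi : i ∉ J) {a ε : ℝ} (ha : 6 ≤ a)
    (hε0 : 0 ≤ ε) (hε : ε ≤ 1/24) {Z : Set (Fin n → ℝ)}
    (hZ : ∀ x ∈ Z, ∀ t : ℝ, Function.update x i t ∈ Z)
    {h g : (Fin n → ℝ) → (Fin n → ℝ)}
    (N : NearOn (Dom (insert i J) a) ε h g)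
    (fix : ∀ x ∈ Z, x ∈ Dom (insert i J) a → h x = x ∧ g x = x) :
    ∃ h' g', NearOn (Dom J (a - 1)) (3 * ε) h' g' ∧
      (∀ x ∈ Z, x ∈ Dom J (a - 1) → h' x = x ∧ g' x = x) ∧
      ∀ x ∈ Dom J (a - 1), |x i| ≤ 1 → h' x = h x := by
  have N0 : NearOn (Slab i J (1/2) a) ε h g := N.mono (by
    intro x hx
    apply mem_dom_insert _ hx.2.2
    have h1 := hx.1
    have h2 := hx.2.1
    rw [abs_le]; constructor <;> linarith)
  have Nq : NearOn (Slab i J (1/2) a) ε (fun x => cm i qf (h (cm i qi x)))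
      (fun x => cm i qf (g (cm i qi x))) := by
    apply N.conj _ _ (cm_cont qf_cont) (cm_cont qi_cont)
      (fun x => by rw [cm_cm]; exact cm_eq_self (qf_qi _))
      (fun x => by rw [cm_cm]; exact cm_eq_self (qi_qf _))
      (fun x y => cm_lip qf_lip x y)
    intro x hx
    have h1 := hx.1
    have h2 := hx.2.1
    apply mem_dom_insert
    · simp only [cm_same]
      rcases le_total (x i) (3/2) with h3 | h3
      · rw [qi_left h3, abs_le]; constructor <;> linarith
      rcases le_total (x i) (5/2) with h4 | h4
      · rw [qi_mid h3 h4, abs_le]; constructor <;> linarith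
      · rw [qi_right h4, abs_le]; constructor <;> linarith
    · intro l hl
      have : l ≠ i := fun h => hi (h ▸ hl)
      rw [cm_ne this]; exact hx.2.2 l hl
  have N1 : NearOn (Slab i J (1/2) a) ε (fun x => sh i 1 (h (sh i (-1) x)))
      (fun x => sh i 1 (g (sh i (-1) x))) := by
    apply N.conj _ _ (sh_cont _ _) (sh_cont _ _)
      (fun x => by rw [sh_sh]; simp [sh_zero]) (fun x => by rw [sh_sh]; simp [sh_zero])
      (fun x y => cm_lip (by intro s t; simp) x y)
    intro x hx
    have h1 := hx.1
    have h2 := hx.2.1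
    apply mem_dom_insert
    · simp; rw [abs_le]; constructor <;> linarith
    · intro l hl
      have : l ≠ i := fun h => hi (h ▸ hl)
      rw [sh_ne this]; exact hx.2.2 l hl
  have Nc := Nq.symm.comp N1 (D' := Slab i J (3/8) (a - 1/8)) hε0 hε0 (by
    intro x hx y hy
    have h1 := hx.1
    have h2 := hx.2.1
    have h3 := hy i
    rw [abs_le] at h3
    refine ⟨by linarith, by linarith, fun l hl => ?_⟩
    have := near_abs (hy l) (hx.2.2 l hl)
    linarith)
  have N0' : NearOn (Slab i J (3/8) (a - 1/8)) ε h g := N0.mono (by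
    intro x hx
    exact ⟨by linarith [hx.1], by linarith [hx.2.1], fun l hl => by linarith [hx.2.2 l hl]⟩)
  have Nf := N0'.comp Nc (D' := Slab i J (1/4) (a - 1)) hε0 (by linarith) (by
    intro x hx y hy
    have h1 := hx.1
    have h2 := hx.2.1
    have h3 := hy i
    rw [abs_le] at h3
    refine ⟨by linarith, by linarith, fun l hl => ?_⟩
    have := near_abs (hy l) (hx.2.2 l hl)
    linarith)
  rw [show ε + (ε + ε) = 3 * ε by ring] at Nf
  obtain ⟨A1, A2⟩ := interp_aux hi ha hε0 hε N
  obtain ⟨B1, B2⟩ := interp_aux hi ha hε0 hε N.symm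
  set ψ : (Fin n → ℝ) → (Fin n → ℝ) := fun x =>
    h (cm i qf (g (cm i qi (sh i 1 (h (sh i (-1) x)))))) with hψ
  set ψ' : (Fin n → ℝ) → (Fin n → ℝ) := fun x =>
    sh i 1 (g (sh i (-1) (cm i qf (h (cm i qi (g x)))))) with hψ'
  have dm : ∀ x, (∀ l ∈ J, |x l| ≤ a - 1) → |x i| ≤ 4 → x ∈ Dom (insert i J) a := by
    intro x hx h1
    exact mem_dom_insert (by linarith) (fun l hl => by linarith [hx l hl])
  -- left ends
  have L1 : ∀ x ∈ Dom J (a - 1), -5/4 ≤ x i → x i ≤ 5/4 → ψ x = h x := by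
    intro x hx h1 h2
    simp only [hψ]
    rw [(A1 x (fun l hl => by linarith [hx l hl]) (by linarith) (by linarith)).2]
  have L2 : ∀ x ∈ Dom J (a - 1), -5/4 ≤ x i → x i ≤ 5/4 → ψ' x = g x := by
    intro x hx h1 h2
    have d := N.dg x (dm x hx (by rw [abs_le]; constructor <;> linarith))
    have di := d i
    rw [abs_le] at di
    simp only [hψ']
    rw [(A1 (g x) (fun l hl => by linarith [near_abs (d l) (hx l hl)]) (by linarith)
      (by linarith)).1]
  -- right ends
  have R1 : ∀ x ∈ Dom J (a - 1), -5/4 ≤ x i → x i ≤ -3/4 → ψ (sh i 1 x) = sh i 1 (h x) := by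
    intro x hx h1 h2
    have d := N.dh x (dm x hx (by rw [abs_le]; constructor <;> linarith))
    have di := d i
    rw [abs_le] at di
    simp only [hψ, sh_sh, neg_add_cancel, sh_zero]
    set y := sh i 1 (h x) with hy
    have yi : y i = h x i + 4 := by simp [hy]
    have yl : ∀ l ∈ J, |y l| ≤ a - 1 + ε := by
      intro l hl
      have : l ≠ i := fun h => hi (h ▸ hl)
      rw [hy, sh_ne this]
      exact near_abs (d l) (hx l hl)
    rw [B2 y (fun l hl => by linarith [yl l hl]) (by linarith) (by linarith)]
    have my : y ∈ Dom (insert i J) a := mem_dom_insert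
      (by rw [abs_le]; constructor <;> linarith) (fun l hl => by linarith [yl l hl])
    have d2 := N.dg y my
    have d2i := d2 i
    rw [abs_le] at d2i
    apply N.hg y my
    exact mem_dom_insert (by rw [abs_le]; constructor <;> linarith)
      (fun l hl => by linarith [near_abs (d2 l) (yl l hl)])
  have R2 : ∀ x ∈ Dom J (a - 1), -5/4 ≤ x i → x i ≤ -3/4 → ψ' (sh i 1 x) = sh i 1 (g x) := by
    intro x hx h1 h2
    have hx' := sh_mem_dom hi hx 1
    have my : sh i 1 x ∈ Dom (insert i J) a := dm _ hx' (by
      simp; rw [abs_le]; constructor <;> linarith)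
    have d := N.dg _ my
    have di := d i
    simp at di
    rw [abs_le] at di
    simp only [hψ']
    have gl : ∀ l ∈ J, |g (sh i 1 x) l| ≤ a - 1 + ε := fun l hl => near_abs (d l) (hx' l hl)
    rw [A2 (g (sh i 1 x)) (fun l hl => by linarith [gl l hl]) (by linarith) (by linarith),
      N.hg _ my (mem_dom_insert (by rw [abs_le]; constructor <;> linarith)
        (fun l hl => by linarith [gl l hl])), sh_sh]
    simp [sh_zero]
  have S1 : ∀ x ∈ Dom J (a - 1), -5/4 ≤ x i → x i ≤ -3/4 → ψ (sh i 1 x) = sh i 1 (ψ x) :=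
    fun x hx h1 h2 => by rw [R1 x hx h1 h2, L1 x hx h1 (by linarith)]
  have S2 : ∀ x ∈ Dom J (a - 1), -5/4 ≤ x i → x i ≤ -3/4 → ψ' (sh i 1 x) = sh i 1 (ψ' x) :=
    fun x hx h1 h2 => by rw [R2 x hx h1 h2, L2 x hx h1 (by linarith)]
  refine ⟨per i ψ, per i ψ', per_near hi (by linarith) S1 S2 Nf, ?_, ?_⟩
  · -- fixed set
    have hZsh : ∀ x ∈ Z, ∀ k, sh i k x ∈ Z := fun x hx k => hZ x hx _
    have hZcm : ∀ x ∈ Z, ∀ φ, cm i φ x ∈ Z := fun x hx φ => hZ x hx _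
    have fx : ∀ x ∈ Z, ∀ t : ℝ, (∀ l ∈ J, |x l| ≤ a - 1) → |x i| ≤ 6 → h x = x ∧ g x = x := by
      intro x hx t hl hi6
      exact fix x hx (mem_dom_insert (by linarith) (fun l hl' => by linarith [hl l hl']))
    have main : ∀ x ∈ Z, x ∈ Dom J (a - 1) → -1 ≤ x i → x i ≤ 3 → ψ x = x ∧ ψ' x = x := by
      intro x hx hJ h1 h2
      have b1 : h x = x ∧ g x = x := fx x hx 0 hJ (by rw [abs_le]; constructor <;> linarith)
      have b2 : h (sh i (-1) x) = sh i (-1) x ∧ g (sh i (-1) x) = sh i (-1) x :=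
        fx _ (hZsh x hx _) 0 (sh_mem_dom hi hJ _) (by
          simp; rw [abs_le]; constructor <;> linarith)
      have b3 : h (cm i qi x) = cm i qi x ∧ g (cm i qi x) = cm i qi x := by
        apply fx _ (hZcm x hx _) 0
        · intro l hl
          have : l ≠ i := fun h => hi (h ▸ hl)
          rw [cm_ne this]; exact hJ l hl
        · simp only [cm_same]
          rcases le_total (x i) (3/2) with h3 | h3
          · rw [qi_left h3, abs_le]; constructor <;> linarith
          rcases le_total (x i) (5/2) with h4 | h4
          · rw [qi_mid h3 h4, abs_le]; constructor <;> linarith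
          · rw [qi_right h4, abs_le]; constructor <;> linarith
      have c1 : cm i qf (cm i qi x) = x := by rw [cm_cm]; exact cm_eq_self (qf_qi _)
      have c2 : sh i 1 (sh i (-1) x) = x := by rw [sh_sh]; simp [sh_zero]
      constructor
      · simp only [hψ]
        rw [b2.1, c2, b3.2, c1, b1.1]
      · simp only [hψ']
        rw [b1.2, b3.1, c1, b2.2, c2]
    intro x hx hJ
    have hk := per_floor i x
    have := main (sh i (-⌊(x i + 1) / 4⌋) x) (hZsh x hx _) (sh_mem_dom hi hJ _)
      (by simp; linarith) (by simp; linarith)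
    unfold per
    rw [this.1, this.2, sh_sh]
    simp [sh_zero]
  · intro x hx h1
    rw [abs_le] at h1
    rw [per_eq hi S1 hx 0 (by push_cast; linarith) (by push_cast; linarith)]
    simp only [neg_zero, sh_zero]
    exact L1 x hx (by linarith) (by linarith)

lemma wrapAll (Z : Set (Fin n → ℝ)) (J : Finset (Fin n)) :
    (∀ x ∈ Z, ∀ i ∈ J, ∀ t : ℝ, Function.update x i t ∈ Z) →
    ∀ (a ε : ℝ) (h g : (Fin n → ℝ) → (Fin n → ℝ)), 6 + J.card ≤ a → 0 ≤ ε →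
    3 ^ J.card * ε ≤ 1/24 → NearOn (Dom J a) ε h g →
    (∀ x ∈ Z, x ∈ Dom J a → h x = x ∧ g x = x) →
    ∃ h' g', NearOn Set.univ (3 ^ J.card * ε) h' g' ∧ (∀ x ∈ Z, h' x = x ∧ g' x = x) ∧
      ∀ x, (∀ i ∈ J, |x i| ≤ 1) → h' x = h x := by
  induction J using Finset.induction_on with
  | empty =>
    intro _ a ε h g _ _ _ N fix
    have : Dom (∅ : Finset (Fin n)) a = Set.univ := by ext x; simp [Dom]
    rw [this] at N
    refine ⟨h, g, by simpa using N, fun x hx => fix x hx (by rw [this]; trivial), fun _ _ => rfl⟩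
  | insert i J hi ih =>
    intro hZ a ε h g ha hε0 hε N fix
    rw [Finset.card_insert_of_notMem hi] at ha hε ⊢
    push_cast at ha
    have hJ0 : (0 : ℝ) ≤ J.card := by positivity
    have h3 : (1 : ℝ) ≤ 3 ^ J.card := one_le_pow₀ (by norm_num)
    have hε1 : ε ≤ 1/24 := by
      rw [pow_succ] at hε
      nlinarith
    obtain ⟨h1, g1, N1, f1, e1⟩ := wrap hi (by linarith) hε0 hε1
      (fun x hx t => hZ x hx i (Finset.mem_insert_self _ _) t) N fix
    obtain ⟨h2, g2, N2, f2, e2⟩ := ih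
      (fun x hx l hl => hZ x hx l (Finset.mem_insert_of_mem hl)) (a - 1) (3 * ε) h1 g1
      (by linarith) (by linarith) (by rw [pow_succ] at hε; linarith) N1 f1
    refine ⟨h2, g2, ?_, f2, ?_⟩
    · rw [pow_succ, mul_assoc]; exact N2
    · intro x hx
      rw [e2 x (fun l hl => hx l (Finset.mem_insert_of_mem hl))]
      apply e1 x _ (hx i (Finset.mem_insert_self _ _))
      intro l hl
      linarith [hx l (Finset.mem_insert_of_mem hl)]

end Frag

namespace Frag

variable {n : ℕ}

/-- radial compression of the whole space onto the open ball of radius `3`. -/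
noncomputable def sg (z : Fin n → ℝ) : Fin n → ℝ := (3 / (max ‖z‖ 2 + 1)) • z
/-- inverse of `sg` on the open ball of radius `3`. -/
noncomputable def si (y : Fin n → ℝ) : Fin n → ℝ := (1 / (3 - max ‖y‖ 2)) • y

lemma sg_cont : Continuous (sg (n := n)) := by
  unfold sg
  refine Continuous.fun_smul ?_ continuous_id
  apply Continuous.div continuous_const (by fun_prop)
  intro x
  have := le_max_right ‖x‖ 2
  linarith

lemma si_cont : ContinuousOn (si (n := n)) (Metric.ball 0 3) := by
  unfold si
  refine ContinuousOn.fun_smul ?_ continuousOn_id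
  apply ContinuousOn.div continuousOn_const (by fun_prop)
  intro x hx
  have hx' : ‖x‖ < 3 := by simpa using hx
  have : max ‖x‖ 2 < 3 := max_lt hx' (by norm_num)
  linarith

lemma sg_norm (z : Fin n → ℝ) : ‖sg z‖ = 3 / (max ‖z‖ 2 + 1) * ‖z‖ := by
  have := le_max_right ‖z‖ 2
  rw [sg, norm_smul, Real.norm_of_nonneg (by positivity)]

lemma sg_lt (z : Fin n → ℝ) : ‖sg z‖ < 3 := by
  have h1 := le_max_right ‖z‖ 2
  have h2 := le_max_left ‖z‖ 2
  rw [sg_norm, div_mul_eq_mul_div, div_lt_iff₀ (by linarith)]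
  linarith

lemma sg_eq {z : Fin n → ℝ} (h : ‖z‖ ≤ 2) : sg z = z := by
  rw [sg, max_eq_right h]; norm_num
lemma si_eq {z : Fin n → ℝ} (h : ‖z‖ ≤ 2) : si z = z := by
  rw [si, max_eq_right h]; norm_num

lemma si_sg (z : Fin n → ℝ) : si (sg z) = z := by
  rcases le_total ‖z‖ 2 with h | h
  · rw [sg_eq h, si_eq h]
  · have e := sg_norm z
    rw [max_eq_left h] at e
    have h2 : 2 ≤ ‖sg z‖ := by
      rw [e, div_mul_eq_mul_div, le_div_iff₀ (by linarith)]; linarith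
    rw [si, max_eq_left h2, e, sg, max_eq_left h, smul_smul]
    have : (1 / (3 - 3 / (‖z‖ + 1) * ‖z‖)) * (3 / (‖z‖ + 1)) = 1 := by
      have h3 : ‖z‖ + 1 ≠ 0 := by linarith
      have : 3 - 3 / (‖z‖ + 1) * ‖z‖ = 3 / (‖z‖ + 1) := by field_simp; ring
      rw [this]; field_simp
    rw [this, one_smul]

lemma si_norm {y : Fin n → ℝ} (hy : ‖y‖ < 3) : ‖si y‖ = 1 / (3 - max ‖y‖ 2) * ‖y‖ := by
  have : max ‖y‖ 2 < 3 := max_lt hy (by norm_num)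
  rw [si, norm_smul, Real.norm_of_nonneg]
  apply div_nonneg zero_le_one; linarith

lemma si_max {y : Fin n → ℝ} (hy : ‖y‖ < 3) : max ‖si y‖ 2 + 1 = 3 / (3 - max ‖y‖ 2) := by
  rcases le_total ‖y‖ 2 with h | h
  · rw [si_eq h, max_eq_right h]; norm_num
  · have e := si_norm hy
    have h3 : 0 < 3 - ‖y‖ := by linarith
    rw [max_eq_left h] at e
    have h2 : 2 ≤ ‖si y‖ := by
      rw [e, div_mul_eq_mul_div, le_div_iff₀ h3]; linarith
    rw [max_eq_left h2, e, max_eq_left h]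
    field_simp; ring

lemma sg_si {y : Fin n → ℝ} (hy : ‖y‖ < 3) : sg (si y) = y := by
  have : max ‖y‖ 2 < 3 := max_lt hy (by norm_num)
  have h3 : 3 - max ‖y‖ 2 ≠ 0 := by linarith
  rw [sg, si_max hy, si, smul_smul]
  have : 3 / (3 / (3 - max ‖y‖ 2)) * (1 / (3 - max ‖y‖ 2)) = 1 := by
    field_simp
  rw [this, one_smul]

lemma sg_lip (z w : Fin n → ℝ) : ‖sg w - sg z‖ ≤ 6 / (max ‖z‖ 2 + 1) * ‖w - z‖ := by
  have a1 := le_max_right ‖z‖ 2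
  have a2 := le_max_left ‖z‖ 2
  have b1 := le_max_right ‖w‖ 2
  have b2 := le_max_left ‖w‖ 2
  have hm : |max ‖z‖ 2 - max ‖w‖ 2| ≤ ‖w - z‖ := by
    refine (abs_max_sub_max_le_abs _ _ _).trans ?_
    rw [norm_sub_rev]
    exact abs_norm_sub_norm_le _ _
  unfold sg
  set m := max ‖z‖ 2
  set k := max ‖w‖ 2
  have e : (3 / (k + 1)) • w - (3 / (m + 1)) • z =
      (3 / (m + 1)) • (w - z) + (3 / (k + 1) - 3 / (m + 1)) • w := by
    rw [smul_sub, sub_smul]; abel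
  rw [e]
  have t1 : ‖(3 / (m + 1)) • (w - z)‖ = 3 / (m + 1) * ‖w - z‖ := by
    rw [norm_smul, Real.norm_of_nonneg (by positivity)]
  have t2 : ‖(3 / (k + 1) - 3 / (m + 1)) • w‖ ≤ 3 / (m + 1) * ‖w - z‖ := by
    have e2 : 3 / (k + 1) - 3 / (m + 1) = 3 / (m + 1) * ((m - k) / (k + 1)) := by
      have : k + 1 ≠ 0 := by linarith
      have : m + 1 ≠ 0 := by linarith
      field_simp; ring
    rw [e2, norm_smul, norm_mul, Real.norm_of_nonneg (by positivity : 0 ≤ 3 / (m + 1)), mul_assoc]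
    apply mul_le_mul_of_nonneg_left _ (by positivity)
    rw [norm_div, Real.norm_eq_abs, Real.norm_of_nonneg (by linarith : 0 ≤ k + 1),
      div_mul_eq_mul_div, div_le_iff₀ (by linarith)]
    have : 0 ≤ |m - k| := abs_nonneg _
    calc |m - k| * ‖w‖ ≤ |m - k| * (k + 1) := by
          apply mul_le_mul_of_nonneg_left _ this; linarith
      _ ≤ ‖w - z‖ * (k + 1) := by
          apply mul_le_mul_of_nonneg_right hm; linarith
  calc _ ≤ _ := norm_add_le _ _
    _ ≤ 3 / (m + 1) * ‖w - z‖ + 3 / (m + 1) * ‖w - z‖ := by rw [t1]; gcongr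
    _ = _ := by ring

open Classical in
/-- the squeezed map. -/
noncomputable def sq (φ : (Fin n → ℝ) → (Fin n → ℝ)) (x : Fin n → ℝ) : Fin n → ℝ :=
  if ‖x‖ < 3 then sg (φ (si x)) else x

lemma sq_lt {φ : (Fin n → ℝ) → (Fin n → ℝ)} {x : Fin n → ℝ} (h : ‖x‖ < 3) :
    sq φ x = sg (φ (si x)) := by simp [sq, h]
lemma sq_ge {φ : (Fin n → ℝ) → (Fin n → ℝ)} {x : Fin n → ℝ} (h : 3 ≤ ‖x‖) :
    sq φ x = x := by simp [sq, not_lt.2 h]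

lemma sq_dist {φ : (Fin n → ℝ) → (Fin n → ℝ)} {η : ℝ} (hη : 0 ≤ η)
    (d : ∀ x, ‖φ x - x‖ ≤ η) (x : Fin n → ℝ) :
    ‖sq φ x - x‖ ≤ 2 * η * max 0 (3 - max ‖x‖ 2) := by
  rcases lt_or_ge ‖x‖ 3 with h | h
  · have h3 : max ‖x‖ 2 < 3 := max_lt h (by norm_num)
    rw [sq_lt h]
    have := sg_lip (si x) (φ (si x))
    rw [sg_si h, si_max h] at this
    have e : 6 / (3 / (3 - max ‖x‖ 2)) = 2 * (3 - max ‖x‖ 2) := by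
      have : 3 - max ‖x‖ 2 ≠ 0 := by linarith
      field_simp; ring
    rw [e] at this
    rw [max_eq_right (by linarith)]
    calc _ ≤ _ := this
      _ ≤ 2 * (3 - max ‖x‖ 2) * η :=
        mul_le_mul_of_nonneg_left (d _) (by linarith)
      _ = _ := by ring
  · rw [sq_ge h]; simp; positivity

lemma sq_cont {φ : (Fin n → ℝ) → (Fin n → ℝ)} {η : ℝ} (hη : 0 ≤ η)
    (d : ∀ x, ‖φ x - x‖ ≤ η) (c : Continuous φ) : Continuous (sq φ) := by
  rw [continuous_iff_continuousAt]
  intro x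
  rcases lt_or_ge ‖x‖ 3 with h | h
  · have hb : Metric.ball (0 : Fin n → ℝ) 3 ∈ nhds x :=
      Metric.isOpen_ball.mem_nhds (by simpa using h)
    have : ContinuousOn (sq φ) (Metric.ball 0 3) := by
      refine ContinuousOn.congr (f := fun x => sg (φ (si x)))
        ((sg_cont.comp c).comp_continuousOn si_cont) ?_
      intro y hy
      exact sq_lt (by simpa using hy)
    exact this.continuousAt hb
  · have e : sq φ = fun y => (sq φ y - y) + y := by ext; simp
    have hx : sq φ x = x := sq_ge h
    have t : Filter.Tendsto (fun y => sq φ y - y) (nhds x) (nhds 0) := by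
      rw [tendsto_zero_iff_norm_tendsto_zero]
      have hb : Filter.Tendsto (fun y : Fin n → ℝ => 2 * η * max 0 (3 - max ‖y‖ 2)) (nhds x)
          (nhds 0) := by
        have : Continuous (fun y : Fin n → ℝ => 2 * η * max 0 (3 - max ‖y‖ 2)) := by fun_prop
        have h0 := this.tendsto x
        rwa [max_eq_left (a := ‖x‖) (by linarith), max_eq_left (by linarith), mul_zero] at h0
      exact squeeze_zero (fun _ => norm_nonneg _) (fun y => sq_dist hη d y) hb
    unfold ContinuousAt
    rw [hx]
    have t2 := t.add Filter.tendsto_id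
    rw [zero_add] at t2
    rw [e]
    exact t2

lemma sq_sq {φ γ : (Fin n → ℝ) → (Fin n → ℝ)} (hg : ∀ x, γ (φ x) = x) (x : Fin n → ℝ) :
    sq γ (sq φ x) = x := by
  rcases lt_or_ge ‖x‖ 3 with h | h
  · rw [sq_lt h, sq_lt (sg_lt _), si_sg, hg, sg_si h]
  · rw [sq_ge h, sq_ge h]

lemma norm_le_of_coord {x y : Fin n → ℝ} {η : ℝ} (hη : 0 ≤ η) (h : ∀ i, |x i - y i| ≤ η) :
    ‖x - y‖ ≤ η := by
  rw [pi_norm_le_iff_of_nonneg hη]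
  intro i
  simpa using h i

/-- Domain of a handle. -/
def HQ (J : Finset (Fin n)) (a : ℝ) : Set (Fin n → ℝ) :=
  {x | (∀ i ∈ J, |x i| ≤ a) ∧ ∀ i ∉ J, |x i| ≤ 1/2}

/-- Admissible fixed sets for a handle. -/
structure Adm (J : Finset (Fin n)) (κ : ℝ) (Z : Set (Fin n → ℝ)) : Prop where
  up : ∀ x ∈ Z, ∀ i ∈ J, ∀ t : ℝ, Function.update x i t ∈ Z
  out : ∀ x ∈ Z, ∀ c : ℝ, 1 ≤ c → c • x ∈ Z
  bd : ∀ x, ∀ i ∉ J, 1/2 - κ ≤ |x i| → x ∈ Z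

open Classical in
/-- cut off to the cube. -/
noncomputable def cut (J : Finset (Fin n)) (h : (Fin n → ℝ) → (Fin n → ℝ)) (x : Fin n → ℝ) :
    Fin n → ℝ := if ∀ i ∉ J, |x i| ≤ 1/2 then h x else x

lemma cut_cont {J : Finset (Fin n)} {a : ℝ} {h : (Fin n → ℝ) → (Fin n → ℝ)}
    (c : ContinuousOn h (HQ J a))
    (f : ∀ x ∈ HQ J a, (∃ i ∉ J, 1/2 ≤ |x i|) → h x = x) :
    ContinuousOn (cut J h) (Dom J a) := by
  set A : Set (Fin n → ℝ) := {x | ∀ i ∉ J, |x i| ≤ 1/2} with hA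
  set B : Set (Fin n → ℝ) := {x | ∃ i ∉ J, 1/2 ≤ |x i|} with hB
  have cA : IsClosed A := by
    have : A = ⋂ i ∈ {i | i ∉ J}, {x : Fin n → ℝ | |x i| ≤ 1/2} := by ext; simp [hA]
    rw [this]
    exact isClosed_biInter fun i _ =>
      isClosed_le (by fun_prop : Continuous fun x : Fin n → ℝ => |x i|) continuous_const
  have cB : IsClosed B := by
    have : B = ⋃ i ∈ {i | i ∉ J}, {x : Fin n → ℝ | 1/2 ≤ |x i|} := by ext; simp [hB]
    rw [this]
    exact (Set.toFinite _).isClosed_biUnion fun i _ =>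
      isClosed_le continuous_const (by fun_prop : Continuous fun x : Fin n → ℝ => |x i|)
  have e : Dom J a = (Dom J a ∩ A) ∪ (Dom J a ∩ B) := by
    rw [← Set.inter_union_distrib_left, eq_comm, Set.inter_eq_left]
    intro x _
    by_cases hx : ∀ i ∉ J, |x i| ≤ 1/2
    · exact Or.inl hx
    · push Not at hx
      obtain ⟨i, hi, h1⟩ := hx
      exact Or.inr ⟨i, hi, h1.le⟩
  have c1 : ContinuousOn (cut J h) (Dom J a ∩ A) := by
    refine (c.mono (fun x hx => ⟨hx.1, hx.2⟩)).congr ?_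
    intro x hx
    have : ∀ i ∉ J, |x i| ≤ 1/2 := hx.2
    simp only [cut]; rw [if_pos this]
  have c2 : ContinuousOn (cut J h) (Dom J a ∩ B) := by
    refine continuousOn_id.congr ?_
    intro x hx
    by_cases h1 : ∀ i ∉ J, |x i| ≤ 1/2
    · simp only [cut]; rw [if_pos h1]; exact f x ⟨hx.1, h1⟩ hx.2
    · simp only [cut]; rw [if_neg h1]; rfl
  have cD : IsClosed (Dom J a) := by
    have : Dom J a = ⋂ i ∈ J, {x : Fin n → ℝ | |x i| ≤ a} := by ext; simp [Dom]
    rw [this]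
    exact isClosed_biInter fun i _ =>
      isClosed_le (by fun_prop : Continuous fun x : Fin n → ℝ => |x i|) continuous_const
  rw [e]
  exact c1.union_of_isClosed c2 (cD.inter cA) (cD.inter cB)

lemma cut_near {J : Finset (Fin n)} {κ a ε : ℝ} {Z : Set (Fin n → ℝ)} (hZ : Adm J κ Z)
    (hε0 : 0 ≤ ε) (hκ : ε ≤ κ) {h g : (Fin n → ℝ) → (Fin n → ℝ)} (N : NearOn (HQ J a) ε h g)
    (fix : ∀ x ∈ Z, x ∈ HQ J a → h x = x ∧ g x = x) :
    NearOn (Dom J a) ε (cut J h) (cut J g) ∧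
      ∀ x ∈ Z, x ∈ Dom J a → cut J h x = x ∧ cut J g x = x := by
  have d : ∀ {h : (Fin n → ℝ) → (Fin n → ℝ)}, (∀ x ∈ HQ J a, ∀ i, |h x i - x i| ≤ ε) →
      ∀ x ∈ Dom J a, ∀ i, |cut J h x i - x i| ≤ ε := by
    intro h dh x hx i
    simp only [cut]
    split_ifs with h1
    · exact dh x ⟨hx, h1⟩ i
    · simpa using hε0
  have inv : ∀ {h g : (Fin n → ℝ) → (Fin n → ℝ)}, NearOn (HQ J a) ε h g →
      (∀ x ∈ Z, x ∈ HQ J a → h x = x ∧ g x = x) →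
      ∀ x ∈ Dom J a, cut J h x ∈ Dom J a → cut J g (cut J h x) = x := by
    intro h g N fix x hx hy
    by_cases h1 : ∀ i ∉ J, |x i| ≤ 1/2
    · have e : cut J h x = h x := by simp only [cut]; rw [if_pos h1]
      rw [e] at hy ⊢
      by_cases h2 : ∀ i ∉ J, |h x i| ≤ 1/2
      · simp only [cut]; rw [if_pos h2]; exact N.gh x ⟨hx, h1⟩ ⟨hy, h2⟩
      · exfalso
        apply h2
        push Not at h2
        obtain ⟨i, hi, hh⟩ := h2
        have := N.dh x ⟨hx, h1⟩ i
        have h3 : |h x i| ≤ |x i| + ε := near_abs this le_rfl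
        rw [(fix x (hZ.bd x i hi (by linarith)) ⟨hx, h1⟩).1]
        exact h1
    · have e : cut J h x = x := by simp only [cut]; rw [if_neg h1]
      rw [e]; simp only [cut]; rw [if_neg h1]
  have bf : ∀ x ∈ HQ J a, (∃ i ∉ J, 1/2 ≤ |x i|) → h x = x ∧ g x = x := by
    rintro x hx ⟨i, hi, h1⟩
    exact fix x (hZ.bd x i hi (by linarith)) hx
  refine ⟨⟨cut_cont N.ch fun x hx h' => (bf x hx h').1, cut_cont N.cg fun x hx h' => (bf x hx h').2,
    d N.dh, d N.dg, inv N fix, inv N.symm fun x hx hx' => (fix x hx hx').symm⟩, ?_⟩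
  intro x hx hx'
  simp only [cut]
  split_ifs with h1
  · exact fix x hx ⟨hx', h1⟩
  · exact ⟨rfl, rfl⟩

/-- The handle lemma in Euclidean space. -/
lemma handle {J : Finset (Fin n)} {κ ε : ℝ} {Z : Set (Fin n → ℝ)} (hZ : Adm J κ Z)
    (hε0 : 0 ≤ ε) (hκ : ε ≤ κ) (hε : 3 ^ n * ε ≤ 1/24)
    {h g : (Fin n → ℝ) → (Fin n → ℝ)} (N : NearOn (HQ J (6 + n)) ε h g)
    (fix : ∀ x ∈ Z, x ∈ HQ J (6 + n) → h x = x ∧ g x = x) :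
    ∃ f : (Fin n → ℝ) ≃ₜ (Fin n → ℝ), (∀ x ∈ HQ J 1, f x = h x) ∧ (∀ x ∈ Z, f x = x) ∧
      (∀ x, 3 ≤ ‖x‖ → f x = x) ∧ ∀ x, ‖f x - x‖ ≤ 2 * (3 ^ n * ε) := by
  have hc : J.card ≤ n := by simpa using Finset.card_le_univ J
  have hp : (3 : ℝ) ^ J.card ≤ 3 ^ n := pow_le_pow_right₀ (by norm_num) hc
  have hpe : 3 ^ J.card * ε ≤ 3 ^ n * ε := mul_le_mul_of_nonneg_right hp hε0
  obtain ⟨N1, f1⟩ := cut_near hZ hε0 hκ N fix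
  obtain ⟨φ, γ, N2, f2, e2⟩ := wrapAll Z J hZ.up (6 + n) ε _ _
    (by have : (J.card : ℝ) ≤ n := by exact_mod_cast hc
        linarith) hε0 (hpe.trans hε) N1 f1
  set η := 3 ^ n * ε with hη
  have hη0 : 0 ≤ η := by positivity
  have dφ : ∀ x, ‖φ x - x‖ ≤ η := fun x =>
    norm_le_of_coord hη0 fun i => (N2.dh x trivial i).trans hpe
  have dγ : ∀ x, ‖γ x - x‖ ≤ η := fun x =>
    norm_le_of_coord hη0 fun i => (N2.dg x trivial i).trans hpe
  have cφ : Continuous φ := continuousOn_univ.1 N2.ch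
  have cγ : Continuous γ := continuousOn_univ.1 N2.cg
  refine ⟨⟨⟨sq φ, sq γ, sq_sq fun x => N2.gh x trivial trivial,
    sq_sq fun x => N2.hg x trivial trivial⟩, sq_cont hη0 dφ cφ, sq_cont hη0 dγ cγ⟩, ?_, ?_, ?_, ?_⟩
  · intro x hx
    change sq φ x = h x
    have hx1 : ‖x‖ ≤ 1 := by
      rw [pi_norm_le_iff_of_nonneg zero_le_one]
      intro i
      rw [Real.norm_eq_abs]
      by_cases hi : i ∈ J
      · exact hx.1 i hi
      · linarith [hx.2 i hi]
    have e : φ x = h x := by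
      rw [e2 x hx.1]; simp only [cut]; rw [if_pos hx.2]
    rw [sq_lt (by linarith), si_eq (by linarith), sg_eq, e]
    have := norm_add_le (φ x - x) x
    rw [sub_add_cancel] at this
    linarith [dφ x]
  · intro x hx
    change sq φ x = x
    rcases lt_or_ge ‖x‖ 3 with h3 | h3
    · have hm : max ‖x‖ 2 < 3 := max_lt h3 (by norm_num)
      have : si x ∈ Z := by
        apply hZ.out x hx
        rw [le_div_iff₀ (by linarith)]
        linarith [le_max_right ‖x‖ 2]
      rw [sq_lt h3, (f2 _ this).1, sg_si h3]
    · exact sq_ge h3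
  · intro x hx
    exact sq_ge hx
  · intro x
    change ‖sq φ x - x‖ ≤ _
    refine (sq_dist hη0 dφ x).trans ?_
    have : max 0 (3 - max ‖x‖ 2) ≤ 1 := max_le zero_le_one (by linarith [le_max_right ‖x‖ 2])
    nlinarith

end Frag

namespace Frag

section extension
variable {E M T : Type*} [TopologicalSpace E] [TopologicalSpace M] [TopologicalSpace T]

/-- push a self map of the chart domain forward, extended by the identity. -/
noncomputable def ext (e : E → M) (F : E → E) (m : M) : M := Function.extend e (e ∘ F) id m

lemma ext_apply {e : E → M} (he : Function.Injective e) (F : E → E) (x : E) :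
    ext e F (e x) = e (F x) := by
  simp [ext, he.extend_apply]

lemma ext_off {e : E → M} {F : E → E} {K : Set E} (he : Function.Injective e)
    (fix : ∀ x ∉ K, F x = x) {m : M} (hm : m ∉ e '' K) : ext e F m = m := by
  by_cases h : ∃ x, e x = m
  · obtain ⟨x, rfl⟩ := h
    rw [ext_apply he, fix x fun hx => hm ⟨x, hx, rfl⟩]
  · simp [ext, Function.extend_apply' _ _ _ h]

lemma ext_cont [T2Space M] {e : E → M} (he : IsOpenEmbedding e) {F : T → E → E}
    (hF : Continuous fun p : T × E => F p.1 p.2) {K : Set E} (hK : IsCompact K)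
    (fix : ∀ t, ∀ x ∉ K, F t x = x) : Continuous fun p : T × M => ext e (F p.1) p.2 := by
  rw [continuous_iff_continuousAt]
  rintro ⟨t, m⟩
  by_cases h : m ∈ Set.range e
  · obtain ⟨x, rfl⟩ := h
    have ho : IsOpenEmbedding (Prod.map (id : T → T) e) := IsOpenEmbedding.id.prodMap he
    have := ho.continuousAt_iff (g := fun p : T × M => ext e (F p.1) p.2) (x := (t, x))
    refine this.1 ?_
    have e2 : (fun p : T × M => ext e (F p.1) p.2) ∘ Prod.map id e =
        fun p : T × E => e (F p.1 p.2) := by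
      ext p; simp [ext_apply he.injective]
    rw [e2]
    exact (he.continuous.comp hF).continuousAt
  · have ho : IsOpen (e '' K)ᶜ := (hK.image he.continuous).isClosed.isOpen_compl
    have hm : m ∈ (e '' K)ᶜ := fun ⟨x, _, hx⟩ => h ⟨x, hx⟩
    have : ∀ᶠ p : T × M in 𝓝 (t, m), p.2 = ext e (F p.1) p.2 := by
      filter_upwards [continuous_snd.continuousAt.preimage_mem_nhds (ho.mem_nhds hm)] with p hp
      exact (ext_off he.injective (fix p.1) hp).symm
    exact (continuous_snd.continuousAt).congr this

lemma ext_cont' [T2Space M] {e : E → M} (he : IsOpenEmbedding e) {F : E → E}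
    (hF : Continuous F) {K : Set E} (hK : IsCompact K)
    (fix : ∀ x ∉ K, F x = x) : Continuous (ext e F) := by
  have := ext_cont (T := Unit) he (F := fun _ => F) (by fun_prop) hK (fun _ => fix)
  exact this.comp (by fun_prop : Continuous fun m : M => ((), m))

lemma ext_ext {e : E → M} (he : Function.Injective e) {F G : E → E}
    (h : ∀ x, F (G x) = x) (m : M) : ext e F (ext e G m) = m := by
  by_cases hm : ∃ x, e x = m
  · obtain ⟨x, rfl⟩ := hm
    rw [ext_apply he, ext_apply he, h]
  · have : ∀ F : E → E, ext e F m = m := fun F => by simp [ext, Function.extend_apply' _ _ _ hm]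
    rw [this, this]

lemma symm_fix {f : E ≃ₜ E} {x : E} (h : f x = x) : f.symm x = x := by
  rw [Homeomorph.symm_apply_eq, h]

/-- push a homeomorphism of the chart domain forward, extended by the identity. -/
noncomputable def extH [T2Space M] {e : E → M} (he : IsOpenEmbedding e) (f : E ≃ₜ E) {K : Set E}
    (hK : IsCompact K) (fix : ∀ x ∉ K, f x = x) : M ≃ₜ M where
  toFun := ext e f
  invFun := ext e f.symm
  left_inv := ext_ext he.injective (by simp)
  right_inv := ext_ext he.injective (by simp)
  continuous_toFun := ext_cont' he f.continuous hK fix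
  continuous_invFun := ext_cont' he f.symm.continuous hK fun x hx => symm_fix (fix x hx)

end extension

section alexander
variable {E : Type*} [NormedAddCommGroup E] [NormedSpace ℝ E]

open Classical in
/-- The Alexander trick. -/
noncomputable def alex (F : E → E) (t : unitInterval) (x : E) : E :=
  if (t : ℝ) = 0 then x else (t : ℝ) • F ((t : ℝ)⁻¹ • x)

lemma alex_alex {F G : E → E} (h : ∀ x, F (G x) = x) (t : unitInterval) (x : E) :
    alex F t (alex G t x) = x := by
  unfold alex
  split_ifs with h1
  · rfl
  · rw [smul_smul, inv_mul_cancel₀ h1, one_smul, h, smul_smul, mul_inv_cancel₀ h1, one_smul]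

lemma alex_fix {F : E → E} (fix : ∀ x, 1 ≤ ‖x‖ → F x = x) (t : unitInterval) (x : E)
    (hx : (t : ℝ) ≤ ‖x‖) : alex F t x = x := by
  unfold alex
  split_ifs with h1
  · rfl
  · have ht : 0 < (t : ℝ) := lt_of_le_of_ne t.2.1 (Ne.symm h1)
    rw [fix, smul_smul, mul_inv_cancel₀ h1, one_smul]
    rw [norm_smul, norm_inv, Real.norm_of_nonneg ht.le, ← div_eq_inv_mul, le_div_iff₀ ht]
    linarith

lemma alex_dist {F : E → E} (inj : Function.Injective F) (fix : ∀ x, 1 ≤ ‖x‖ → F x = x)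
    (t : unitInterval) (x : E) : ‖alex F t x - x‖ ≤ 2 * t := by
  have ht0 : 0 ≤ (t : ℝ) := t.2.1
  rcases le_or_gt (t : ℝ) ‖x‖ with h | h
  · rw [alex_fix fix t x h]; simpa using ht0
  · have hF : ∀ y, ‖y‖ ≤ 1 → ‖F y‖ ≤ 1 := by
      intro y hy
      by_contra hc
      push Not at hc
      have := inj (fix (F y) hc.le)
      rw [this] at hc; linarith
    have : ‖alex F t x‖ ≤ t := by
      unfold alex
      split_ifs with h1
      · exact h.le
      · have ht : 0 < (t : ℝ) := lt_of_le_of_ne t.2.1 (Ne.symm h1)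
        rw [norm_smul, Real.norm_of_nonneg ht.le]
        have : ‖(t : ℝ)⁻¹ • x‖ ≤ 1 := by
          rw [norm_smul, norm_inv, Real.norm_of_nonneg ht.le, ← div_eq_inv_mul, div_le_iff₀ ht]
          linarith
        nlinarith [hF _ this]
    linarith [norm_sub_le (alex F t x) x]

lemma alex_cont {F : E → E} (c : Continuous F) (inj : Function.Injective F)
    (fix : ∀ x, 1 ≤ ‖x‖ → F x = x) : Continuous fun p : unitInterval × E => alex F p.1 p.2 := by
  rw [continuous_iff_continuousAt]
  rintro ⟨t, x⟩
  by_cases h : (t : ℝ) = 0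
  · have t1 : Filter.Tendsto (fun p : unitInterval × E => alex F p.1 p.2 - p.2) (𝓝 (t, x)) (𝓝 0) := by
      rw [tendsto_zero_iff_norm_tendsto_zero]
      have hb : Filter.Tendsto (fun p : unitInterval × E => 2 * (p.1 : ℝ)) (𝓝 (t, x)) (𝓝 0) := by
        have : Continuous (fun p : unitInterval × E => 2 * (p.1 : ℝ)) := by fun_prop
        have h0 := this.tendsto (t, x)
        simpa [h] using h0
      exact squeeze_zero (fun _ => norm_nonneg _) (fun p => alex_dist inj fix p.1 p.2) hb
    have t2 := t1.add (continuous_snd.tendsto (t, x))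
    unfold ContinuousAt
    simp only [sub_add_cancel, zero_add] at t2
    simpa [alex, h] using t2
  · have ev : ∀ᶠ p : unitInterval × E in 𝓝 (t, x), (p.1 : ℝ) ≠ 0 := by
      have : Continuous fun p : unitInterval × E => (p.1 : ℝ) := by fun_prop
      exact this.continuousAt.eventually_ne h
    have c2 : ContinuousAt (fun p : unitInterval × E => (p.1 : ℝ) • F ((p.1 : ℝ)⁻¹ • p.2)) (t, x) := by
      have c0 : ContinuousAt (fun p : unitInterval × E => (p.1 : ℝ)) (t, x) := by fun_prop
      refine ContinuousAt.fun_smul c0 ?_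
      refine c.continuousAt.comp ?_
      exact (c0.inv₀ h).smul continuousAt_snd
    refine c2.congr ?_
    filter_upwards [ev] with p hp
    simp [alex, hp]

end alexander

section easy
variable {E M : Type*} [NormedAddCommGroup E] [NormedSpace ℝ E] [ProperSpace E]
  [TopologicalSpace M] [T2Space M]

lemma iso_comp {g h : M ≃ₜ M} (hg : IsotopicToId g) (hh : IsotopicToId h) :
    IsotopicToId (h.trans g) := by
  obtain ⟨H, c, h0, h1, hh1⟩ := hg
  obtain ⟨K, c', k0, k1, kk⟩ := hh
  refine ⟨fun p => H (p.1, K p), by fun_prop, by simp [h0, k0], by simp [h1, k1], fun t => ?_⟩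
  obtain ⟨a, ha⟩ := hh1 t
  obtain ⟨b, hb⟩ := kk t
  exact ⟨b.trans a, fun x => by simp [ha, hb]⟩

lemma iso_refl : IsotopicToId (Homeomorph.refl M) :=
  ⟨fun p => p.2, by fun_prop, by simp, by simp, fun _ => ⟨Homeomorph.refl M, by simp⟩⟩

lemma iso_supp {g : M ≃ₜ M} {e : E → M} (he : IsOpenEmbedding e)
    (hg : ∀ x ∉ e '' Metric.ball (0 : E) 1, g x = x) : IsotopicToId g := by
  have pres : ∀ x, ∃ y, e y = g (e x) := by
    intro x
    by_contra hc
    have := g.injective (hg (g (e x)) (by rintro ⟨y, _, hy⟩; exact hc ⟨y, hy⟩))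
    exact hc ⟨x, this.symm⟩
  have hg' : ∀ x ∉ e '' Metric.ball (0 : E) 1, g.symm x = x := fun x hx => symm_fix (hg x hx)
  have pres' : ∀ x, ∃ y, e y = g.symm (e x) := by
    intro x
    by_contra hc
    have := g.symm.injective (hg' (g.symm (e x)) (by rintro ⟨y, _, hy⟩; exact hc ⟨y, hy⟩))
    exact hc ⟨x, this.symm⟩
  choose F hF using pres
  choose F' hF' using pres'
  have cF : Continuous F := by
    rw [he.isInducing.continuous_iff]
    have : e ∘ F = g ∘ e := by ext x; simp [hF]
    rw [this]; exact g.continuous.comp he.continuous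
  have cF' : Continuous F' := by
    rw [he.isInducing.continuous_iff]
    have : e ∘ F' = g.symm ∘ e := by ext x; simp [hF']
    rw [this]; exact g.symm.continuous.comp he.continuous
  have i1 : ∀ x, F (F' x) = x := fun x => he.injective (by rw [hF, hF']; simp)
  have i2 : ∀ x, F' (F x) = x := fun x => he.injective (by rw [hF', hF]; simp)
  have nm : ∀ x : E, 1 ≤ ‖x‖ → e x ∉ e '' Metric.ball (0 : E) 1 := by
    rintro x hx ⟨y, hy, hxy⟩
    rw [he.injective hxy] at hy
    simp at hy; linarith
  have fF : ∀ x, 1 ≤ ‖x‖ → F x = x := fun x hx => he.injective (by rw [hF, hg _ (nm x hx)])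
  have fF' : ∀ x, 1 ≤ ‖x‖ → F' x = x := fun x hx => he.injective (by rw [hF', hg' _ (nm x hx)])
  have inj : Function.Injective F := Function.LeftInverse.injective i2
  have inj' : Function.Injective F' := Function.LeftInverse.injective i1
  have hK : IsCompact (Metric.closedBall (0 : E) 1) := isCompact_closedBall _ _
  have oK : ∀ x ∉ Metric.closedBall (0 : E) 1, ∀ t : unitInterval, (t : ℝ) ≤ ‖x‖ := by
    intro x hx t
    simp at hx
    exact t.2.2.trans hx.le
  have cA := alex_cont cF inj fF
  have cA' := alex_cont cF' inj' fF'
  have H1 := ext_cont he cA hK (fun t x hx => alex_fix fF t x (oK x hx t))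
  have H2 := ext_cont he cA' hK (fun t x hx => alex_fix fF' t x (oK x hx t))
  refine ⟨_, H1, ?_, ?_, ?_⟩
  · intro m
    exact ext_off (K := ∅) he.injective (by simp [alex]) (by simp)
  · intro m
    by_cases hm : ∃ x, e x = m
    · obtain ⟨x, rfl⟩ := hm
      simp [ext_apply he.injective, alex, hF]
    · simp only [ext, Function.extend_apply' _ _ _ hm]
      rw [hg, id]
      rintro ⟨y, _, hy⟩; exact hm ⟨y, hy⟩
  · intro t
    refine ⟨⟨⟨ext e (alex F t), ext e (alex F' t), ext_ext he.injective (alex_alex i2 t),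
      ext_ext he.injective (alex_alex i1 t)⟩, ?_, ?_⟩, fun x => rfl⟩
    · exact H1.comp (by fun_prop : Continuous fun m : M => (t, m))
    · exact H2.comp (by fun_prop : Continuous fun m : M => (t, m))

/-- the composition of a list of homeomorphisms. -/
lemma iso_list (l : List (M ≃ₜ M)) (hl : ∀ g ∈ l, IsotopicToId g) (g : M ≃ₜ M)
    (hg : ∀ x, g x = (l.map fun h : M ≃ₜ M => (h : M → M)).foldr (· ∘ ·) id x) : IsotopicToId g := by
  induction l generalizing g with
  | nil =>
    have : g = Homeomorph.refl M := by ext x; simpa using hg x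
    rw [this]; exact iso_refl
  | cons a l ih =>
    have h1 : IsotopicToId (g.trans a.symm) := by
      refine ih (fun g hg => hl g (by simp [hg])) _ ?_
      intro x
      simp [hg]
    have := iso_comp (hl a (by simp)) h1
    have e : (g.trans a.symm).trans a = g := by ext x; simp
    rwa [e] at this

end easy

end Frag

namespace Frag

section group
variable {M : Type*} [TopologicalSpace M]

/-- homeomorphisms compactly supported in a chart. -/
def Gen (M : Type*) [TopologicalSpace M] (n : ℕ) : Set (M ≃ₜ M) :=
  {f | ∃ e : (Fin n → ℝ) → M, IsOpenEmbedding e ∧ ∃ K, IsCompact K ∧ ∀ x ∉ e '' K, f x = x}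

/-- the group (as a submonoid) generated by `Gen`. -/
def GG (M : Type*) [TopologicalSpace M] (n : ℕ) : Submonoid (M ≃ₜ M) :=
  Submonoid.closure (Gen M n)

end group

section metric
variable {n : ℕ} {M : Type*} [MetricSpace M]

lemma chart_near {e : (Fin n → ℝ) → M} (he : IsOpenEmbedding e) {K : Set (Fin n → ℝ)}
    (hK : IsCompact K) {δ : ℝ} (hδ : 0 < δ) :
    ∃ ε > 0, ∀ x ∈ K, ∀ m, dist m (e x) < ε → ∃ y, e y = m ∧ dist y x < δ := by
  obtain ⟨ε, hε, H⟩ := lebesgue_number_lemma_of_metric (s := e '' K)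
    (c := fun x => e '' Metric.ball x (δ / 2)) (hK.image he.continuous)
    (fun i => he.isOpenMap _ Metric.isOpen_ball)
    (by
      rintro _ ⟨x, _, rfl⟩
      exact Set.mem_iUnion.2 ⟨x, x, by simpa using hδ, rfl⟩)
  refine ⟨ε, hε, fun x hx m hm => ?_⟩
  obtain ⟨i, hi⟩ := H (e x) ⟨x, hx, rfl⟩
  obtain ⟨y, hy, rfl⟩ := hi hm
  obtain ⟨z, hz, hzx⟩ := hi (Metric.mem_ball_self hε)
  rw [he.injective hzx] at hz
  refine ⟨y, rfl, ?_⟩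
  have := dist_triangle_right y x i
  simp only [Metric.mem_ball] at hy hz
  linarith

lemma HQ_compact (J : Finset (Fin n)) (a : ℝ) : IsCompact (HQ J a) := by
  apply Metric.isCompact_of_isClosed_isBounded
  · have : HQ J a = (⋂ i ∈ J, {x : Fin n → ℝ | |x i| ≤ a}) ∩
        ⋂ i ∈ {i | i ∉ J}, {x : Fin n → ℝ | |x i| ≤ 1/2} := by ext; simp [HQ]
    rw [this]
    exact (isClosed_biInter fun i _ =>
      isClosed_le (by fun_prop : Continuous fun x : Fin n → ℝ => |x i|) continuous_const).inter
      (isClosed_biInter fun i _ =>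
      isClosed_le (by fun_prop : Continuous fun x : Fin n → ℝ => |x i|) continuous_const)
  · refine Metric.isBounded_closedBall (x := (0 : Fin n → ℝ)) (r := max |a| (1/2)) |>.subset ?_
    intro x hx
    rw [mem_closedBall_zero_iff, pi_norm_le_iff_of_nonneg (by positivity)]
    intro i
    rw [Real.norm_eq_abs]
    by_cases hi : i ∈ J
    · exact (hx.1 i hi).trans ((le_abs_self a).trans (le_max_left _ _))
    · exact (hx.2 i hi).trans (le_max_right _ _)

lemma handleM {e : (Fin n → ℝ) → M} (he : IsOpenEmbedding e) {J : Finset (Fin n)} {κ : ℝ}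
    {Z : Set (Fin n → ℝ)} (hZ : Adm J κ Z) (hκ : 0 < κ) {η : ℝ} (hη : 0 < η) :
    ∃ ε > 0, ∀ h : M ≃ₜ M, (∀ x, dist (h x) x < ε) →
      (∀ x ∈ Z, x ∈ HQ J (6 + n) → h (e x) = e x) → ∃ f ∈ GG M n, (∀ x, dist (f x) x < η) ∧
      (∀ x ∈ HQ J 1, f (e x) = h (e x)) ∧ ∀ m, m ∉ e '' {x | ‖x‖ < 3 ∧ x ∉ Z} → f m = m := by
  have hB : IsCompact (Metric.closedBall (0 : Fin n → ℝ) 3) := isCompact_closedBall _ _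
  obtain ⟨δ, hδ, Hδ⟩ := Metric.uniformContinuousOn_iff.1
    (hB.uniformContinuousOn_of_continuous he.continuous.continuousOn) η hη
  have h3 : (0 : ℝ) < 3 ^ n := by positivity
  set ε1 := min κ (min (1/24/3^n) (δ / 4 / 3^n)) with hε1
  have ε1pos : 0 < ε1 := by positivity
  have b1 : ε1 ≤ κ := min_le_left _ _
  have b2 : 3 ^ n * ε1 ≤ 1/24 := by
    have : ε1 ≤ 1/24/3^n := (min_le_right _ _).trans (min_le_left _ _)
    rw [le_div_iff₀ h3] at this; linarith
  have b3 : 3 ^ n * ε1 ≤ δ / 4 := by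
    have : ε1 ≤ δ/4/3^n := (min_le_right _ _).trans (min_le_right _ _)
    rw [le_div_iff₀ h3] at this; linarith
  obtain ⟨ε, hε, Hε⟩ := chart_near he (HQ_compact J (6 + n)) ε1pos
  refine ⟨ε, hε, fun h hn hfix => ?_⟩
  have key : ∀ h : M ≃ₜ M, (∀ x, dist (h x) x < ε) → ∀ x ∈ HQ J (6 + n),
      e (Function.invFun e (h (e x))) = h (e x) ∧
        dist (Function.invFun e (h (e x))) x < ε1 := by
    intro h hn x hx
    obtain ⟨y, hy, hd⟩ := Hε x hx (h (e x)) (hn _)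
    rw [← hy, Function.leftInverse_invFun he.injective y]
    exact ⟨rfl, hd⟩
  have hn' : ∀ x, dist (h.symm x) x < ε := by
    intro x
    have := hn (h.symm x)
    rw [Homeomorph.apply_symm_apply, dist_comm] at this
    exact this
  have cont : ∀ h : M ≃ₜ M, (∀ x, dist (h x) x < ε) →
      ContinuousOn (fun x => Function.invFun e (h (e x))) (HQ J (6 + n)) := by
    intro h hn
    rw [he.isInducing.continuousOn_iff]
    exact (h.continuous.comp he.continuous).continuousOn.congr fun x hx => (key h hn x hx).1
  have nr : ∀ h : M ≃ₜ M, (∀ x, dist (h x) x < ε) → ∀ x ∈ HQ J (6 + n), ∀ i,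
      |Function.invFun e (h (e x)) i - x i| ≤ ε1 := by
    intro h hn x hx i
    rw [← Real.dist_eq]
    exact (dist_le_pi_dist _ _ i).trans (key h hn x hx).2.le
  have N : NearOn (HQ J (6 + n)) ε1 (fun x => Function.invFun e (h (e x)))
      (fun x => Function.invFun e (h.symm (e x))) := by
    refine ⟨cont h hn, cont h.symm hn', nr h hn, nr h.symm hn', ?_, ?_⟩
    · intro x hx hy
      apply he.injective
      rw [(key h.symm hn' _ hy).1, (key h hn x hx).1, Homeomorph.symm_apply_apply]
    · intro x hx hy
      apply he.injective
      rw [(key h hn _ hy).1, (key h.symm hn' x hx).1, Homeomorph.apply_symm_apply]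
  have fix : ∀ x ∈ Z, x ∈ HQ J (6 + n) → Function.invFun e (h (e x)) = x ∧
      Function.invFun e (h.symm (e x)) = x := by
    intro x hx hx'
    have := hfix x hx hx'
    rw [symm_fix this, this, Function.leftInverse_invFun he.injective x]
    exact ⟨rfl, rfl⟩
  obtain ⟨f, f1, f2, f3, f4⟩ := handle hZ ε1pos.le b1 b2 N fix
  have offK : ∀ x ∉ Metric.closedBall (0 : Fin n → ℝ) 3, f x = x := by
    intro x hx
    rw [mem_closedBall_zero_iff, not_le] at hx
    exact f3 x hx.le
  have pres : ∀ x ∈ Metric.closedBall (0 : Fin n → ℝ) 3, f x ∈ Metric.closedBall (0 : Fin n → ℝ) 3 := by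
    intro x hx
    by_contra hc
    exact hc (by rw [f.injective (offK _ hc)]; exact hx)
  have ap : ∀ x, extH he f hB offK (e x) = e (f x) := fun x => ext_apply he.injective f x
  refine ⟨extH he f hB offK, Submonoid.subset_closure ⟨e, he, _, hB,
    fun x hx => ext_off he.injective offK hx⟩, ?_, ?_, ?_⟩
  · intro m
    by_cases hm : m ∈ e '' Metric.closedBall (0 : Fin n → ℝ) 3
    · obtain ⟨x, hx, rfl⟩ := hm
      rw [ap]
      apply Hδ _ (pres x hx) _ hx
      rw [dist_eq_norm]
      linarith [f4 x]
    · have : extH he f hB offK m = m := ext_off he.injective offK hm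
      rw [this, dist_self]; exact hη
  · intro x hx
    rw [ap, f1 x hx]
    refine (key h hn x ⟨fun i hi => (hx.1 i hi).trans ?_, hx.2⟩).1
    have : (0 : ℝ) ≤ n := Nat.cast_nonneg n
    linarith
  · intro m hm
    refine ext_off he.injective (F := f) ?_ hm
    intro x hx
    by_cases hxZ : x ∈ Z
    · exact f2 x hxZ
    · apply f3; by_contra hc; exact hx ⟨not_le.1 hc, hxZ⟩

/-- homeomorphisms near the identity and fixed on `C` can be modified to be fixed on `C'`. -/
def Red (n : ℕ) (C C' : Set M) : Prop :=
  ∀ η > 0, ∃ ε > 0, ∀ h : M ≃ₜ M, (∀ x, dist (h x) x < ε) → (∀ x ∈ C, h x = x) →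
    ∃ f ∈ GG M n, (∀ x, dist (f.symm (h x)) x < η) ∧ ∀ x ∈ C', f.symm (h x) = x

lemma Red.refl (C : Set M) : Red n C C :=
  fun η hη => ⟨η, hη, fun _ hh hC => ⟨1, one_mem _, hh, hC⟩⟩

lemma Red.mono {C C' D D' : Set M} (h : Red n C C') (h1 : C ⊆ D) (h2 : D' ⊆ C') : Red n D D' := by
  intro η hη
  obtain ⟨ε, hε, H⟩ := h η hη
  refine ⟨ε, hε, fun h hh hC => ?_⟩
  obtain ⟨f, hf, a, b⟩ := H h hh fun x hx => hC x (h1 hx)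
  exact ⟨f, hf, a, fun x hx => b x (h2 hx)⟩

lemma Red.trans {C C' C'' : Set M} (h1 : Red n C C') (h2 : Red n C' C'') : Red n C C'' := by
  intro η hη
  obtain ⟨ε, hε, H⟩ := h2 η hη
  obtain ⟨ε', hε', H'⟩ := h1 ε hε
  refine ⟨ε', hε', fun h hh hC => ?_⟩
  obtain ⟨f, hf, a, b⟩ := H' h hh hC
  obtain ⟨f', hf', a', b'⟩ := H (h.trans f.symm) a b
  exact ⟨f * f', mul_mem hf hf', a', b'⟩

lemma redHandle {e : (Fin n → ℝ) → M} (he : IsOpenEmbedding e) {J : Finset (Fin n)} {κ : ℝ}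
    {Z : Set (Fin n → ℝ)} (hZ : Adm J κ Z) (hκ : 0 < κ) {C C' : Set M}
    (hC : ∀ x ∈ Z, x ∈ HQ J (6 + n) → e x ∈ C)
    (hC' : ∀ m ∈ C', m ∈ e '' HQ J 1 ∨ (m ∈ C ∧ m ∉ e '' {x | ‖x‖ < 3 ∧ x ∉ Z})) : Red n C C' := by
  intro η hη
  obtain ⟨ε, hε, H⟩ := handleM he hZ hκ (half_pos hη)
  refine ⟨min ε (η / 2), lt_min hε (half_pos hη), fun h hh hfix => ?_⟩
  obtain ⟨f, hf, f1, f2, f3⟩ := H h (fun x => (hh x).trans_le (min_le_left _ _))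
    (fun x hx hx' => hfix _ (hC x hx hx'))
  refine ⟨f, hf, ?_, ?_⟩
  · intro x
    have a := (hh x).trans_le (min_le_right _ _)
    have b := f1 (f.symm (h x))
    rw [Homeomorph.apply_symm_apply, dist_comm] at b
    linarith [dist_triangle (f.symm (h x)) (h x) x]
  · intro m hm
    rcases hC' m hm with ⟨x, hx, rfl⟩ | ⟨h1, h2⟩
    · rw [← f2 x hx, Homeomorph.symm_apply_apply]
    · rw [hfix m h1]; exact symm_fix (f3 m h2)

end metric

end Frag

namespace Frag

section cells
variable {n : ℕ}

/-- thickness of handles. -/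
noncomputable def tt (n m : ℕ) : ℝ := (6 + (n : ℝ)) ^ m / (8 * (6 + (n : ℝ)) ^ n)

lemma tt_pos (n m : ℕ) : 0 < tt n m := by unfold tt; positivity

lemma tt_mono (n : ℕ) {m k : ℕ} (h : m ≤ k) : tt n m ≤ tt n k := by
  unfold tt
  have : (1 : ℝ) ≤ 6 + n := by have : (0 : ℝ) ≤ n := Nat.cast_nonneg n
                               linarith
  gcongr

lemma tt_succ (n m : ℕ) : (6 + (n : ℝ)) * tt n m = tt n (m + 1) := by
  unfold tt; rw [pow_succ]; ring

lemma tt_le {m : ℕ} (h : m ≤ n) : tt n m ≤ 1 / 8 := by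
  refine (tt_mono n h).trans (le_of_eq ?_)
  unfold tt
  have : (6 + (n : ℝ)) ^ n ≠ 0 := by positivity
  field_simp

lemma card_le (J : Finset (Fin n)) : J.card ≤ n := by simpa using Finset.card_le_univ J

/-- the fixed set in handle coordinates. -/
def ZZ (J : Finset (Fin n)) : Set (Fin n → ℝ) :=
  {u | ∃ S : Finset (Fin n), S.Nonempty ∧ Disjoint S J ∧
    ∀ i ∈ S, 1/2 - tt n (J.card + S.card) ≤ |u i|}

lemma ZZ_adm (J : Finset (Fin n)) : Adm J (tt n (J.card + 1)) (ZZ J) := by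
  refine ⟨?_, ?_, ?_⟩
  · rintro x ⟨S, h1, h2, h3⟩ i hi t
    refine ⟨S, h1, h2, fun l hl => ?_⟩
    have : l ≠ i := fun h => (Finset.disjoint_left.1 h2 hl) (h ▸ hi)
    rw [Function.update_of_ne this]
    exact h3 l hl
  · rintro x ⟨S, h1, h2, h3⟩ c hc
    refine ⟨S, h1, h2, fun l hl => (h3 l hl).trans ?_⟩
    rw [Pi.smul_apply, smul_eq_mul, abs_mul, abs_of_nonneg (by linarith : 0 ≤ c)]
    nlinarith [abs_nonneg (x l)]
  · intro x i hi h
    exact ⟨{i}, by simp, by simpa using hi, by simpa using h⟩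

open Classical in
/-- handle coordinates. -/
noncomputable def AA (b : Finset (Fin n) × (Fin n → ℤ)) : (Fin n → ℝ) ≃ₜ (Fin n → ℝ) where
  toFun u i := if i ∈ b.1 then b.2 i + tt n b.1.card * u i else b.2 i + 1/2 + u i
  invFun x i := if i ∈ b.1 then (x i - b.2 i) / tt n b.1.card else x i - b.2 i - 1/2
  left_inv u := by
    ext i
    have := (tt_pos n b.1.card).ne'
    by_cases h : i ∈ b.1
    · simp [h]; field_simp
    · simp [h]; ring
  right_inv u := by
    ext i
    have := (tt_pos n b.1.card).ne'
    by_cases h : i ∈ b.1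
    · simp [h]; field_simp; ring
    · simp [h]
  continuous_toFun := by
    apply continuous_pi
    intro i
    by_cases h : i ∈ b.1
    · simp only [h, if_true]; fun_prop
    · simp only [h, if_false]; fun_prop
  continuous_invFun := by
    apply continuous_pi
    intro i
    by_cases h : i ∈ b.1
    · simp only [h, if_true]; fun_prop
    · simp only [h, if_false]; fun_prop

lemma AA_mem {b : Finset (Fin n) × (Fin n → ℤ)} {i : Fin n} (h : i ∈ b.1) (u : Fin n → ℝ) :
    AA b u i = b.2 i + tt n b.1.card * u i := by
  change (if i ∈ b.1 then _ else _) = _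
  rw [if_pos h]

lemma AA_nmem {b : Finset (Fin n) × (Fin n → ℤ)} {i : Fin n} (h : i ∉ b.1) (u : Fin n → ℝ) :
    AA b u i = b.2 i + 1/2 + u i := by
  change (if i ∈ b.1 then _ else _) = _
  rw [if_neg h]

/-- core of a handle. -/
def HH (b : Finset (Fin n) × (Fin n → ℤ)) : Set (Fin n → ℝ) := AA b '' HQ b.1 1
/-- support of a handle modification. -/
def VV (b : Finset (Fin n) × (Fin n → ℤ)) : Set (Fin n → ℝ) := AA b '' {x | ‖x‖ < 3 ∧ x ∉ ZZ b.1}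

lemma mem_HH {b : Finset (Fin n) × (Fin n → ℤ)} {x : Fin n → ℝ} :
    x ∈ HH b ↔ (∀ i ∈ b.1, |x i - b.2 i| ≤ tt n b.1.card) ∧
      ∀ i ∉ b.1, b.2 i ≤ x i ∧ x i ≤ b.2 i + 1 := by
  have tp := tt_pos n b.1.card
  constructor
  · rintro ⟨u, ⟨h1, h2⟩, rfl⟩
    refine ⟨fun i hi => ?_, fun i hi => ?_⟩
    · rw [AA_mem hi, add_sub_cancel_left, abs_mul, abs_of_pos tp]
      nlinarith [h1 i hi]
    · rw [AA_nmem hi]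
      have := abs_le.1 (h2 i hi)
      constructor <;> linarith
  · rintro ⟨h1, h2⟩
    refine ⟨(AA b).symm x, ?_, by simp⟩
    obtain ⟨u, rfl⟩ := (AA b).surjective x
    rw [Homeomorph.symm_apply_apply]
    refine ⟨fun i hi => ?_, fun i hi => ?_⟩
    · have := h1 i hi
      rw [AA_mem hi, add_sub_cancel_left, abs_mul, abs_of_pos tp] at this
      nlinarith
    · have := h2 i hi
      rw [AA_nmem hi] at this
      rw [abs_le]; constructor <;> linarith

/-- the fixed part of a handle is covered by bigger-index handles. -/
lemma ZZ_cover {b : Finset (Fin n) × (Fin n → ℤ)} {u : Fin n → ℝ} (hu : u ∈ ZZ b.1)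
    (hq : u ∈ HQ b.1 (6 + n)) : ∃ c : Finset (Fin n) × (Fin n → ℤ), b.1.card < c.1.card ∧
      (∀ i, |c.2 i - b.2 i| ≤ 1) ∧ AA b u ∈ HH c := by
  classical
  obtain ⟨S, h1, h2, h3⟩ := hu
  have hcard : (b.1 ∪ S).card = b.1.card + S.card := Finset.card_union_of_disjoint h2.symm
  have hS : 0 < S.card := h1.card_pos
  refine ⟨(b.1 ∪ S, fun i => if i ∈ S ∧ 0 ≤ u i then b.2 i + 1 else b.2 i), ?_, ?_, ?_⟩
  · simp only [hcard]; omega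
  · intro i
    dsimp only
    split_ifs <;> simp
  · rw [mem_HH]
    dsimp only
    rw [hcard]
    have tp := tt_pos n b.1.card
    refine ⟨fun i hi => ?_, fun i hi => ?_⟩
    · by_cases hi' : i ∈ S
      · have hb : i ∉ b.1 := Finset.disjoint_left.1 h2 hi'
        have a1 := h3 i hi'
        have a2 := abs_le.1 (hq.2 i hb)
        rw [AA_nmem hb]
        by_cases h0 : 0 ≤ u i
        · rw [if_pos ⟨hi', h0⟩]
          rw [abs_of_nonneg h0] at a1
          push_cast
          rw [abs_le]; constructor <;> linarith
        · rw [if_neg (fun h => h0 h.2)]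
          rw [abs_of_neg (not_le.1 h0)] at a1
          rw [abs_le]; constructor <;> linarith
      · have hb : i ∈ b.1 := by simpa [hi'] using hi
        rw [if_neg (fun h => hi' h.1), AA_mem hb, add_sub_cancel_left, abs_mul, abs_of_pos tp]
        have a1 := hq.1 i hb
        have a2 := tt_succ n b.1.card
        have a3 : tt n (b.1.card + 1) ≤ tt n (b.1.card + S.card) := tt_mono n (by omega)
        nlinarith
    · have hb : i ∉ b.1 := fun h => hi (Finset.mem_union_left _ h)
      have hs : i ∉ S := fun h => hi (Finset.mem_union_right _ h)
      rw [if_neg (fun h => hs h.1), AA_nmem hb]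
      have a2 := abs_le.1 (hq.2 i hb)
      constructor <;> linarith

lemma VV_mem {b : Finset (Fin n) × (Fin n → ℤ)} {x : Fin n → ℝ} (hx : x ∈ VV b) :
    (∀ i ∈ b.1, |x i - b.2 i| < 3 / 8) ∧ (∀ i ∉ b.1, b.2 i < x i ∧ x i < b.2 i + 1) := by
  obtain ⟨u, ⟨hu, hz⟩, rfl⟩ := hx
  have tp := tt_pos n b.1.card
  have tl := tt_le (card_le b.1)
  refine ⟨fun i hi => ?_, fun i hi => ?_⟩
  · rw [AA_mem hi, add_sub_cancel_left, abs_mul, abs_of_pos tp]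
    have : |u i| < 3 := (norm_le_pi_norm u i).trans_lt hu
    nlinarith [abs_nonneg (u i)]
  · rw [AA_nmem hi]
    have : |u i| < 1/2 := by
      by_contra hc
      apply hz
      exact (ZZ_adm b.1).bd u i hi (by linarith [tt_pos n (b.1.card + 1)])
    rw [abs_lt] at this
    constructor <;> linarith

lemma HH_VV {b c : Finset (Fin n) × (Fin n → ℤ)} {x : Fin n → ℝ} (hb : x ∈ HH b) (hc : x ∈ VV c) :
    b.1 ⊆ c.1 ∧ (∀ i, |b.2 i - c.2 i| ≤ 1) ∧ (b.1 = c.1 → b = c) := by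
  classical
  have hb' := mem_HH.1 hb
  have hc' := VV_mem hc
  have tl := tt_le (card_le b.1)
  have sub : b.1 ⊆ c.1 := by
    by_contra hns
    have hS : (b.1 \ c.1).Nonempty := Finset.sdiff_nonempty.2 hns
    obtain ⟨u, ⟨hu, hz⟩, rfl⟩ := hc
    apply hz
    refine ⟨b.1 \ c.1, hS, Finset.sdiff_disjoint, fun i hi => ?_⟩
    obtain ⟨hib, hic⟩ := Finset.mem_sdiff.1 hi
    have a1 := hb'.1 i hib
    have a2 : tt n b.1.card ≤ tt n (c.1.card + (b.1 \ c.1).card) := by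
      apply tt_mono
      have : b.1 ⊆ c.1 ∪ (b.1 \ c.1) := by intro j hj; simp [hj]
      exact (Finset.card_le_card this).trans (Finset.card_union_le _ _)
    set t := tt n (c.1.card + (b.1 \ c.1).card)
    rw [AA_nmem hic] at a1
    have a3 := abs_le.1 (a1.trans a2)
    rcases le_or_gt (b.2 i) (c.2 i) with h | h
    · have h' : (b.2 i : ℝ) ≤ c.2 i := by exact_mod_cast h
      have := neg_abs_le (u i)
      linarith
    · have h' : (c.2 i : ℝ) + 1 ≤ b.2 i := by exact_mod_cast h
      have := le_abs_self (u i)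
      linarith
  have A : ∀ i, i ∈ b.1 → b.2 i = c.2 i := by
    intro i hi
    have a1 := abs_le.1 (hb'.1 i hi)
    have a2 := abs_lt.1 (hc'.1 i (sub hi))
    have a3 : (b.2 i : ℝ) < c.2 i + 1 := by linarith
    have a4 : (c.2 i : ℝ) < b.2 i + 1 := by linarith
    have a3' : b.2 i < c.2 i + 1 := by exact_mod_cast a3
    have a4' : c.2 i < b.2 i + 1 := by exact_mod_cast a4
    omega
  have B : ∀ i, i ∉ c.1 → b.2 i = c.2 i := by
    intro i hi
    have a1 := hb'.2 i (fun h => hi (sub h))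
    have a2 := hc'.2 i hi
    have a3 : (b.2 i : ℝ) < c.2 i + 1 := by linarith
    have a4 : (c.2 i : ℝ) < b.2 i + 1 := by linarith
    have a3' : b.2 i < c.2 i + 1 := by exact_mod_cast a3
    have a4' : c.2 i < b.2 i + 1 := by exact_mod_cast a4
    omega
  refine ⟨sub, fun i => ?_, fun h => ?_⟩
  · by_cases hi : i ∈ b.1
    · rw [A i hi]; simp
    by_cases hi' : i ∈ c.1
    · have a1 := hb'.2 i hi
      have a2 := abs_lt.1 (hc'.1 i hi')
      have a3 : (b.2 i : ℝ) < c.2 i + 1 := by linarith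
      have a4 : (c.2 i : ℝ) < b.2 i + 2 := by linarith
      have a3' : b.2 i < c.2 i + 1 := by exact_mod_cast a3
      have a4' : c.2 i < b.2 i + 2 := by exact_mod_cast a4
      rw [abs_le]; constructor <;> omega
    · rw [B i hi']; simp
  · apply Prod.ext h
    ext i
    by_cases hi : i ∈ b.1
    · exact A i hi
    · exact B i (h ▸ hi)

/-- a whole neighbourhood of the vertex lies in `P`. -/
def deep (P : Set (Fin n → ℝ)) (b : Finset (Fin n) × (Fin n → ℤ)) : Prop :=
  ∀ y : Fin n → ℝ, (∀ i, |y i - b.2 i| ≤ 2 + 2 * ((n : ℝ) - b.1.card)) → y ∈ P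

lemma deep_step {P : Set (Fin n → ℝ)} {b c : Finset (Fin n) × (Fin n → ℤ)} (h : deep P b)
    (hbc : ∀ i, |b.2 i - c.2 i| ≤ 1) (hlt : b.1.card < c.1.card) : deep P c := by
  intro y hy
  apply h
  intro i
  have h1 := hy i
  have h2 : |(b.2 i : ℝ) - c.2 i| ≤ 1 := by exact_mod_cast hbc i
  have h3 : (b.1.card : ℝ) + 1 ≤ c.1.card := by exact_mod_cast hlt
  rw [abs_le] at *
  constructor <;> linarith

lemma HH_vert {b : Finset (Fin n) × (Fin n → ℤ)} {x : Fin n → ℝ} (hx : x ∈ HH b) (i : Fin n) :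
    |x i - b.2 i| ≤ 1 := by
  have := mem_HH.1 hx
  by_cases hi : i ∈ b.1
  · linarith [this.1 i hi, tt_le (card_le b.1)]
  · have := this.2 i hi
    rw [abs_le]; constructor <;> linarith

lemma VV_vert {b : Finset (Fin n) × (Fin n → ℤ)} {x : Fin n → ℝ} (hx : x ∈ VV b) (i : Fin n) :
    |x i - b.2 i| ≤ 1 := by
  have := VV_mem hx
  by_cases hi : i ∈ b.1
  · linarith [this.1 i hi]
  · have := this.2 i hi
    rw [abs_le]; constructor <;> linarith

lemma deep_HH {P : Set (Fin n → ℝ)} {b : Finset (Fin n) × (Fin n → ℤ)} (h : deep P b)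
    {x : Fin n → ℝ} (hx : x ∈ HH b) : x ∈ P := by
  apply h
  intro i
  have : (b.1.card : ℝ) ≤ n := by exact_mod_cast card_le b.1
  linarith [HH_vert hx i]

/-- handles that have to be processed. -/
def Proc (P : Set (Fin n → ℝ)) (N : ℕ) : Set (Finset (Fin n) × (Fin n → ℤ)) :=
  {b | (∀ i, |b.2 i| ≤ N + 1 + b.1.card) ∧ ¬ deep P b}

lemma Proc_fin (P : Set (Fin n → ℝ)) (N : ℕ) : (Proc P N).Finite := by
  refine (Set.Finite.prod (Set.finite_univ (α := Finset (Fin n)))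
    (Set.finite_Icc (fun _ : Fin n => -((N : ℤ) + 1 + n)) (fun _ => (N : ℤ) + 1 + n))).subset ?_
  intro b hb
  refine ⟨trivial, fun i => ?_, fun i => ?_⟩
  all_goals
    have h1 := abs_le.1 (hb.1 i)
    have h2 : (b.1.card : ℤ) ≤ n := by exact_mod_cast card_le b.1
    dsimp only
    linarith

variable {M : Type*} [MetricSpace M]

/-- the region fixed after processing `T`. -/
def Om (e : (Fin n → ℝ) → M) (C : Set M) (T : Finset (Finset (Fin n) × (Fin n → ℤ))) : Set M :=
  {m | (∃ b ∈ T, m ∈ e '' HH b) ∨ (m ∈ C ∧ ∀ b ∈ T, m ∉ e '' VV b)}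

lemma Om_red {e : (Fin n → ℝ) → M} (he : IsOpenEmbedding e) (C : Set M) (N : ℕ) (k : ℕ) :
    ∀ T : Finset (Finset (Fin n) × (Fin n → ℤ)), T.card = k →
      (∀ b ∈ T, b ∈ Proc (e ⁻¹' C) N) →
      (∀ a ∈ T, ∀ b ∈ Proc (e ⁻¹' C) N, a.1.card < b.1.card → b ∈ T) → Red n C (Om e C T) := by
  classical
  induction k with
  | zero =>
    intro T hT _ _
    rw [Finset.card_eq_zero] at hT
    subst hT
    refine (Red.refl C).mono subset_rfl ?_
    rintro m (⟨b, hb, _⟩ | h)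
    · simp at hb
    · exact h.1
  | succ k ih =>
    intro T hT hP hup
    have hne : T.Nonempty := by rw [← Finset.card_pos]; omega
    obtain ⟨a, ha, hmin⟩ := Finset.exists_min_image T (fun b => b.1.card) hne
    have ih' := ih (T.erase a) (by rw [Finset.card_erase_of_mem ha]; omega)
      (fun b hb => hP b (Finset.mem_of_mem_erase hb)) (by
        intro b hb c hc hlt
        refine Finset.mem_erase.2 ⟨?_, hup b (Finset.mem_of_mem_erase hb) c hc hlt⟩
        rintro rfl
        have := hmin b (Finset.mem_of_mem_erase hb)
        omega)
    refine ih'.trans ?_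
    have he' : IsOpenEmbedding (e ∘ AA a) := he.comp (AA a).isOpenEmbedding
    refine redHandle he' (ZZ_adm a.1) (tt_pos _ _) ?_ ?_
    · intro u hu hq
      obtain ⟨c, c1, c2, c3⟩ := ZZ_cover hu hq
      by_cases hc : c ∈ Proc (e ⁻¹' C) N
      · left
        refine ⟨c, Finset.mem_erase.2 ⟨?_, hup a ha c hc c1⟩, _, c3, rfl⟩
        rintro rfl; omega
      · have hd : deep (e ⁻¹' C) c := by
          by_contra hnd
          apply hc
          refine ⟨fun i => ?_, hnd⟩
          have h1 := (hP a ha).1 i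
          have h2 := c2 i
          have h3 : (a.1.card : ℤ) + 1 ≤ c.1.card := by exact_mod_cast c1
          rw [abs_le] at *
          constructor <;> linarith
        right
        refine ⟨deep_HH hd c3, ?_⟩
        rintro b hb ⟨x, hx, hxe⟩
        have hxx := he.injective hxe
        subst hxx
        obtain ⟨p1, p2, p3⟩ := HH_VV c3 hx
        have hbP := hP b (Finset.mem_of_mem_erase hb)
        rcases (Finset.card_le_card p1).lt_or_eq with h | h
        · exact hbP.2 (deep_step hd p2 h)
        · have := p3 (Finset.eq_of_subset_of_card_le p1 h.ge)
          subst this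
          exact hc hbP
    · have hV : (e ∘ AA a) '' {x | ‖x‖ < 3 ∧ x ∉ ZZ a.1} = e '' VV a := by
        rw [Set.image_comp]; rfl
      have hH : (e ∘ AA a) '' HQ a.1 1 = e '' HH a := by
        rw [Set.image_comp]; rfl
      rw [hV, hH]
      rintro m (⟨b, hb, hm⟩ | ⟨hm1, hm2⟩)
      · by_cases hab : b = a
        · subst hab; exact Or.inl hm
        right
        refine ⟨Or.inl ⟨b, Finset.mem_erase.2 ⟨hab, hb⟩, hm⟩, ?_⟩
        obtain ⟨x, hx, rfl⟩ := hm
        rintro ⟨y, hy, hxe⟩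
        have hxx := he.injective hxe
        subst hxx
        obtain ⟨p1, p2, p3⟩ := HH_VV hx hy
        exact hab (p3 (Finset.eq_of_subset_of_card_le p1 (hmin b hb)))
      · exact Or.inr ⟨Or.inr ⟨hm1, fun b hb => hm2 b (Finset.mem_of_mem_erase hb)⟩, hm2 a ha⟩

lemma chart_core {e : (Fin n → ℝ) → M} (he : IsOpenEmbedding e) {C C' : Set M} (hsub : C' ⊆ C)
    (N : ℕ) (ht : ∀ x y : Fin n → ℝ, ‖x‖ ≤ N + n + 5 → e x ∈ C' → ‖y - x‖ ≤ 2 * n + 6 → e y ∈ C) :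
    Red n C (C' ∪ e '' {x | ‖x‖ ≤ N}) := by
  classical
  set T := (Proc_fin (e ⁻¹' C) N).toFinset with hT
  have hTm : ∀ b, b ∈ T ↔ b ∈ Proc (e ⁻¹' C) N := by simp [hT]
  refine (Om_red he C N T.card T rfl (fun b hb => (hTm b).1 hb)
    (fun _ _ b hb _ => (hTm b).2 hb)).mono subset_rfl ?_
  rintro m (hm | ⟨x, hx, rfl⟩)
  · right
    refine ⟨hsub hm, ?_⟩
    rintro b hb ⟨x, hx, rfl⟩
    have hbP := (hTm b).1 hb
    apply hbP.2
    have hn0 : (0 : ℝ) ≤ n := Nat.cast_nonneg n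
    have hc : (b.1.card : ℝ) ≤ n := by exact_mod_cast card_le b.1
    intro y hy
    refine ht x y ?_ hm ?_
    · rw [pi_norm_le_iff_of_nonneg (by positivity)]
      intro i
      have h1 := VV_vert hx i
      have h2 : |(b.2 i : ℝ)| ≤ N + 1 + b.1.card := by exact_mod_cast hbP.1 i
      rw [Real.norm_eq_abs]
      rw [abs_le] at *
      constructor <;> linarith
    · apply norm_le_of_coord (by positivity)
      intro i
      have h1 := VV_vert hx i
      have h2 := hy i
      have h0 : (0 : ℝ) ≤ b.1.card := Nat.cast_nonneg _
      rw [abs_le] at *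
      constructor <;> linarith
  · set b : Finset (Fin n) × (Fin n → ℤ) := (∅, fun i => ⌊x i⌋) with hb
    have hxb : x ∈ HH b := by
      rw [mem_HH]
      refine ⟨by simp [hb], fun i _ => ⟨Int.floor_le _, (Int.lt_floor_add_one _).le⟩⟩
    by_cases hc : b ∈ Proc (e ⁻¹' C) N
    · exact Or.inl ⟨b, (hTm b).2 hc, x, hxb, rfl⟩
    · have hd : deep (e ⁻¹' C) b := by
        by_contra hnd
        apply hc
        refine ⟨fun i => ?_, hnd⟩
        have h1 : |x i| ≤ N := (norm_le_pi_norm x i).trans hx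
        have h2 := Int.floor_le (x i)
        have h3 := (Int.lt_floor_add_one (x i)).le
        simp only [hb, Finset.card_empty, Nat.cast_zero, add_zero]
        have : |((⌊x i⌋ : ℤ) : ℝ)| ≤ N + 1 := by
          rw [abs_le] at *
          constructor <;> linarith
        exact_mod_cast this
      right
      refine ⟨deep_HH hd hxb, ?_⟩
      rintro c hcT ⟨y, hy, hxe⟩
      have hxx := he.injective hxe
      subst hxx
      obtain ⟨p1, p2, p3⟩ := HH_VV hxb hy
      have hbP := (hTm c).1 hcT
      rcases (Finset.card_le_card p1).lt_or_eq with h | h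
      · exact hbP.2 (deep_step hd p2 h)
      · have := p3 (Finset.eq_of_subset_of_card_le p1 h.ge)
        rw [this] at hc
        exact hc hbP

lemma chart_step {e : (Fin n → ℝ) → M} (he : IsOpenEmbedding e) {C C' : Set M} (hcl : IsClosed C')
    (hsub : C' ⊆ interior C) {r : ℝ} (hr : 0 ≤ r) :
    Red n C (C' ∪ e '' Metric.closedBall 0 r) := by
  set R : ℝ := r + n + 6
  have hK : IsCompact (Metric.closedBall (0 : Fin n → ℝ) R ∩ e ⁻¹' C') :=
    (isCompact_closedBall _ _).inter_right (hcl.preimage he.continuous)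
  obtain ⟨δ, hδ, hth⟩ := hK.exists_thickening_subset_open
    (isOpen_interior.preimage he.continuous) (fun x hx => hsub hx.2)
  have hn0 : (0 : ℝ) ≤ n := Nat.cast_nonneg n
  set l : ℝ := min 1 (δ / (2 * n + 7)) with hl
  have hl0 : 0 < l := by positivity
  have hl1 : l ≤ 1 := min_le_left _ _
  have hl2 : l * (2 * n + 7) ≤ δ := by
    rw [← le_div_iff₀ (by positivity)]; exact min_le_right _ _
  have he' : IsOpenEmbedding (e ∘ (Homeomorph.smulOfNeZero l hl0.ne' : (Fin n → ℝ) ≃ₜ _)) :=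
    he.comp (Homeomorph.isOpenEmbedding _)
  set N := ⌈r / l⌉₊
  have hN1 : r ≤ N * l := by rw [← div_le_iff₀ hl0]; exact Nat.le_ceil _
  have hN2 : N * l ≤ r + l := by
    have := (Nat.ceil_lt_add_one (by positivity : 0 ≤ r / l)).le
    calc N * l ≤ (r / l + 1) * l := by gcongr
      _ = r + l := by field_simp
  refine (chart_core he' (hsub.trans interior_subset) N ?_).mono subset_rfl ?_
  · intro x y hx hxe hxy
    apply interior_subset (s := C)
    change l • y ∈ e ⁻¹' interior C
    apply hth
    rw [Metric.mem_thickening_iff]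
    refine ⟨l • x, ⟨?_, hxe⟩, ?_⟩
    · rw [mem_closedBall_zero_iff, norm_smul, Real.norm_of_nonneg hl0.le]
      calc l * ‖x‖ ≤ l * (N + n + 5) := by gcongr
        _ = N * l + l * (n + 5) := by ring
        _ ≤ r + l + 1 * (n + 5) := by gcongr
        _ ≤ R := by simp only [R]; linarith
    · rw [dist_eq_norm, ← smul_sub, norm_smul, Real.norm_of_nonneg hl0.le]
      nlinarith
  · apply Set.union_subset_union_right
    rintro _ ⟨x, hx, rfl⟩
    rw [mem_closedBall_zero_iff] at hx
    refine ⟨l⁻¹ • x, ?_, ?_⟩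
    · change ‖l⁻¹ • x‖ ≤ N
      rw [norm_smul, norm_inv, Real.norm_of_nonneg hl0.le, ← div_eq_inv_mul, div_le_iff₀ hl0]
      linarith
    · change e (l • l⁻¹ • x) = e x
      rw [smul_smul, mul_inv_cancel₀ hl0.ne', one_smul]

end cells

end Frag

namespace Frag

section final
variable {n : ℕ}

lemma charts_red {M : Type*} [MetricSpace M] {ι : Type*} {e : ι → (Fin n → ℝ) → M}
    (he : ∀ i, IsOpenEmbedding (e i)) (s : Finset ι) :
    ∀ r : ℝ, 0 ≤ r → Red n ∅ (⋃ i ∈ s, e i '' Metric.closedBall 0 r) := by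
  classical
  induction s using Finset.induction_on with
  | empty => intro r _; simpa using Red.refl (n := n) (∅ : Set M)
  | insert a s _ ih =>
    intro r hr
    refine (ih (r + 1) (by linarith)).trans ?_
    rw [Finset.set_biUnion_insert, Set.union_comm]
    apply chart_step (he a) _ _ hr
    · exact s.finite_toSet.isClosed_biUnion fun i _ =>
        ((isCompact_closedBall _ _).image (he i).continuous).isClosed
    · apply Set.iUnion₂_subset
      intro i hi
      refine (Set.image_mono
        (Metric.closedBall_subset_ball (by linarith : r < r + 1))).trans ?_
      apply interior_maximal _ ((he i).isOpenMap _ Metric.isOpen_ball)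
      exact (Set.image_mono Metric.ball_subset_closedBall).trans
        (Set.subset_biUnion_of_mem (u := fun i => e i '' Metric.closedBall 0 (r + 1)) hi)

lemma near_mem {M : Type*} [MetricSpace M] [CompactSpace M]
    (hM : ∀ x : M, ∃ e : (Fin n → ℝ) → M, IsOpenEmbedding e ∧ e 0 = x) :
    ∃ ε > 0, ∀ h : M ≃ₜ M, (∀ x, dist (h x) x < ε) → h ∈ GG M n := by
  choose e he h0 using hM
  obtain ⟨s, hs⟩ := isCompact_univ.elim_finite_subcover (fun x => e x '' Metric.ball 0 1)
    (fun x => (he x).isOpenMap _ Metric.isOpen_ball)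
    (fun x _ => Set.mem_iUnion.2 ⟨x, 0, by simp, h0 x⟩)
  obtain ⟨ε, hε, H⟩ := charts_red he s 1 zero_le_one 1 one_pos
  refine ⟨ε, hε, fun h hh => ?_⟩
  obtain ⟨f, hf, _, h2⟩ := H h hh (by simp)
  have : h = f := by
    ext x
    have hx : x ∈ ⋃ i ∈ s, e i '' Metric.closedBall 0 1 := by
      obtain ⟨i, hi, hx⟩ := Set.mem_iUnion₂.1 (hs (Set.mem_univ x))
      exact Set.mem_iUnion₂.2 ⟨i, hi, Set.image_mono Metric.ball_subset_closedBall hx⟩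
    have := h2 x hx
    rwa [Homeomorph.symm_apply_eq] at this
  rwa [this]

lemma iso_mem {M : Type*} [MetricSpace M] [CompactSpace M]
    (hM : ∀ x : M, ∃ e : (Fin n → ℝ) → M, IsOpenEmbedding e ∧ e 0 = x) {g : M ≃ₜ M}
    (hg : IsotopicToId g) : g ∈ GG M n := by
  obtain ⟨H, c, h0, h1, hh⟩ := hg
  choose f hf using hh
  obtain ⟨ε, hε, hG⟩ := near_mem hM
  obtain ⟨δ, hδ, Hδ⟩ := Metric.uniformContinuous_iff.1
    (CompactSpace.uniformContinuous_of_continuous c) ε hε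
  have step : ∀ s t, dist s t < δ → f t ∈ GG M n → f s ∈ GG M n := by
    intro s t hst ht
    have : f s * (f t)⁻¹ ∈ GG M n := by
      apply hG
      intro x
      obtain ⟨y, rfl⟩ := (f t).surjective x
      change dist (f s ((f t).symm (f t y))) (f t y) < ε
      rw [Homeomorph.symm_apply_apply, ← hf, ← hf]
      apply Hδ
      rw [Prod.dist_eq, dist_self]
      exact max_lt hst hδ
    have := mul_mem this ht
    rwa [inv_mul_cancel_right] at this
  have clopen : IsClopen {t | f t ∈ GG M n} := by
    refine ⟨?_, ?_⟩
    · rw [← isOpen_compl_iff, Metric.isOpen_iff]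
      intro t ht
      refine ⟨δ, hδ, fun s hs hs' => ht (step t s ?_ hs')⟩
      rw [dist_comm]; exact hs
    · rw [Metric.isOpen_iff]
      intro t ht
      exact ⟨δ, hδ, fun s hs => step s t hs ht⟩
  have hz : (0 : unitInterval) ∈ {t | f t ∈ GG M n} := by
    have : f 0 = 1 := by
      ext x
      rw [← hf, h0]; rfl
    change f 0 ∈ GG M n
    rw [this]; exact one_mem _
  have hu := clopen.eq_univ ⟨0, hz⟩
  have h1' : (1 : unitInterval) ∈ {t | f t ∈ GG M n} := by rw [hu]; trivial
  have : g = f 1 := by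
    ext x
    rw [← hf, h1]
  rw [this]; exact h1'

lemma foldr_prod {M : Type*} [TopologicalSpace M] (l : List (M ≃ₜ M)) (x : M) :
    (l.map fun h : M ≃ₜ M => (h : M → M)).foldr (· ∘ ·) id x = l.prod x := by
  induction l with
  | nil => rfl
  | cons a l ih =>
    rw [List.map_cons, List.foldr_cons, Function.comp_apply, ih, List.prod_cons]
    rfl

lemma gen_supp {M : Type*} [TopologicalSpace M] {f : M ≃ₜ M} (hf : f ∈ Gen M n) :
    ∃ e : EuclideanSpace ℝ (Fin n) → M, IsOpenEmbedding e ∧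
      ∀ x ∉ e '' Metric.ball (0 : EuclideanSpace ℝ (Fin n)) 1, f x = x := by
  obtain ⟨e, he, K, hK, hfix⟩ := hf
  set Lh : EuclideanSpace ℝ (Fin n) ≃ₜ (Fin n → ℝ) := (EuclideanSpace.equiv (Fin n) ℝ).toHomeomorph
  obtain ⟨R, hR, hb⟩ := (hK.image Lh.symm.continuous).isBounded.subset_ball_lt 0 0
  refine ⟨e ∘ Lh ∘ (Homeomorph.smulOfNeZero R hR.ne' : EuclideanSpace ℝ (Fin n) ≃ₜ _),
    he.comp (Lh.isOpenEmbedding.comp (Homeomorph.isOpenEmbedding _)), fun x hx => hfix x ?_⟩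
  rintro ⟨y, hy, rfl⟩
  apply hx
  have := hb ⟨y, hy, rfl⟩
  rw [mem_ball_zero_iff] at this
  refine ⟨R⁻¹ • Lh.symm y, ?_, ?_⟩
  · rw [mem_ball_zero_iff, norm_smul, norm_inv, Real.norm_of_nonneg hR.le, ← div_eq_inv_mul,
      div_lt_one hR]
    exact this
  · change e (Lh (R • R⁻¹ • Lh.symm y)) = e y
    rw [smul_smul, mul_inv_cancel₀ hR.ne', one_smul, Homeomorph.apply_symm_apply]

lemma charts {M : Type*} [TopologicalSpace M] (hM : ∀ x : M, ∃ U : Set M, IsOpen U ∧ x ∈ U ∧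
      Nonempty (U ≃ₜ EuclideanSpace ℝ (Fin n))) (x : M) :
    ∃ e : (Fin n → ℝ) → M, IsOpenEmbedding e ∧ e 0 = x := by
  obtain ⟨U, hU, hx, ⟨φ⟩⟩ := hM x
  set Lh : EuclideanSpace ℝ (Fin n) ≃ₜ (Fin n → ℝ) := (EuclideanSpace.equiv (Fin n) ℝ).toHomeomorph
  set ψ : (Fin n → ℝ) ≃ₜ U :=
    ((Homeomorph.addRight (Lh (φ ⟨x, hx⟩))).trans Lh.symm).trans φ.symm with hψ
  refine ⟨Subtype.val ∘ ψ, hU.isOpenEmbedding_subtypeVal.comp ψ.isOpenEmbedding, ?_⟩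
  simp [hψ]

end final

end Frag
/-- on a compact connected topological `d`-manifold without boundary, a
homeomorphism `g` is isotopic to the identity if and only if it is a finite composition
`g₁ ∘ ⋯ ∘ g_k` of homeomorphisms, each supported in `e_j(B)` for some open embedding
`e_j : ℝ^d → M`, with `B` the open unit ball of `ℝ^d`. -/
theorem stmt_4 (d : ℕ) (M : Type*) [TopologicalSpace M] [CompactSpace M] [ConnectedSpace M]
    [T2Space M] [SecondCountableTopology M] [Nonempty M]
    (hM : ∀ x : M, ∃ U : Set M, IsOpen U ∧ x ∈ U ∧
      Nonempty (U ≃ₜ EuclideanSpace ℝ (Fin d)))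
    (g : M ≃ₜ M) :
    IsotopicToId g ↔
      ∃ (k : ℕ) (gs : Fin k → M ≃ₜ M),
        (∀ j, ∃ e : EuclideanSpace ℝ (Fin d) → M, IsOpenEmbedding e ∧
          ∀ x ∉ e '' Metric.ball (0 : EuclideanSpace ℝ (Fin d)) 1, gs j x = x) ∧
        ∀ x, g x = (List.ofFn fun j => (⇑(gs j) : M → M)).foldr (· ∘ ·) id x := by
  constructor
  · intro hg
    have hmem : g ∈ Frag.GG M d := by
      let _ := TopologicalSpace.metrizableSpaceMetric M
      exact Frag.iso_mem (Frag.charts hM) hg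
    obtain ⟨l, hl, hp⟩ := Submonoid.exists_list_of_mem_closure hmem
    refine ⟨l.length, l.get, fun j => Frag.gen_supp (hl _ (List.get_mem l j)), fun x => ?_⟩
    have e : (List.ofFn fun j => (⇑(l.get j) : M → M)) = l.map fun h : M ≃ₜ M => (h : M → M) := by
      conv_rhs => rw [← List.ofFn_get l]
      rw [List.map_ofFn]
      rfl
    rw [e, Frag.foldr_prod, hp]
  · rintro ⟨k, gs, h1, h2⟩
    refine Frag.iso_list (List.ofFn gs) ?_ g ?_
    · intro h hh
      obtain ⟨j, rfl⟩ := (List.mem_ofFn' gs h).1 hh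
      obtain ⟨e, he, hs⟩ := h1 j
      exact Frag.iso_supp he hs
    · intro x
      rw [h2 x, List.map_ofFn]
      rfl
end

section
/- Let M be a nonempty compact metrizable space. The collection of all sets of the form U_𝒱(f) = {g ∈ Homeo(M) : g⁻¹ ∘ f ∈ U_𝒱}, as f ranges over Homeo(M) and 𝒱 ranges over finite open covers of M, is a basis for the compact-open topology on Homeo(M). -/
/-- The compact-open topology on the homeomorphism group `Homeo(M)`, as a subspace of the
space `C(M,M)` of continuous self-maps with the compact-open topology. -/
instance homeoCompactOpen {M : Type*} [TopologicalSpace M] : TopologicalSpace (M ≃ₜ M) :=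
  TopologicalSpace.induced (fun g : M ≃ₜ M => (⟨⇑g, g.continuous⟩ : C(M, M)))
    ContinuousMap.compactOpen

/-- for a nonempty compact metrizable space `M`, the sets
`U_𝒱(f) = {g ∈ Homeo(M) : g⁻¹ ∘ f ∈ U_𝒱}`, as `f` ranges over `Homeo(M)` and `𝒱` over finite
open covers of `M`, form a basis of the compact-open topology on `Homeo(M)`. -/
theorem stmt_6 (M : Type*) [TopologicalSpace M] [CompactSpace M]
    [TopologicalSpace.MetrizableSpace M] [Nonempty M] :
    TopologicalSpace.IsTopologicalBasis
      {S : Set (M ≃ₜ M) | ∃ (𝒱 : Finset (Set M)) (f : M ≃ₜ M),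
        (∀ V ∈ 𝒱, IsOpen V) ∧ ⋃₀ (𝒱 : Set (Set M)) = Set.univ ∧
        S = {g : M ≃ₜ M | ∀ p : M, ∃ V ∈ 𝒱, p ∈ V ∧ g.symm (f p) ∈ V}} := by
  classical
  apply TopologicalSpace.isTopologicalBasis_of_isOpen_of_nhds
  · rintro S ⟨𝒱, f, hopen, -, rfl⟩
    let W : Set (M × M) := ⋃ V ∈ 𝒱, V ×ˢ V
    have hW : IsOpen W := isOpen_biUnion fun V hV => (hopen V hV).prod (hopen V hV)
    let F : C(M, M) → C(M, M × M) := fun h =>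
      (ContinuousMap.id M).prodMk ((⟨⇑f.symm, f.symm.continuous⟩ : C(M, M)).comp h)
    have hF : Continuous F :=
      by
      exact ContinuousMap.continuous_of_continuous_uncurry _ (by
        simp only [Function.uncurry_def, F]
        exact continuous_snd.prodMk (f.symm.continuous.comp ContinuousEval.continuous_eval))
    have ho : IsOpen {h : C(M, M × M) | Set.MapsTo h Set.univ W} :=
      ContinuousMap.isOpen_setOf_mapsTo isCompact_univ hW
    have hι : Continuous (fun g : M ≃ₜ M => (⟨⇑g, g.continuous⟩ : C(M, M))) :=
      continuous_induced_dom
    convert ho.preimage (hF.comp hι) using 1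
    ext g
    have key : ∀ q : M, F ⟨⇑g, g.continuous⟩ q = (q, f.symm (g q)) := fun q => rfl
    simp only [Set.mem_setOf_eq, Set.mem_preimage, Function.comp_apply, Set.MapsTo, Set.mem_univ,
      true_imp_iff, key, W, Set.mem_iUnion, Set.mem_prod, exists_prop]
    constructor
    · intro h q
      obtain ⟨V, hV, h1, h2⟩ := h (f.symm (g q))
      exact ⟨V, hV, by simpa using h2, h1⟩
    · intro h p
      obtain ⟨V, hV, h1, h2⟩ := @h (g.symm (f p))
      exact ⟨V, hV, by simpa using h2, h1⟩
  · intro f O hf hO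
    letI := TopologicalSpace.metrizableSpaceMetric M
    obtain ⟨O', hO', rfl⟩ := isOpen_induced_iff.1 hO
    obtain ⟨ε, hε, hb⟩ := Metric.isOpen_iff.1 hO' _ hf
    obtain ⟨t, ht⟩ := (isCompact_univ (X := M)).elim_finite_subcover
      (fun y : M => Metric.ball y (ε / 2)) (fun y => Metric.isOpen_ball)
      (fun y _ => Set.mem_iUnion.2 ⟨y, Metric.mem_ball_self (half_pos hε)⟩)
    have hc : ∀ p : M, ∃ V ∈ t.image (fun y => f ⁻¹' Metric.ball y (ε / 2)), p ∈ V := by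
      intro p
      obtain ⟨y, hy, hp⟩ := Set.mem_iUnion₂.1 (ht (Set.mem_univ (f p)))
      exact ⟨_, Finset.mem_image_of_mem _ hy, hp⟩
    refine ⟨_, ⟨t.image (fun y => f ⁻¹' Metric.ball y (ε / 2)), f, ?_, ?_, rfl⟩, ?_, ?_⟩
    · intro V hV
      obtain ⟨y, -, rfl⟩ := Finset.mem_image.1 hV
      exact Metric.isOpen_ball.preimage f.continuous
    · exact Set.eq_univ_of_forall fun p => by
        obtain ⟨V, hV, hp⟩ := hc p
        exact ⟨V, hV, hp⟩
    · intro p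
      obtain ⟨V, hV, hp⟩ := hc p
      exact ⟨V, hV, hp, by simpa using hp⟩
    · intro g hg
      apply hb
      rw [Metric.mem_ball, ContinuousMap.dist_lt_iff hε]
      intro q
      obtain ⟨V, hV, h1, h2⟩ := hg (f.symm (g q))
      obtain ⟨y, -, rfl⟩ := Finset.mem_image.1 hV
      simp only [Set.mem_preimage, Homeomorph.apply_symm_apply, Homeomorph.symm_apply_apply,
        Metric.mem_ball] at h1 h2
      change dist (g q) (f q) < ε
      have := dist_triangle_right (g q) (f q) y
      linarith
end

section
/- Let M be a nonempty compact metrizable space. Every open subset of Homeo(M) is the union of countably many sets of the form U_{𝒱_i}(f_i), where each 𝒱_i is a finite open cover of M and each f_i ∈ Homeo(M). -/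
/-- for a nonempty compact metrizable space `M`, every open subset of `Homeo(M)`
is a union of countably many sets of the form `U_{𝒱ᵢ}(fᵢ)`, where each `𝒱ᵢ` is a finite open
cover of `M` and `fᵢ ∈ Homeo(M)`. -/
theorem stmt_7 (M : Type*) [TopologicalSpace M] [CompactSpace M]
    [TopologicalSpace.MetrizableSpace M] [Nonempty M]
    (O : Set (M ≃ₜ M)) (hO : IsOpen O) :
    ∃ S : Set (Set (M ≃ₜ M)), S.Countable ∧
      (∀ T ∈ S, ∃ (𝒱 : Finset (Set M)) (f : M ≃ₜ M),
        (∀ V ∈ 𝒱, IsOpen V) ∧ ⋃₀ (𝒱 : Set (Set M)) = Set.univ ∧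
        T = {g : M ≃ₜ M | ∀ p : M, ∃ V ∈ 𝒱, p ∈ V ∧ g.symm (f p) ∈ V}) ∧
      O = ⋃₀ S := by
  letI : MetricSpace M := TopologicalSpace.metrizableSpaceMetric M
  have hind : Topology.IsInducing (fun g : M ≃ₜ M => (⟨⇑g, g.continuous⟩ : C(M, M))) := ⟨rfl⟩
  haveI : SecondCountableTopology (M ≃ₜ M) := hind.secondCountableTopology
  -- local statement
  have key : ∀ g ∈ O, ∃ 𝒱 : Finset (Set M), (∀ V ∈ 𝒱, IsOpen V) ∧
      ⋃₀ (𝒱 : Set (Set M)) = Set.univ ∧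
      {h : M ≃ₜ M | ∀ p : M, ∃ V ∈ 𝒱, p ∈ V ∧ h.symm (g p) ∈ V} ⊆ O ∧
      {h : M ≃ₜ M | ∀ p : M, ∃ V ∈ 𝒱, p ∈ V ∧ h.symm (g p) ∈ V} ∈ nhds g := by
    intro g hg
    have hgn : O ∈ nhds g := hO.mem_nhds hg
    have hbasis := (Metric.nhds_basis_ball
      (x := (⟨⇑g, g.continuous⟩ : C(M, M)))).comap
        (fun g : M ≃ₜ M => (⟨⇑g, g.continuous⟩ : C(M, M)))
    rw [← hind.nhds_eq_comap g] at hbasis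
    obtain ⟨ε, hε, hεO⟩ := hbasis.mem_iff.1 hgn
    obtain ⟨η, hη, hgη⟩ := Metric.uniformContinuous_iff.1
      (CompactSpace.uniformContinuous_of_continuous g.continuous) ε hε
    obtain ⟨t, ht⟩ := isCompact_univ.elim_finite_subcover
      (fun x : M => Metric.ball x (η / 2)) (fun x => Metric.isOpen_ball)
      (fun x _ => Set.mem_iUnion.2 ⟨x, Metric.mem_ball_self (half_pos hη)⟩)
    classical
    obtain ⟨l, hl, hleb⟩ := lebesgue_number_lemma_of_metric (isCompact_univ (X := M))
      (c := fun x : t => Metric.ball (x : M) (η / 2)) (fun x => Metric.isOpen_ball)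
      (fun x hx => by
        obtain ⟨y, hy, hxy⟩ := Set.mem_iUnion₂.1 (ht hx)
        exact Set.mem_iUnion.2 ⟨⟨y, hy⟩, hxy⟩)
    obtain ⟨δ, hδ, hgδ⟩ := Metric.uniformContinuous_iff.1
      (CompactSpace.uniformContinuous_of_continuous g.symm.continuous) l hl
    refine ⟨t.image (fun x => Metric.ball x (η / 2)), ?_, ?_, ?_, ?_⟩
    · intro V hV
      obtain ⟨x, -, rfl⟩ := Finset.mem_image.1 hV
      exact Metric.isOpen_ball
    · refine Set.eq_univ_of_forall fun x => ?_
      obtain ⟨y, hy, hxy⟩ := Set.mem_iUnion₂.1 (ht (Set.mem_univ x))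
      exact ⟨_, Finset.mem_coe.2 (Finset.mem_image.2 ⟨y, hy, rfl⟩), hxy⟩
    · intro h hh
      apply hεO
      rw [Set.mem_preimage, Metric.mem_ball, ContinuousMap.dist_lt_iff hε]
      intro q
      obtain ⟨V, hV, h1, h2⟩ := hh (g.symm (h q))
      obtain ⟨x, -, rfl⟩ := Finset.mem_image.1 hV
      simp only [Homeomorph.apply_symm_apply, Homeomorph.symm_apply_apply,
        Metric.mem_ball] at h1 h2
      have h3 : dist (g.symm (h q)) q < η := by
        have := dist_triangle_right (g.symm (h q)) q x
        linarith
      have h4 := hgη h3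
      rw [Homeomorph.apply_symm_apply] at h4
      exact h4
    · refine hbasis.mem_iff.2 ⟨δ, hδ, ?_⟩
      intro h hh p
      rw [Set.mem_preimage, Metric.mem_ball, ContinuousMap.dist_lt_iff hδ] at hh
      have h1 : dist (h (h.symm (g p))) (g (h.symm (g p))) < δ := hh (h.symm (g p))
      rw [Homeomorph.apply_symm_apply, dist_comm] at h1
      have h2 := hgδ h1
      rw [Homeomorph.symm_apply_apply, Homeomorph.symm_apply_apply] at h2
      obtain ⟨x, hx⟩ := hleb p (Set.mem_univ p)
      exact ⟨_, Finset.mem_image.2 ⟨x, x.2, rfl⟩, hx (Metric.mem_ball_self hl), hx h2⟩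
  choose! 𝒱 h1 h2 h3 h4 using key
  obtain ⟨s, hsO, hsc, hs⟩ := TopologicalSpace.countable_cover_nhdsWithin
    (fun g hg => mem_nhdsWithin_of_mem_nhds (h4 g hg))
  refine ⟨(fun g => {h : M ≃ₜ M | ∀ p : M, ∃ V ∈ 𝒱 g, p ∈ V ∧ h.symm (g p) ∈ V}) '' s,
    hsc.image _, ?_, ?_⟩
  · rintro _ ⟨g, hg, rfl⟩
    exact ⟨𝒱 g, g, h1 g (hsO hg), h2 g (hsO hg), rfl⟩
  · apply Set.Subset.antisymm
    · intro h hh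
      obtain ⟨g, hg, hgh⟩ := Set.mem_iUnion₂.1 (hs hh)
      exact ⟨_, ⟨g, hg, rfl⟩, hgh⟩
    · rintro h ⟨_, ⟨g, hg, rfl⟩, hgh⟩
      exact h3 g (hsO hg) hgh
end

section
/- For every integer d ≥ 1 and every compact set K contained in the open unit ball B of ℝ^d, there exists a homeomorphism g of ℝ^d supported in B such that the sets g^i(K), for i ∈ ℕ, are pairwise disjoint: g^i(K) ∩ g^j(K) = ∅ whenever i ≠ j. -/
/-- Key lemma: a map pushing in a fixed direction cannot keep two points of a smaller ball for long. -/
theorem push_bound {E : Type*} [NormedAddCommGroup E] [NormedSpace ℝ E] (e : E) (he : ‖e‖ = 1)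
    (g : E → E) (hg : ∀ x, g x = x + ((1/2 : ℝ) * max 0 (1 - ‖x‖)) • e)
    (R : ℝ) (hR : R < 1) (x : E) (hx : x ∈ Metric.ball (0 : E) R) (m : ℕ)
    (hm : g^[m] x ∈ Metric.ball (0 : E) R) : (m : ℝ) * ((1 - R) / 2) < 2 := by
  set T : ℕ → ℝ := fun k => ∑ i ∈ Finset.range k, (1/2 : ℝ) * max 0 (1 - ‖g^[i] x‖) with hT
  have hTs : ∀ k, T (k+1) = T k + (1/2 : ℝ) * max 0 (1 - ‖g^[k] x‖) := fun k =>
    Finset.sum_range_succ _ _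
  have hT0 : T 0 = 0 := by simp [hT]
  have hgT : ∀ k, g^[k] x = x + T k • e := by
    intro k
    induction k with
    | zero => simp [hT0]
    | succ k ih =>
      rw [Function.iterate_succ_apply', hg, hTs, add_smul, ← add_assoc, ← ih]
  have hmono : Monotone T := monotone_nat_of_le_succ (fun k => by
    rw [hTs]; have := le_max_left 0 (1 - ‖g^[k] x‖); linarith)
  have hball : ∀ i ≤ m, g^[i] x ∈ Metric.ball (0 : E) R := by
    intro i hi
    have h0 : 0 ≤ T i := by rw [← hT0]; exact hmono (Nat.zero_le i)
    have h1 : T i ≤ T m := hmono hi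
    rcases eq_or_lt_of_le (h0.trans h1) with h | h
    · have : T i = 0 := by linarith
      rw [hgT, this]; simpa using hx
    · have hc := (convex_ball (0 : E) R) hx hm
        (show 0 ≤ 1 - T i / T m by rw [sub_nonneg, div_le_one h]; exact h1)
        (show 0 ≤ T i / T m by positivity) (by ring)
      convert hc using 1
      rw [hgT, hgT, smul_add, smul_smul, div_mul_cancel₀ _ h.ne', sub_smul, one_smul]
      abel
  have hlow : ∀ i ≤ m, (i : ℝ) * ((1 - R) / 2) ≤ T i := by
    intro i
    induction i with
    | zero => intro _; simp [hT0]
    | succ i ih =>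
      intro hi
      have h1 := ih (by omega)
      have h2 := hball i (by omega)
      rw [mem_ball_zero_iff] at h2
      have := le_max_right 0 (1 - ‖g^[i] x‖)
      rw [hTs]; push_cast; linarith
  have hTm : T m < 2 := by
    have h0 : 0 ≤ T m := by rw [← hT0]; exact hmono (Nat.zero_le m)
    have h1 : g^[m] x - x = T m • e := by rw [hgT]; abel
    have h2 : ‖g^[m] x - x‖ = T m := by
      rw [h1, norm_smul, he, mul_one, Real.norm_of_nonneg h0]
    have h3 := norm_sub_le (g^[m] x) x
    rw [mem_ball_zero_iff] at hx hm
    linarith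
  linarith [hlow m le_rfl]

theorem push_exists {E : Type*} [NormedAddCommGroup E] [NormedSpace ℝ E] [CompleteSpace E]
    [Nontrivial E] (e : E) (he : ‖e‖ = 1) :
    ∃ g : E ≃ₜ E, ∀ x, g x = x + ((1/2 : ℝ) * max 0 (1 - ‖x‖)) • e := by
  have h : ApproximatesLinearOn (fun x : E => x + ((1/2 : ℝ) * max 0 (1 - ‖x‖)) • e)
      ((ContinuousLinearEquiv.refl ℝ E : E ≃L[ℝ] E) : E →L[ℝ] E) Set.univ (1/2 : NNReal) := by
    intro x _ y _
    have h1 : x + ((1/2 : ℝ) * max 0 (1 - ‖x‖)) • e - (y + ((1/2 : ℝ) * max 0 (1 - ‖y‖)) • e)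
        - ((ContinuousLinearEquiv.refl ℝ E : E ≃L[ℝ] E) : E →L[ℝ] E) (x - y)
        = ((1/2 : ℝ) * (max 0 (1 - ‖x‖) - max 0 (1 - ‖y‖))) • e := by
      simp only [ContinuousLinearEquiv.coe_coe, ContinuousLinearEquiv.refl_apply, mul_sub, sub_smul]
      abel
    rw [h1, norm_smul, he, mul_one, norm_mul]
    have h2 : |max 0 (1 - ‖x‖) - max 0 (1 - ‖y‖)| ≤ ‖x - y‖ := by
      have h3 := abs_max_sub_max_le_max 0 (1 - ‖x‖) 0 (1 - ‖y‖)
      have h4 : |(1 - ‖x‖) - (1 - ‖y‖)| ≤ ‖x - y‖ := by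
        rw [show (1 - ‖x‖) - (1 - ‖y‖) = ‖y‖ - ‖x‖ by ring, abs_sub_comm]
        exact abs_norm_sub_norm_le x y
      refine h3.trans (max_le (by simp) h4)
    rw [Real.norm_eq_abs, Real.norm_eq_abs, abs_of_pos (by norm_num : (0:ℝ) < 1/2)]
    push_cast
    linarith
  refine ⟨h.toHomeomorph _ (Or.inr ?_), fun x => rfl⟩
  have : ‖(((ContinuousLinearEquiv.refl ℝ E).symm : E ≃L[ℝ] E) : E →L[ℝ] E)‖₊ = 1 := by
    apply NNReal.eq
    exact ContinuousLinearMap.norm_id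
  rw [this, inv_one]
  exact NNReal.half_lt_self one_ne_zero

theorem homeo_iterate {E : Type*} [TopologicalSpace E] (g : E ≃ₜ E) (n : ℕ) :
    ∃ f : E ≃ₜ E, ⇑f = (⇑g)^[n] := by
  induction n with
  | zero => exact ⟨Homeomorph.refl E, rfl⟩
  | succ n ih =>
    obtain ⟨f, hf⟩ := ih
    refine ⟨g.trans f, ?_⟩
    rw [Function.iterate_succ, ← hf]; rfl


/-- for every `d ≥ 1` and every compact set `K` contained in the open unit ball
`B` of `ℝ^d`, there exists a homeomorphism `g` of `ℝ^d` supported in `B` whose iterated images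
`g^i(K)`, `i ∈ ℕ`, are pairwise disjoint. -/
theorem stmt_9 (d : ℕ) (hd : 1 ≤ d) (K : Set (EuclideanSpace ℝ (Fin d)))
    (hK : IsCompact K) (hKB : K ⊆ Metric.ball (0 : EuclideanSpace ℝ (Fin d)) 1) :
    ∃ g : EuclideanSpace ℝ (Fin d) ≃ₜ EuclideanSpace ℝ (Fin d),
      (∀ x ∉ Metric.ball (0 : EuclideanSpace ℝ (Fin d)) 1, g x = x) ∧
      ∀ i j : ℕ, i ≠ j → (⇑g)^[i] '' K ∩ (⇑g)^[j] '' K = ∅ := by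
  have key : ∃ e : EuclideanSpace ℝ (Fin d), ‖e‖ = 1 :=
    ⟨EuclideanSpace.single ⟨0, hd⟩ 1, by simp⟩
  obtain ⟨e, he⟩ := key
  have hnt : Nontrivial (EuclideanSpace ℝ (Fin d)) :=
    ⟨e, 0, by rintro rfl; simp at he⟩
  obtain ⟨g, hg⟩ := push_exists e he
  obtain ⟨R, hR, hKR⟩ := exists_lt_subset_ball hK.isClosed hKB
  obtain ⟨N, hN⟩ := exists_nat_ge (2 / ((1 - R) / 2))
  have hpos : 0 < (1 - R) / 2 := by linarith
  rw [div_le_iff₀ hpos] at hN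
  obtain ⟨f, hf⟩ := homeo_iterate g N
  refine ⟨f, ?_, ?_⟩
  · intro x hx
    have hfix : g x = x := by
      rw [mem_ball_zero_iff, not_lt] at hx
      rw [hg, max_eq_left (by linarith)]; simp
    rw [hf]
    exact Function.iterate_fixed hfix N
  · have main : ∀ i k : ℕ, ∀ a ∈ K, ∀ b ∈ K, (⇑f)^[i] a ≠ (⇑f)^[i + (k + 1)] b := by
      intro i k a ha b hb h
      rw [Function.iterate_add_apply] at h
      have h1 := f.injective.iterate i h
      rw [hf, ← Function.iterate_mul] at h1
      have h2 := push_bound e he g hg R hR b (hKR hb) (N * (k + 1)) (h1 ▸ hKR ha)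
      push_cast at h2
      have h3 : 0 ≤ (N : ℝ) * k * ((1 - R) / 2) := by positivity
      nlinarith
    intro i j hij
    rw [Set.eq_empty_iff_forall_notMem]
    rintro y ⟨⟨a, ha, rfl⟩, ⟨b, hb, hab⟩⟩
    rcases lt_or_gt_of_ne hij with h | h
    · obtain ⟨k, rfl⟩ := Nat.exists_eq_add_of_lt h
      exact main i k a ha b hb hab.symm
    · obtain ⟨k, rfl⟩ := Nat.exists_eq_add_of_lt h
      exact main j k b hb a ha hab
end

section
/- Let M be a compact connected topological d-manifold without boundary, let e : ℝ^d → M be an open embedding, let K be a compact subset of M with K ⊆ e(B), where B is the open unit ball of ℝ^d, and let V ⊆ M be a nonempty open set. Then there exists a homeomorphism g of M, isotopic to the identity, such that g(K) ⊆ V. -/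
open Topology

namespace Stmt15

theorem isotopic_comp {M : Type*} [TopologicalSpace M] {g h : M ≃ₜ M}
    (hg : IsotopicToId g) (hh : IsotopicToId h) : IsotopicToId (g.trans h) := by
  obtain ⟨G, hGc, hG0, hG1, hG⟩ := hg
  obtain ⟨H, hHc, hH0, hH1, hH⟩ := hh
  refine ⟨fun p => H (p.1, G p), by fun_prop, ?_, ?_, ?_⟩
  · intro x; simp [hG0, hH0]
  · intro x; simp [hG1, hH1]
  · intro t
    obtain ⟨a, ha⟩ := hG t
    obtain ⟨b, hb⟩ := hH t
    exact ⟨a.trans b, fun x => by simp [ha, hb]⟩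

/-- radial scaling factor -/
noncomputable def s (l r : ℝ) : ℝ := max l (min 1 (r - 1))

theorem s_pos {l : ℝ} (hl : 0 < l) (r : ℝ) : 0 < s l r := lt_max_of_lt_left hl

theorem s_mono (l : ℝ) : Monotone (s l) := by
  intro a b h
  unfold s
  gcongr

theorem phi_strict {l : ℝ} (hl : 0 < l) {a b : ℝ} (ha : 0 ≤ a) (hab : a < b) :
    s l a * a < s l b * b := by
  have h1 := s_mono l hab.le
  have h2 := s_pos hl b
  nlinarith

variable {E : Type*} [NormedAddCommGroup E] [NormedSpace ℝ E]

theorem Phi_inj {l : ℝ} (hl : 0 < l) : Function.Injective (fun x : E => s l ‖x‖ • x) := by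
  intro x y h
  have hn : s l ‖x‖ * ‖x‖ = s l ‖y‖ * ‖y‖ := by
    have := congrArg norm h
    simpa [norm_smul, abs_of_pos (s_pos hl _)] using this
  have hxy : ‖x‖ = ‖y‖ := by
    rcases lt_trichotomy ‖x‖ ‖y‖ with h | h | h
    · exact absurd hn (phi_strict hl (norm_nonneg _) h).ne
    · exact h
    · exact absurd hn (phi_strict hl (norm_nonneg _) h).ne'
  simp only [hxy] at h
  exact smul_right_injective E (s_pos hl ‖y‖).ne' h

theorem Phi_surj {l : ℝ} (hl : 0 < l) : Function.Surjective (fun x : E => s l ‖x‖ • x) := by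
  intro y
  have hc : Continuous (fun r : ℝ => s l r * r) := by unfold s; fun_prop
  have h0 : (0:ℝ) ≤ ‖y‖ + 2 := by positivity
  have hmem : ‖y‖ ∈ Set.Icc (s l 0 * 0) (s l (‖y‖ + 2) * (‖y‖ + 2)) := by
    refine ⟨by simp, ?_⟩
    have : 1 ≤ s l (‖y‖ + 2) := by
      refine le_max_of_le_right (le_min le_rfl ?_)
      linarith [norm_nonneg y]
    nlinarith [norm_nonneg y]
  obtain ⟨r, hr, hry⟩ := intermediate_value_Icc h0 hc.continuousOn hmem
  have hs := s_pos hl r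
  refine ⟨(s l r)⁻¹ • y, ?_⟩
  have : ‖(s l r)⁻¹ • y‖ = r := by
    rw [norm_smul, norm_inv, Real.norm_eq_abs, abs_of_pos hs, ← hry]
    field_simp
  simp only [this]
  rw [smul_smul, mul_inv_cancel₀ hs.ne', one_smul]

theorem Phi_id {l : ℝ} (hl : l ≤ 1) {x : E} (hx : 2 ≤ ‖x‖) : s l ‖x‖ • x = x := by
  have : s l ‖x‖ = 1 := by
    unfold s
    rw [min_eq_left (by linarith), max_eq_right hl]
  rw [this, one_smul]

theorem squeeze [ProperSpace E] {M : Type*} [TopologicalSpace M] [CompactSpace M] [T2Space M]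
    (f : E → M) (hf : IsOpenEmbedding f) (l : ℝ) (hl : 0 < l) (hl1 : l ≤ 1) :
    ∃ g : M ≃ₜ M, IsotopicToId g ∧ ∀ x, ‖x‖ ≤ 1 → g (f x) = f (l • x) := by
  classical
  let L : unitInterval → ℝ := fun t => 1 - t + t * l
  have hLc : Continuous L := by fun_prop
  have hLpos : ∀ t, 0 < L t := fun t => by
    have := t.2.1; have := t.2.2
    simp only [L]
    rcases eq_or_lt_of_le t.2.1 with h | h
    · rw [← h]; simp
    · nlinarith [mul_pos h hl]
  have hL1 : ∀ t, L t ≤ 1 := fun t => by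
    have := t.2.1; have := t.2.2
    simp only [L]
    nlinarith
  let H : unitInterval × M → M := fun p =>
    if p.2 ∈ Set.range f then
      f (s (L p.1) ‖Function.invFun f p.2‖ • Function.invFun f p.2) else p.2
  have Hf : ∀ t x, H (t, f x) = f (s (L t) ‖x‖ • x) := by
    intro t x
    simp [H, Function.leftInverse_invFun hf.injective x]
  have Hn : ∀ t m, m ∉ Set.range f → H (t, m) = m := by
    intro t m hm
    simp only [H, if_neg hm]
  have Hc : Continuous H := by
    rw [continuous_iff_continuousAt]
    rintro ⟨t, m⟩
    by_cases hm : m ∈ Set.range f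
    · obtain ⟨x, rfl⟩ := hm
      have hop : IsOpenEmbedding (Prod.map (id : unitInterval → unitInterval) f) :=
        IsOpenEmbedding.id.prodMap hf
      have : ContinuousAt (H ∘ Prod.map (id : unitInterval → unitInterval) f) (t, x) := by
        have he : H ∘ Prod.map (id : unitInterval → unitInterval) f =
            fun p => f (s (L p.1) ‖p.2‖ • p.2) := by
          ext ⟨t, x⟩; exact Hf t x
        rw [he]
        have hfc := hf.continuous
        unfold s
        exact Continuous.continuousAt (by fun_prop)
      exact (hop.continuousAt_iff).1 this
    · have hcl : IsClosed (f '' Metric.closedBall 0 2) :=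
        ((isCompact_closedBall (0:E) 2).image hf.continuous).isClosed
      have hnb : Prod.snd ⁻¹' (f '' Metric.closedBall 0 2)ᶜ ∈ 𝓝 (t, m) :=
        (hcl.isOpen_compl.preimage continuous_snd).mem_nhds
          (fun h => hm (Set.image_subset_range _ _ h))
      have heq : H =ᶠ[𝓝 (t, m)] Prod.snd := by
        filter_upwards [hnb]
        rintro ⟨t', m'⟩ h
        by_cases hm' : m' ∈ Set.range f
        · obtain ⟨x, rfl⟩ := hm'
          have hx : 2 ≤ ‖x‖ := by
            by_contra hlt
            exact h ⟨x, by simpa using (not_le.1 hlt).le, rfl⟩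
          rw [Hf, Phi_id (hL1 _) hx]
        · exact Hn _ _ hm'
      exact continuousAt_snd.congr heq.symm
  have Hbij : ∀ t, Function.Bijective (fun m => H (t, m)) := by
    intro t
    constructor
    · intro a b hab
      simp only at hab
      by_cases ha : a ∈ Set.range f <;> by_cases hb : b ∈ Set.range f
      · obtain ⟨x, rfl⟩ := ha
        obtain ⟨y, rfl⟩ := hb
        rw [Hf, Hf] at hab
        rw [Phi_inj (hLpos t) (hf.injective hab)]
      · obtain ⟨x, rfl⟩ := ha
        rw [Hf, Hn _ _ hb] at hab
        exact absurd ⟨_, hab⟩ hb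
      · obtain ⟨x, rfl⟩ := hb
        rw [Hf, Hn _ _ ha] at hab
        exact absurd ⟨_, hab.symm⟩ ha
      · rwa [Hn _ _ ha, Hn _ _ hb] at hab
    · intro b
      by_cases hb : b ∈ Set.range f
      · obtain ⟨y, rfl⟩ := hb
        obtain ⟨x, hx⟩ := Phi_surj (hLpos t) y
        exact ⟨f x, by simp only [Hf]; exact congrArg f hx⟩
      · exact ⟨b, Hn _ _ hb⟩
  have hcont : ∀ t, Continuous (fun m => H (t, m)) := fun t => by fun_prop
  let h : unitInterval → (M ≃ₜ M) := fun t =>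
    Continuous.homeoOfEquivCompactToT2 (f := Equiv.ofBijective _ (Hbij t)) (hcont t)
  have hh : ∀ t x, h t x = H (t, x) := fun t x => rfl
  refine ⟨h 1, ⟨H, Hc, ?_, fun x => (hh 1 x).symm, fun t => ⟨h t, fun x => (hh t x).symm⟩⟩, ?_⟩
  · intro m
    by_cases hm : m ∈ Set.range f
    · obtain ⟨x, rfl⟩ := hm
      have : s (L 0) ‖x‖ = 1 := by simp [s, L]
      rw [Hf, this, one_smul]
    · exact Hn _ _ hm
  · intro x hx
    have : s (L 1) ‖x‖ = l := by
      simp only [s, L, Set.Icc.coe_one]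
      rw [max_eq_left]
      · ring
      · exact (min_le_right _ _).trans (by linarith)
    rw [hh, Hf, this]

theorem local_move [ProperSpace E] {M : Type*} [TopologicalSpace M] [CompactSpace M] [T2Space M]
    (f : E → M) (hf : IsOpenEmbedding f) (C : Set M) (hC : IsCompact C) (hCf : C ⊆ Set.range f)
    (w : E) (V : Set M) (hV : V ∈ 𝓝 (f w)) :
    ∃ g : M ≃ₜ M, IsotopicToId g ∧ g '' C ⊆ V := by
  have hCc : IsCompact (f ⁻¹' C) := hf.isInducing.isCompact_preimage' hC hCf
  obtain ⟨R, hR0, hR⟩ := hCc.isBounded.subset_closedBall_lt 0 w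
  obtain ⟨r, hr0, hr⟩ := Metric.mem_nhds_iff.1 (hf.continuous.continuousAt hV)
  let a : E ≃ₜ E := (Homeomorph.smulOfNeZero R hR0.ne').trans (Homeomorph.addLeft w)
  have ha : ∀ x, a x = w + R • x := fun x => rfl
  let l := min 1 (r / (2 * R))
  have hl : 0 < l := by positivity
  obtain ⟨g, hg, hgf⟩ := squeeze (f ∘ a) (hf.comp a.isOpenEmbedding) l hl (min_le_left _ _)
  refine ⟨g, hg, ?_⟩
  rintro _ ⟨c, hc, rfl⟩
  obtain ⟨y, rfl⟩ := hCf hc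
  have hy : ‖y - w‖ ≤ R := by simpa [dist_eq_norm] using hR hc
  obtain ⟨x, rfl⟩ := a.surjective y
  have hx : ‖x‖ ≤ 1 := by
    rw [ha, add_sub_cancel_left, norm_smul, Real.norm_eq_abs, abs_of_pos hR0] at hy
    exact le_of_mul_le_mul_left (by simpa using hy) hR0
  have := hgf x hx
  simp only [Function.comp] at this
  rw [this]
  apply hr
  rw [Metric.mem_ball, dist_eq_norm, ha, add_sub_cancel_left, norm_smul, norm_smul,
    Real.norm_eq_abs, Real.norm_eq_abs, abs_of_pos hR0, abs_of_pos hl]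
  have h1 : l ≤ r / (2 * R) := min_le_right _ _
  have h2 : l * ‖x‖ ≤ r / (2 * R) := by nlinarith [norm_nonneg x]
  calc R * (l * ‖x‖) ≤ R * (r / (2 * R)) := by gcongr
    _ = r / 2 := by field_simp
    _ < r := by linarith

end Stmt15

/-- let `M` be a compact connected topological `d`-manifold without boundary, let
`e : ℝ^d → M` be an open embedding, let `K ⊆ e(B)` be compact (`B` the open unit ball) and let
`V ⊆ M` be nonempty open. Then there is a homeomorphism `g` of `M`, isotopic to the identity,
with `g(K) ⊆ V`. -/
theorem stmt_15 (d : ℕ) (M : Type*) [TopologicalSpace M] [CompactSpace M] [ConnectedSpace M]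
    [T2Space M] [SecondCountableTopology M] [Nonempty M]
    (hM : ∀ x : M, ∃ U : Set M, IsOpen U ∧ x ∈ U ∧
      Nonempty (U ≃ₜ EuclideanSpace ℝ (Fin d)))
    (e : EuclideanSpace ℝ (Fin d) → M) (he : IsOpenEmbedding e)
    (K : Set M) (hK : IsCompact K)
    (hKe : K ⊆ e '' Metric.ball (0 : EuclideanSpace ℝ (Fin d)) 1)
    (V : Set M) (hV : IsOpen V) (hVne : V.Nonempty) :
    ∃ g : M ≃ₜ M, IsotopicToId g ∧ g '' K ⊆ V := by
  let S : Set M := {y | ∀ W ∈ 𝓝 y, ∃ g : M ≃ₜ M, IsotopicToId g ∧ g '' K ⊆ W}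
  have hne : S.Nonempty := ⟨e 0, fun W hW =>
    Stmt15.local_move e he K hK (hKe.trans (Set.image_subset_range _ _)) 0 W hW⟩
  have hcl : IsClosed S := by
    refine isClosed_of_closure_subset fun y hy W hW => ?_
    obtain ⟨O, hOW, hO, hyO⟩ := mem_nhds_iff.1 hW
    obtain ⟨z, hzO, hz⟩ := mem_closure_iff.1 hy O hO hyO
    exact hz W (Filter.mem_of_superset (hO.mem_nhds hzO) hOW)
  have hop : IsOpen S := by
    rw [isOpen_iff_mem_nhds]
    intro y hy
    obtain ⟨U, hU, hyU, ⟨φ⟩⟩ := hM y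
    obtain ⟨g₁, hg₁, hgK⟩ := hy U (hU.mem_nhds hyU)
    refine Filter.mem_of_superset (hU.mem_nhds hyU) fun z hz W hW => ?_
    have hf : IsOpenEmbedding (Subtype.val ∘ φ.symm : EuclideanSpace ℝ (Fin d) → M) :=
      hU.isOpenEmbedding_subtypeVal.comp φ.symm.isOpenEmbedding
    obtain ⟨g₂, hg₂, hgK₂⟩ := Stmt15.local_move _ hf (g₁ '' K) (hK.image g₁.continuous)
      (fun m hm => ⟨φ ⟨m, hgK hm⟩, by simp⟩) (φ ⟨z, hz⟩) W (by simpa using hW)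
    refine ⟨g₁.trans g₂, Stmt15.isotopic_comp hg₁ hg₂, ?_⟩
    rw [Set.image_image] at hgK₂
    exact hgK₂
  have huniv : S = Set.univ := IsClopen.eq_univ ⟨hcl, hop⟩ hne
  obtain ⟨v, hv⟩ := hVne
  have : v ∈ S := huniv ▸ Set.mem_univ v
  exact this V (hV.mem_nhds hv)
end
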